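/- There exist absolute constants c₁ > 0 and c₂ > 0 with the following property. Let p be a prime with log log p > 0, let ε ∈ (0, 1/2), and let G ⊆ F_p be a proper generalized arithmetic progression with G ⊆ R and rank rk(G) ≤ c₁ · ε³ · (log p)/(log log p). Then |G| ≤ c₂ · p^{1/4 + ε}. -/

import Mathlib

open Finset Pointwise

/-- The set of nonzero quadratic residues in `F_p`. -/
def quadRes (p : ℕ) [Fact p.Prime] : Finset (ZMod p) :=
  Finset.univ.filter fun x => ∃ y : ZMod p, y ≠ 0 ∧ y ^ 2 = x

/-- An arithmetic progression `{a, a+d, …, a+(k−1)d}` in `F_p`. -/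
def IsAP (p : ℕ) [Fact p.Prime] (H : Finset (ZMod p)) : Prop :=
  ∃ (a d : ZMod p) (k : ℕ), H = (Finset.range k).image fun i : ℕ => a + (i : ZMod p) * d

/-- `G` is a proper generalized arithmetic progression of rank `r`:
`G = P₁ + … + P_r` with each `P_j` an arithmetic progression, and `|G| = ∏ |P_j|`. -/
def IsProperGAP (p : ℕ) [Fact p.Prime] (r : ℕ) (G : Finset (ZMod p)) : Prop :=
  ∃ P : Fin r → Finset (ZMod p),
    (∀ j, IsAP p (P j)) ∧ G = ∑ j, P j ∧ G.card = ∏ j, (P j).card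

set_option linter.unusedSectionVars false

section GramDeterminant

variable {E : Type*} [NormedAddCommGroup E] [InnerProductSpace ℝ E]

/-- The Gram determinant of a finite family of vectors. -/
noncomputable def gramDet {ι : Type*} [Fintype ι] [DecidableEq ι] (v : ι → E) : ℝ :=
  (Matrix.gram ℝ v).det

variable {ι κ : Type*} [Fintype ι] [DecidableEq ι] [Fintype κ] [DecidableEq κ]

lemma gramDet_nonneg (v : ι → E) : 0 ≤ gramDet v :=
  (Matrix.posSemidef_gram ℝ v).det_nonneg

lemma gramDet_pos {v : ι → E} (hv : LinearIndependent ℝ v) : 0 < gramDet v :=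
  lt_of_le_of_ne (gramDet_nonneg v)
    (Ne.symm (Matrix.det_gram_ne_zero_iff_linearIndependent.mpr hv))

lemma gramDet_reindex (e : κ ≃ ι) (v : ι → E) : gramDet (v ∘ e) = gramDet v := by
  unfold gramDet
  rw [← Matrix.det_submatrix_equiv_self e (Matrix.gram ℝ v)]
  rfl

lemma gramDet_linear_combination (A : Matrix ι ι ℝ) (v w : ι → E)
    (h : ∀ i, w i = ∑ j, A i j • v j) : gramDet w = A.det ^ 2 * gramDet v := by
  have hG : Matrix.gram ℝ w = A * Matrix.gram ℝ v * A.transpose := by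
    ext i j
    simp only [Matrix.gram_apply, Matrix.mul_apply, Matrix.transpose_apply, h, sum_inner,
      inner_sum, inner_smul_left, inner_smul_right, Finset.sum_mul,
      Finset.mul_sum]
    refine Finset.sum_congr rfl fun k _ => Finset.sum_congr rfl fun l _ => ?_
    simp only [conj_trivial, real_inner_comm]
    ring
  unfold gramDet
  rw [hG, Matrix.det_mul, Matrix.det_mul, Matrix.det_transpose]
  ring

/-- The distance from `x` to the span of `s`. -/
noncomputable def spanDist (s : Set E) (x : E) : ℝ :=
  Metric.infDist x (Submodule.span ℝ s : Set E)

lemma spanDist_nonneg (s : Set E) (x : E) : 0 ≤ spanDist s x := Metric.infDist_nonneg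

lemma spanDist_anti {s t : Set E} (h : s ⊆ t) (x : E) : spanDist t x ≤ spanDist s x :=
  Metric.infDist_le_infDist_of_subset (Submodule.span_mono h) ⟨0, Submodule.zero_mem _⟩

lemma spanDist_le_norm (s : Set E) (x : E) : spanDist s x ≤ ‖x‖ := by
  have := Metric.infDist_le_dist_of_mem (x := x) (Submodule.zero_mem (Submodule.span ℝ s))
  simpa [spanDist] using this

lemma exists_spanDist (v : ι → E) (x : E) : ∃ c : ι → ℝ,
    (∀ i, inner ℝ (v i) (x - ∑ j, c j • v j) = 0) ∧
      spanDist (Set.range v) x = ‖x - ∑ j, c j • v j‖ := by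
  set K := Submodule.span ℝ (Set.range v) with hK
  have : FiniteDimensional ℝ K := FiniteDimensional.span_of_finite ℝ (Set.finite_range v)
  have hmem : (K.starProjection x) ∈ K := by simp
  obtain ⟨c, hc⟩ := (Submodule.mem_span_range_iff_exists_fun ℝ).1 hmem
  refine ⟨c, fun i => ?_, ?_⟩
  · rw [hc]
    have := Submodule.starProjection_inner_eq_zero (K := K) x (v i)
      (Submodule.subset_span ⟨i, rfl⟩)
    rw [real_inner_comm]; exact this
  · rw [hc, Submodule.starProjection_minimal, spanDist, Metric.infDist_eq_iInf]
    simp [dist_eq_norm]; rfl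

lemma gramDet_sum_unit (v : ι → E) (x : E) :
    gramDet (Sum.elim v (fun _ : Unit => x)) = gramDet v * spanDist (Set.range v) x ^ 2 := by
  obtain ⟨c, hc, hd⟩ := exists_spanDist v x
  set y := x - ∑ j, c j • v j with hy
  have h1 : gramDet (Sum.elim v (fun _ : Unit => y)) = gramDet v * ‖y‖ ^ 2 := by
    have : Matrix.gram ℝ (Sum.elim v (fun _ : Unit => y)) =
        Matrix.fromBlocks (Matrix.gram ℝ v) 0 0 (Matrix.of fun _ _ => ‖y‖ ^ 2) := by
      ext i j
      rcases i with i | i <;> rcases j with j | j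
      · simp
      · simpa using hc i
      · simpa [real_inner_comm] using hc j
      · simp
    unfold gramDet
    rw [this, Matrix.det_fromBlocks_zero₂₁]
    simp
  have h2 : gramDet (Sum.elim v (fun _ : Unit => x)) =
      gramDet (Sum.elim v (fun _ : Unit => y)) := by
    rw [gramDet_linear_combination (Matrix.fromBlocks (1 : Matrix ι ι ℝ) 0
      (Matrix.of fun _ j => c j) (1 : Matrix Unit Unit ℝ)) (Sum.elim v (fun _ : Unit => y))]
    · rw [Matrix.det_fromBlocks_zero₁₂]; simp
    · rintro (i | i)
      · simp [Matrix.one_apply]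
      · simp [hy]
  rw [h2, h1, hd]

/-- The volume of the parallelepiped spanned by a list, built one vector at a time. -/
noncomputable def listVol : List E → ℝ
  | [] => 1
  | x :: l => spanDist {y | y ∈ l} x * listVol l

lemma listVol_nonneg : ∀ l : List E, 0 ≤ listVol l
  | [] => zero_le_one
  | _ :: l => mul_nonneg (spanDist_nonneg _ _) (listVol_nonneg l)

lemma listVol_append_mul_le (c b a : List E) :
    listVol (c ++ (b ++ a)) * listVol a ≤ listVol (c ++ a) * listVol (b ++ a) := by
  induction c with
  | nil => simp [mul_comm]
  | cons x c ih =>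
    simp only [List.cons_append, listVol]
    have h : spanDist {y | y ∈ c ++ (b ++ a)} x ≤ spanDist {y | y ∈ c ++ a} x := by
      apply spanDist_anti
      intro y hy
      simp only [List.mem_append, Set.mem_ofPred_eq] at hy ⊢
      tauto
    calc _ = spanDist {y | y ∈ c ++ (b ++ a)} x * (listVol (c ++ (b ++ a)) * listVol a) := by ring
      _ ≤ spanDist {y | y ∈ c ++ a} x * (listVol (c ++ a) * listVol (b ++ a)) :=
        mul_le_mul h ih (mul_nonneg (listVol_nonneg _) (listVol_nonneg _)) (spanDist_nonneg _ _)
      _ = _ := by ring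

lemma gramDet_eq_listVol_sq {n : ℕ} (v : Fin n → E) :
    gramDet v = listVol (List.ofFn v) ^ 2 := by
  induction n with
  | zero => simp [gramDet, listVol]
  | succ n ih =>
    have e : Fin n ⊕ Unit ≃ Fin (n + 1) :=
      (Equiv.optionEquivSumPUnit (Fin n)).symm.trans (finSuccEquiv n).symm
    rw [List.ofFn_succ, listVol, mul_pow, ← ih]
    rw [← gramDet_reindex ((Equiv.optionEquivSumPUnit (Fin n)).symm.trans (finSuccEquiv n).symm) v]
    have : v ∘ ((Equiv.optionEquivSumPUnit (Fin n)).symm.trans (finSuccEquiv n).symm) =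
        Sum.elim (fun i => v i.succ) (fun _ : Unit => v 0) := by
      ext (i | i) <;> simp
    rw [this, gramDet_sum_unit, mul_comm]
    congr 3
    ext y; simp [List.mem_ofFn]

lemma gramDet_append {m n : ℕ} (v : Fin m → E) (w : Fin n → E) :
    gramDet (Sum.elim v w) = listVol (List.ofFn v ++ List.ofFn w) ^ 2 := by
  rw [← List.ofFn_fin_append, ← gramDet_eq_listVol_sq, ← gramDet_reindex finSumFinEquiv]
  congr 1
  ext (i | i) <;> simp

lemma gramDet_sum_mul_le {l m n : ℕ} (a : Fin l → E) (b : Fin m → E) (c : Fin n → E) :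
    gramDet (Sum.elim c (Sum.elim b a)) * gramDet a ≤
      gramDet (Sum.elim c a) * gramDet (Sum.elim b a) := by
  have h : gramDet (Sum.elim c (Sum.elim b a)) =
      listVol (List.ofFn c ++ (List.ofFn b ++ List.ofFn a)) ^ 2 := by
    rw [← List.ofFn_fin_append, ← gramDet_append,
      ← gramDet_reindex (Equiv.sumCongr (Equiv.refl _) finSumFinEquiv)]
    congr 1
    ext (i | i | i) <;> simp
  rw [h, gramDet_append, gramDet_append, gramDet_eq_listVol_sq, ← mul_pow, ← mul_pow]
  exact pow_le_pow_left₀ (mul_nonneg (listVol_nonneg _) (listVol_nonneg _))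
    (listVol_append_mul_le _ _ _) 2

lemma listVol_le_prod_norm (l : List E) : listVol l ≤ (l.map norm).prod := by
  induction l with
  | nil => simp [listVol]
  | cons x l ih =>
    simp only [listVol, List.map_cons, List.prod_cons]
    exact mul_le_mul (spanDist_le_norm _ _) ih (listVol_nonneg _) (norm_nonneg _)

lemma gramDet_le_prod_norm {n : ℕ} (v : Fin n → E) : gramDet v ≤ (∏ i, ‖v i‖) ^ 2 := by
  rw [gramDet_eq_listVol_sq]
  refine pow_le_pow_left₀ (listVol_nonneg _) ((listVol_le_prod_norm _).trans_eq ?_) 2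
  rw [List.map_ofFn, List.prod_ofFn]; rfl

end GramDeterminant

section LatticeVolume

variable {E : Type*} [NormedAddCommGroup E] [InnerProductSpace ℝ E]
variable {M : Type*} [AddCommGroup M] [Module.Free ℤ M] [Module.Finite ℤ M]

/-- The squared covolume of the image of the submodule `S` under `T`. -/
noncomputable def latDet (T : M →ₗ[ℤ] E) (S : Submodule ℤ M) : ℝ :=
  gramDet fun i => T (Module.finBasis ℤ S i : M)

/-- `T` identifies `M` with a lattice in a real subspace of `E`. -/
def IsLatticeMap (T : M →ₗ[ℤ] E) : Prop :=
  ∀ (k : ℕ) (w : Fin k → M), LinearIndependent ℤ w → LinearIndependent ℝ (T ∘ w)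

/-- The logarithm of the covolume of the image of `S` under `T`. -/
noncomputable def logVol (T : M →ₗ[ℤ] E) (S : Submodule ℤ M) : ℝ :=
  Real.log (latDet T S) / 2

lemma gramDet_eq_card_sq_mul {ι : Type*} [Fintype ι] [DecidableEq ι] (T : M →ₗ[ℤ] E)
    {S : Submodule ℤ M} {w : ι → S} (hw : LinearIndependent ℤ w)
    (hcard : Fintype.card ι = Module.finrank ℤ S) :
    gramDet (fun i => T (w i : M)) =
      (Nat.card (S ⧸ Submodule.span ℤ (Set.range w)) : ℝ) ^ 2 * latDet T S := by
  let e : Fin (Module.finrank ℤ S) ≃ ι := (Fintype.equivFinOfCardEq hcard).symm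
  let b := (Module.finBasis ℤ S).reindex e
  have h1 := Submodule.natAbs_det_basis_change b _ (Module.Basis.span hw)
  have h2 : ((↑) ∘ (Module.Basis.span hw) : ι → S) = w := by
    ext i; simp [Module.Basis.span_apply]
  rw [h2] at h1
  have h3 : latDet T S = gramDet (fun i => T (b i : M)) := by
    rw [latDet, ← gramDet_reindex e]
    congr 1
    ext i; simp [b]
  rw [h3, gramDet_linear_combination (((b.toMatrix w).transpose).map (Int.cast : ℤ → ℝ))
    (fun i => T (b i : M)) (fun i => T (w i : M))]
  · congr 1
    have : ((b.toMatrix w).transpose.map (Int.cast : ℤ → ℝ)).det = ((b.det w : ℤ) : ℝ) := by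
      rw [Module.Basis.det_apply, ← Matrix.det_transpose (b.toMatrix w)]
      exact (Int.cast_det _).symm
    rw [this, ← h1]
    rw [Nat.cast_natAbs, Int.cast_abs, sq_abs]
  · intro i
    have := b.sum_toMatrix_smul_self w i
    have h4 := congrArg (fun x : S => T (x : M)) this
    simp only [AddSubmonoidClass.coe_finsetSum, Submodule.coe_smul, map_sum, map_smul] at h4
    rw [← h4]
    refine Finset.sum_congr rfl fun j _ => ?_
    simp [Matrix.map_apply, Matrix.transpose_apply, Int.cast_smul_eq_zsmul]

lemma card_quotient_pos {ι : Type*} [Fintype ι] {S : Submodule ℤ M} {w : ι → S}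
    (hw : LinearIndependent ℤ w) (hcard : Fintype.card ι = Module.finrank ℤ S) :
    0 < Nat.card (S ⧸ Submodule.span ℤ (Set.range w)) := by
  have : Finite (S ⧸ Submodule.span ℤ (Set.range w)) :=
    Submodule.finiteQuotientOfFreeOfRankEq _ (by rw [finrank_span_eq_card hw, hcard])
  exact Nat.card_pos

lemma exists_linearIndependent_sumElim {N : Type*} [AddCommGroup N] [Module ℤ N] {k l : ℕ}
    {w : Fin k → N} (hw : LinearIndependent ℤ w) (h : k + l ≤ Module.finrank ℤ N) :
    ∃ b : Fin l → N, LinearIndependent ℤ (Sum.elim b w) := by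
  induction l with
  | zero =>
    refine ⟨Fin.elim0, ?_⟩
    have : Sum.elim Fin.elim0 w = w ∘ (Equiv.emptySum (Fin 0) (Fin k)) := by
      ext (i | i)
      · exact i.elim0
      · rfl
    rw [this]
    exact hw.comp _ (Equiv.injective _)
  | succ l ih =>
    obtain ⟨b, hb⟩ := ih (by omega)
    have h2 : LinearIndependent ℤ (Fin.append b w) := by
      have : Fin.append b w = Sum.elim b w ∘ finSumFinEquiv.symm := by
        ext i
        refine Fin.addCases (fun i => ?_) (fun i => ?_) i <;> simp
      rw [this]
      exact hb.comp _ (Equiv.injective _)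
    obtain ⟨x, hx⟩ := exists_linearIndependent_cons_of_lt_finrank h2 (by omega)
    refine ⟨Fin.cons x b, ?_⟩
    let f : Fin (l + 1) ⊕ Fin k → Fin (l + k + 1) :=
      Sum.elim (Fin.cons 0 fun i => (Fin.castAdd k i).succ) fun i => (Fin.natAdd l i).succ
    have hf : Sum.elim (Fin.cons x b) w = (Fin.cons x (Fin.append b w) : Fin (l + k + 1) → N) ∘ f := by
      ext (i | i)
      · refine Fin.cases ?_ (fun i => ?_) i <;> simp [f]
      · simp [f]
    rw [hf]
    refine hx.comp _ ?_
    rintro (i | i) (j | j)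
    · refine Fin.cases ?_ (fun i => ?_) i <;> refine Fin.cases ?_ (fun j => ?_) j <;>
        simp [f, Fin.ext_iff]
    · refine Fin.cases ?_ (fun i => ?_) i <;> simp [f, Fin.ext_iff]
      omega
    · refine Fin.cases ?_ (fun j => ?_) j <;> simp [f, Fin.ext_iff]
      omega
    · simp [f, Fin.ext_iff]

lemma IsLatticeMap.of_basis {ι : Type*} [Fintype ι] [DecidableEq ι] {T : M →ₗ[ℤ] E}
    (b : Module.Basis ι ℤ M) (h : LinearIndependent ℝ (T ∘ b)) : IsLatticeMap T := by
  intro k w hw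
  have hk : k ≤ Module.finrank ℤ M := by
    simpa using hw.fintype_card_le_finrank
  obtain ⟨l, hl⟩ := Nat.exists_eq_add_of_le hk
  obtain ⟨c, hc⟩ := exists_linearIndependent_sumElim hw hl.symm.le
  let e : (⊤ : Submodule ℤ M) ≃ₗ[ℤ] M := Submodule.topEquiv
  have hrank : Module.finrank ℤ (⊤ : Submodule ℤ M) = Module.finrank ℤ M := finrank_top ℤ M
  have h1 := gramDet_eq_card_sq_mul T (S := ⊤) (w := fun i => e.symm (b i))
    (b.linearIndependent.map' e.symm.toLinearMap e.symm.ker)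
    (by rw [hrank, Module.finrank_eq_card_basis b])
  have h2 := gramDet_eq_card_sq_mul T (S := ⊤) (w := fun i => e.symm (Sum.elim c w i))
    (hc.map' e.symm.toLinearMap e.symm.ker) (by rw [hrank, hl]; simp [add_comm])
  have h3 := card_quotient_pos (S := ⊤) (w := fun i => e.symm (Sum.elim c w i))
    (hc.map' e.symm.toLinearMap e.symm.ker) (by rw [hrank, hl]; simp [add_comm])
  have h4 : 0 < gramDet (T ∘ b) := gramDet_pos h
  have h5 : gramDet (fun i => T (e.symm (b i) : M)) = gramDet (T ∘ b) := rfl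
  have h6 : latDet T ⊤ ≠ 0 := by
    intro h0
    rw [h5, h0, mul_zero] at h1
    exact h4.ne' h1
  have h7 : LinearIndependent ℝ (fun i => T (e.symm (Sum.elim c w i) : M)) := by
    apply Matrix.linearIndependent_of_det_gram_ne_zero
    change gramDet _ ≠ 0
    rw [h2]
    positivity
  exact h7.comp Sum.inr Sum.inr_injective

lemma IsLatticeMap.linearIndependent {ι : Type*} [Fintype ι] {T : M →ₗ[ℤ] E}
    (hT : IsLatticeMap T) {w : ι → M} (hw : LinearIndependent ℤ w) :
    LinearIndependent ℝ (fun i => T (w i)) := by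
  have h := hT _ (w ∘ (Fintype.equivFin ι).symm) (hw.comp _ (Equiv.injective _))
  have h2 := h.comp _ (Fintype.equivFin ι).injective
  convert h2 using 1
  ext i; simp

lemma latDet_pos {T : M →ₗ[ℤ] E} (hT : IsLatticeMap T) (S : Submodule ℤ M) : 0 < latDet T S := by
  apply gramDet_pos
  apply hT.linearIndependent
  exact (Module.finBasis ℤ S).linearIndependent.map' S.subtype S.ker_subtype

lemma latDet_eq_gramDet {ι : Type*} [Fintype ι] [DecidableEq ι] (T : M →ₗ[ℤ] E)
    {S : Submodule ℤ M} {w : ι → M} (hw : LinearIndependent ℤ w)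
    (hS : Submodule.span ℤ (Set.range w) = S) : latDet T S = gramDet (fun i => T (w i)) := by
  subst hS
  have hb : LinearIndependent ℤ (Module.Basis.span hw) := (Module.Basis.span hw).linearIndependent
  have h := gramDet_eq_card_sq_mul T hb (by rw [finrank_span_eq_card hw])
  rw [(Module.Basis.span hw).span_eq] at h
  have : Subsingleton ((Submodule.span ℤ (Set.range w)) ⧸
      (⊤ : Submodule ℤ (Submodule.span ℤ (Set.range w)))) :=
    Submodule.Quotient.subsingleton_iff.mpr rfl
  rw [Nat.card_unique, Nat.cast_one, one_pow, one_mul] at h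
  rw [← h]
  simp [Module.Basis.span_apply]

lemma logVol_bot (T : M →ₗ[ℤ] E) : logVol T ⊥ = 0 := by
  have : latDet T ⊥ = gramDet (fun i : Fin 0 => T ((Fin.elim0 : Fin 0 → M) i)) :=
    latDet_eq_gramDet T linearIndependent_empty_type (by simp)
  rw [logVol, this]
  simp [gramDet]

lemma latDet_of_le {T : M →ₗ[ℤ] E} {S' S : Submodule ℤ M} (h : S' ≤ S)
    (hr : Module.finrank ℤ S' = Module.finrank ℤ S) :
    latDet T S' = (Nat.card (S ⧸ S'.submoduleOf S) : ℝ) ^ 2 * latDet T S := by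
  let w : Fin (Module.finrank ℤ S') → S := fun i => Submodule.inclusion h (Module.finBasis ℤ S' i)
  have hw : LinearIndependent ℤ w :=
    (Module.finBasis ℤ S').linearIndependent.map' (Submodule.inclusion h)
      (LinearMap.ker_eq_bot.mpr (Submodule.inclusion_injective h))
  have h1 := gramDet_eq_card_sq_mul T hw (by simpa using hr)
  have h2 : Submodule.span ℤ (Set.range w) = S'.submoduleOf S := by
    have : Set.range w = Submodule.inclusion h '' Set.range (Module.finBasis ℤ S') := by
      rw [← Set.range_comp]; rfl
    rw [this, ← Submodule.map_span, Module.Basis.span_eq, Submodule.map_top,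
      Submodule.range_inclusion]
    rfl
  rw [h2] at h1
  exact h1

lemma card_submoduleOf_pos {S' S : Submodule ℤ M} (h : S' ≤ S)
    (hr : Module.finrank ℤ S' = Module.finrank ℤ S) : 0 < Nat.card (S ⧸ S'.submoduleOf S) := by
  have : Finite (S ⧸ S'.submoduleOf S) :=
    Submodule.finiteQuotientOfFreeOfRankEq _
      (by rw [← hr]; exact (Submodule.submoduleOfEquivOfLe h).finrank_eq)
  exact Nat.card_pos

lemma logVol_of_le {T : M →ₗ[ℤ] E} (hT : IsLatticeMap T) {S' S : Submodule ℤ M} (h : S' ≤ S)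
    (hr : Module.finrank ℤ S' = Module.finrank ℤ S) :
    logVol T S' = Real.log (Nat.card (S ⧸ S'.submoduleOf S)) + logVol T S := by
  have h1 := card_submoduleOf_pos h hr
  have h2 := latDet_pos hT S
  rw [logVol, latDet_of_le h hr, Real.log_mul (by positivity) h2.ne', Real.log_pow, logVol]
  push_cast
  ring

lemma logVol_anti {T : M →ₗ[ℤ] E} (hT : IsLatticeMap T) {S' S : Submodule ℤ M} (h : S' ≤ S)
    (hr : Module.finrank ℤ S' = Module.finrank ℤ S) : logVol T S ≤ logVol T S' := by
  rw [logVol_of_le hT h hr]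
  have h1 := card_submoduleOf_pos h hr
  have : 0 ≤ Real.log (Nat.card (S ⧸ S'.submoduleOf S)) :=
    Real.log_nonneg (by exact_mod_cast h1)
  linarith

end LatticeVolume

section Submodularity

variable {E : Type*} [NormedAddCommGroup E] [InnerProductSpace ℝ E]
variable {M : Type*} [AddCommGroup M] [Module.Free ℤ M] [Module.Finite ℤ M]

lemma finrank_sup_add_finrank_inf (S S' : Submodule ℤ M) :
    Module.finrank ℤ (S ⊔ S' : Submodule ℤ M) + Module.finrank ℤ (S ⊓ S' : Submodule ℤ M) =
      Module.finrank ℤ S + Module.finrank ℤ S' := by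
  have h := Submodule.rank_sup_add_rank_inf_eq S S'
  simp only [← Module.finrank_eq_rank] at h
  exact_mod_cast h

lemma card_quotient_le_of_inf_le {S S' Q : Submodule ℤ M} (hD : S ⊓ S' ≤ Q) (hQ : Q ≤ S')
    (hfin : 0 < Nat.card ((S ⊔ S' : Submodule ℤ M) ⧸ (S ⊔ Q).submoduleOf (S ⊔ S'))) :
    Nat.card (S' ⧸ Q.submoduleOf S') ≤
      Nat.card ((S ⊔ S' : Submodule ℤ M) ⧸ (S ⊔ Q).submoduleOf (S ⊔ S')) := by
  have : Finite ((S ⊔ S' : Submodule ℤ M) ⧸ (S ⊔ Q).submoduleOf (S ⊔ S')) :=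
    Nat.finite_of_card_ne_zero hfin.ne'
  let f : S' →ₗ[ℤ] (S ⊔ S' : Submodule ℤ M) ⧸ (S ⊔ Q).submoduleOf (S ⊔ S') :=
    ((S ⊔ Q).submoduleOf (S ⊔ S')).mkQ ∘ₗ Submodule.inclusion le_sup_right
  have hker : LinearMap.ker f = Q.submoduleOf S' := by
    ext ⟨x, hx⟩
    rw [LinearMap.mem_ker]
    change Submodule.Quotient.mk _ = 0 ↔ x ∈ Q
    rw [Submodule.Quotient.mk_eq_zero]
    change x ∈ S ⊔ Q ↔ x ∈ Q
    constructor
    · intro h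
      obtain ⟨s, hs, q, hq, rfl⟩ := Submodule.mem_sup.mp h
      have : s ∈ S' := by simpa using S'.sub_mem hx (hQ hq)
      exact Q.add_mem (hD ⟨hs, this⟩) hq
    · exact fun h => Submodule.mem_sup_right h
  refine Nat.card_le_card_of_injective ((Q.submoduleOf S').liftQ f hker.ge) ?_
  rw [← LinearMap.ker_eq_bot]
  exact Submodule.ker_liftQ_eq_bot _ _ _ hker.le

lemma logVol_sup_add_le_of_inf_le {T : M →ₗ[ℤ] E} (hT : IsLatticeMap T) {S S' Q : Submodule ℤ M}
    (hD : S ⊓ S' ≤ Q) (hQ : Q ≤ S') (hr : Module.finrank ℤ Q = Module.finrank ℤ S') :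
    logVol T (S ⊔ S') + logVol T Q ≤ logVol T (S ⊔ Q) + logVol T S' := by
  have hinf : S ⊓ Q = S ⊓ S' :=
    le_antisymm (inf_le_inf_left _ hQ) (le_inf inf_le_left hD)
  have h1 := finrank_sup_add_finrank_inf S S'
  have h2 := finrank_sup_add_finrank_inf S Q
  rw [hinf] at h2
  have hle : S ⊔ Q ≤ S ⊔ S' := sup_le_sup_left hQ _
  have hr2 : Module.finrank ℤ (S ⊔ Q : Submodule ℤ M) =
    Module.finrank ℤ (S ⊔ S' : Submodule ℤ M) := by omega
  rw [logVol_of_le hT hle hr2, logVol_of_le hT hQ hr]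
  have h3 := card_submoduleOf_pos hle hr2
  have h4 := card_submoduleOf_pos hQ hr
  have h5 := card_quotient_le_of_inf_le hD hQ h3
  have h6 : Real.log (Nat.card (S' ⧸ Q.submoduleOf S')) ≤
      Real.log (Nat.card ((S ⊔ S' : Submodule ℤ M) ⧸ (S ⊔ Q).submoduleOf (S ⊔ S'))) :=
    Real.log_le_log (by exact_mod_cast h4) (by exact_mod_cast h5)
  linarith

lemma exists_extension_span {D S : Submodule ℤ M} (h : D ≤ S) :
    ∃ (l : ℕ) (b : Fin l → M),
      LinearIndependent ℤ (Sum.elim b fun i => (Module.finBasis ℤ D i : M)) ∧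
      Submodule.span ℤ (Set.range (Sum.elim b fun i => (Module.finBasis ℤ D i : M))) ≤ S ∧
      D ≤ Submodule.span ℤ (Set.range (Sum.elim b fun i => (Module.finBasis ℤ D i : M))) ∧
      Module.finrank ℤ D + l = Module.finrank ℤ S := by
  have hk : Module.finrank ℤ D ≤ Module.finrank ℤ S := Submodule.finrank_mono h
  obtain ⟨l, hl⟩ := Nat.exists_eq_add_of_le hk
  have ha : LinearIndependent ℤ (fun i => Submodule.inclusion h (Module.finBasis ℤ D i)) :=
    (Module.finBasis ℤ D).linearIndependent.map' (Submodule.inclusion h)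
      (LinearMap.ker_eq_bot.mpr (Submodule.inclusion_injective h))
  obtain ⟨b, hb⟩ := exists_linearIndependent_sumElim ha hl.symm.le
  have key := hb.map' S.subtype S.ker_subtype
  have e : (S.subtype ∘ Sum.elim b fun i => Submodule.inclusion h (Module.finBasis ℤ D i)) =
      Sum.elim (fun i => (b i : M)) (fun i => (Module.finBasis ℤ D i : M)) := by
    ext (i | i) <;> simp
  rw [e] at key
  refine ⟨l, fun i => b i, key, ?_, ?_, hl.symm⟩
  · rw [Submodule.span_le]
    rintro _ ⟨i | i, rfl⟩
    · exact (b i).2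
    · exact h (Module.finBasis ℤ D i).2
  · intro x hx
    have : (⟨x, hx⟩ : D) ∈ Submodule.span ℤ (Set.range (Module.finBasis ℤ D)) := by
      rw [Module.Basis.span_eq]; trivial
    have h2 := Submodule.mem_map_of_mem (f := D.subtype) this
    rw [Submodule.map_span, ← Set.range_comp] at h2
    refine Submodule.span_mono ?_ h2
    rintro _ ⟨i, rfl⟩
    exact ⟨Sum.inr i, rfl⟩

/-- Covolumes of lattices are submodular. -/
theorem logVol_inf_add_logVol_sup_le {T : M →ₗ[ℤ] E} (hT : IsLatticeMap T)
    (S S' : Submodule ℤ M) :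
    logVol T (S ⊓ S') + logVol T (S ⊔ S') ≤ logVol T S + logVol T S' := by
  set D := S ⊓ S' with hDdef
  set a : Fin (Module.finrank ℤ D) → M := fun i => (Module.finBasis ℤ D i : M) with ha
  obtain ⟨l, b, hb, hbS, hDb, hl⟩ := exists_extension_span (inf_le_left : S ⊓ S' ≤ S)
  obtain ⟨m, c, hc, hcS, hDc, hm⟩ := exists_extension_span (inf_le_right : S ⊓ S' ≤ S')
  set Q := Submodule.span ℤ (Set.range (Sum.elim b a)) with hQ
  set Q' := Submodule.span ℤ (Set.range (Sum.elim c a)) with hQ'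
  have hrQ : Module.finrank ℤ Q = Module.finrank ℤ S := by
    rw [hQ, finrank_span_eq_card hb, ← hl]; simp [add_comm]
  have hrQ' : Module.finrank ℤ Q' = Module.finrank ℤ S' := by
    rw [hQ', finrank_span_eq_card hc, ← hm]; simp [add_comm]
  have hspan_a : Submodule.span ℤ (Set.range a) = D := by
    have : Set.range a = D.subtype '' Set.range (Module.finBasis ℤ D) := by
      rw [← Set.range_comp]; rfl
    rw [this, ← Submodule.map_span, Module.Basis.span_eq, Submodule.map_top, Submodule.range_subtype]
  have hli : LinearIndependent ℤ (Sum.elim c (Sum.elim b a)) := by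
    rw [linearIndependent_sum]
    have hc2 := linearIndependent_sum.mp hc
    refine ⟨hc2.1, hb, ?_⟩
    have h3 := hc2.2.2
    simp only [Sum.elim_comp_inl, Sum.elim_comp_inr] at h3 ⊢
    rw [Submodule.disjoint_def] at h3 ⊢
    intro x hx hx2
    refine h3 x hx ?_
    change x ∈ Submodule.span ℤ (Set.range a)
    rw [hspan_a]
    exact ⟨hbS hx2, hcS (Submodule.span_mono (by rintro _ ⟨i, rfl⟩; exact ⟨Sum.inl i, rfl⟩) hx)⟩
  have hspan : Submodule.span ℤ (Set.range (Sum.elim c (Sum.elim b a))) = Q ⊔ Q' := by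
    rw [hQ, hQ', Set.Sum.elim_range, Set.Sum.elim_range, Set.Sum.elim_range, ← Submodule.span_union]
    congr 1
    ext x; simp only [Set.mem_union]; tauto
  have hcomb : logVol T D + logVol T (Q ⊔ Q') ≤ logVol T Q + logVol T Q' := by
    have e1 := latDet_eq_gramDet T hli hspan
    have e2 := latDet_eq_gramDet T hb hQ.symm
    have e3 := latDet_eq_gramDet T hc hQ'.symm
    have e4 : latDet T D = gramDet fun i => T (a i) := rfl
    have h := gramDet_sum_mul_le (fun i => T (a i)) (fun i => T (b i)) (fun i => T (c i))
    have r1 : (fun i => T (Sum.elim c (Sum.elim b a) i)) = Sum.elim (fun i => T (c i))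
        (Sum.elim (fun i => T (b i)) (fun i => T (a i))) := by
      ext (i | i | i) <;> rfl
    have r2 : (fun i => T (Sum.elim b a i)) =
        (Sum.elim (fun i => T (b i)) (fun i => T (a i))) := by
      ext (i | i) <;> rfl
    have r3 : (fun i => T (Sum.elim c a i)) =
        (Sum.elim (fun i => T (c i)) (fun i => T (a i))) := by
      ext (i | i) <;> rfl
    rw [r1] at e1
    have e2' : latDet T Q = gramDet (Sum.elim (fun i => T (b i)) (fun i => T (a i))) := by
      rw [← r2]; exact e2
    have e3' : latDet T Q' = gramDet (Sum.elim (fun i => T (c i)) (fun i => T (a i))) := by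
      rw [← r3]; exact e3
    rw [← e1, ← e2', ← e3', ← e4] at h
    have p1 := latDet_pos hT (Q ⊔ Q')
    have p2 := latDet_pos hT Q
    have p3 := latDet_pos hT Q'
    have p4 := latDet_pos hT D
    have := Real.log_le_log (mul_pos p1 p4) h
    rw [Real.log_mul p1.ne' p4.ne', Real.log_mul p3.ne' p2.ne'] at this
    simp only [logVol]
    linarith
  have s1 := logVol_sup_add_le_of_inf_le hT (S := S) (S' := S') (Q := Q') hDc hcS hrQ'
  have s2 := logVol_sup_add_le_of_inf_le hT (S := Q') (S' := S) (Q := Q)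
    ((le_inf inf_le_right (inf_le_left.trans hcS)).trans hDb) hbS hrQ
  rw [sup_comm Q' S, sup_comm Q' Q] at s2
  linarith

end Submodularity

section ProductLattice

variable {E : Type*} [NormedAddCommGroup E] [InnerProductSpace ℝ E]
variable {M : Type*} [AddCommGroup M] [Module.Free ℤ M] [Module.Finite ℤ M]

/-- The map `T × T` into the Euclidean product. -/
noncomputable def sqMap (T : M →ₗ[ℤ] E) : M × M →ₗ[ℤ] WithLp 2 (E × E) :=
  (WithLp.linearEquiv 2 ℤ (E × E)).symm.toLinearMap ∘ₗ T.prodMap T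

lemma sqMap_apply (T : M →ₗ[ℤ] E) (x : M × M) : sqMap T x = WithLp.toLp 2 (T x.1, T x.2) := rfl

lemma inner_sqMap (T : M →ₗ[ℤ] E) (x y : M × M) :
    inner ℝ (sqMap T x) (sqMap T y) = inner ℝ (T x.1) (T y.1) + inner ℝ (T x.2) (T y.2) := by
  simp [sqMap_apply, WithLp.prod_inner_apply]

lemma norm_sq_sqMap (T : M →ₗ[ℤ] E) (x : M × M) :
    ‖sqMap T x‖ ^ 2 = ‖T x.1‖ ^ 2 + ‖T x.2‖ ^ 2 := by
  simp only [← real_inner_self_eq_norm_sq, inner_sqMap]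

lemma gramDet_sqMap {ι κ : Type*} [Fintype ι] [DecidableEq ι] [Fintype κ] [DecidableEq κ]
    (T : M →ₗ[ℤ] E) (v : ι → M) (w : κ → M) :
    gramDet (fun i => sqMap T (Sum.elim (fun i => (v i, 0)) (fun j => (0, w j)) i)) =
      gramDet (fun i => T (v i)) * gramDet (fun i => T (w i)) := by
  rw [gramDet, gramDet, gramDet, ← Matrix.det_fromBlocks_zero₁₂ _ 0]
  congr 1
  ext (i | i) (j | j) <;> rw [Matrix.gram_apply, inner_sqMap] <;> simp [Matrix.gram_apply]

lemma linearIndependent_sumElim_prod {ι κ : Type*} {v : ι → M} {w : κ → M}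
    (hv : LinearIndependent ℤ v) (hw : LinearIndependent ℤ w) :
    LinearIndependent ℤ
      (Sum.elim (fun i => ((v i, 0) : M × M)) (fun j => ((0, w j) : M × M))) := by
  rw [linearIndependent_sum]
  refine ⟨hv.map' (LinearMap.inl ℤ M M) (LinearMap.ker_eq_bot.mpr LinearMap.inl_injective),
    hw.map' (LinearMap.inr ℤ M M) (LinearMap.ker_eq_bot.mpr LinearMap.inr_injective), ?_⟩
  refine LinearMap.isCompl_range_inl_inr.disjoint.mono ?_ ?_ <;>
    (rw [Submodule.span_le]; rintro _ ⟨i, rfl⟩)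
  · exact ⟨v i, rfl⟩
  · exact ⟨w i, rfl⟩

lemma span_sumElim_prod {ι κ : Type*} (v : ι → M) (w : κ → M) :
    Submodule.span ℤ (Set.range
      (Sum.elim (fun i => ((v i, 0) : M × M)) (fun j => ((0, w j) : M × M)))) =
    (Submodule.span ℤ (Set.range v)).prod (Submodule.span ℤ (Set.range w)) := by
  rw [← LinearMap.span_inl_union_inr, Set.Sum.elim_range]
  congr 2 <;> rw [← Set.range_comp] <;> rfl

lemma span_range_finBasis (D : Submodule ℤ M) :
    Submodule.span ℤ (Set.range (D.subtype ∘ Module.finBasis ℤ D)) = D := by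
  rw [Set.range_comp, ← Submodule.map_span, Module.Basis.span_eq, Submodule.map_top,
    Submodule.range_subtype]

lemma linearIndependent_finBasis (D : Submodule ℤ M) :
    LinearIndependent ℤ (D.subtype ∘ Module.finBasis ℤ D) :=
  (Module.finBasis ℤ D).linearIndependent.map' D.subtype D.ker_subtype

lemma span_finBasis_prod (S S' : Submodule ℤ M) :
    Submodule.span ℤ (Set.range
      (Sum.elim (fun i => (((S.subtype ∘ Module.finBasis ℤ S) i, 0) : M × M))
        (fun j => ((0, (S'.subtype ∘ Module.finBasis ℤ S') j) : M × M)))) = S.prod S' := by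
  rw [span_sumElim_prod, span_range_finBasis, span_range_finBasis]

lemma latDet_sqMap_prod (T : M →ₗ[ℤ] E) (S S' : Submodule ℤ M) :
    latDet (sqMap T) (S.prod S') = latDet T S * latDet T S' := by
  rw [latDet_eq_gramDet (sqMap T) (linearIndependent_sumElim_prod (linearIndependent_finBasis S)
    (linearIndependent_finBasis S')) (span_finBasis_prod S S'), gramDet_sqMap]
  rfl

lemma finrank_submodule_prod (S S' : Submodule ℤ M) :
    Module.finrank ℤ (S.prod S') = Module.finrank ℤ S + Module.finrank ℤ S' := by
  rw [← span_finBasis_prod, finrank_span_eq_card (linearIndependent_sumElim_prod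
    (linearIndependent_finBasis S) (linearIndependent_finBasis S'))]
  simp

lemma IsLatticeMap.sqMap {T : M →ₗ[ℤ] E} (hT : IsLatticeMap T) : IsLatticeMap (sqMap T) := by
  let b := (Module.finBasis ℤ M)
  refine IsLatticeMap.of_basis (b.prod b) ?_
  apply Matrix.linearIndependent_of_det_gram_ne_zero
  have h := gramDet_sqMap T b b
  have e : (_root_.sqMap T ∘ b.prod b) =
      fun i => _root_.sqMap T (Sum.elim (fun i => (b i, 0)) (fun j => (0, b j)) i) := by
    ext (i | i) <;> simp
  rw [e]
  have h1 := gramDet_pos (hT.linearIndependent b.linearIndependent)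
  exact (h.trans_gt (mul_pos h1 h1)).ne'

lemma logVol_sqMap_prod {T : M →ₗ[ℤ] E} (hT : IsLatticeMap T) (S S' : Submodule ℤ M) :
    logVol (sqMap T) (S.prod S') = logVol T S + logVol T S' := by
  rw [logVol, latDet_sqMap_prod, Real.log_mul (latDet_pos hT S).ne' (latDet_pos hT S').ne']
  simp only [logVol]
  ring

/-- The fibre over `0` of the second projection. -/
def Submodule.fiberFst (U : Submodule ℤ (M × M)) : Submodule ℤ M :=
  U.comap (LinearMap.inl ℤ M M)

lemma inf_prod_top_bot (U : Submodule ℤ (M × M)) :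
    U ⊓ (⊤ : Submodule ℤ M).prod ⊥ = U.fiberFst.prod ⊥ := by
  ext ⟨x, y⟩
  simp only [Submodule.mem_inf, Submodule.mem_prod, Submodule.mem_top, Submodule.mem_bot,
    true_and, Submodule.fiberFst, Submodule.mem_comap, LinearMap.inl_apply]
  constructor
  · rintro ⟨h, rfl⟩; exact ⟨h, rfl⟩
  · rintro ⟨h, rfl⟩; exact ⟨h, rfl⟩

lemma sup_prod_top_bot (U : Submodule ℤ (M × M)) :
    U ⊔ (⊤ : Submodule ℤ M).prod ⊥ = (⊤ : Submodule ℤ M).prod (U.map (LinearMap.snd ℤ M M)) := by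
  apply le_antisymm
  · refine sup_le ?_ (Submodule.prod_mono le_rfl bot_le)
    intro x hx
    exact ⟨trivial, Submodule.mem_map_of_mem hx⟩
  · rintro ⟨x, y⟩ ⟨-, hy⟩
    obtain ⟨⟨x', y'⟩, hu, rfl⟩ := hy
    exact Submodule.mem_sup.mpr ⟨_, hu, (x - x', 0), ⟨trivial, rfl⟩, by simp⟩

lemma finrank_fiberFst_add (U : Submodule ℤ (M × M)) :
    Module.finrank ℤ U.fiberFst + Module.finrank ℤ (U.map (LinearMap.snd ℤ M M)) =
      Module.finrank ℤ U := by
  have h := finrank_sup_add_finrank_inf U ((⊤ : Submodule ℤ M).prod ⊥)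
  rw [inf_prod_top_bot, sup_prod_top_bot, finrank_submodule_prod, finrank_submodule_prod,
    finrank_submodule_prod] at h
  simp only [finrank_bot] at h
  omega

lemma logVol_fiberFst_add_le {T : M →ₗ[ℤ] E} (hT : IsLatticeMap T) (U : Submodule ℤ (M × M)) :
    logVol T U.fiberFst + logVol T (U.map (LinearMap.snd ℤ M M)) ≤ logVol (sqMap T) U := by
  have h := logVol_inf_add_logVol_sup_le hT.sqMap U ((⊤ : Submodule ℤ M).prod ⊥)
  rw [inf_prod_top_bot, sup_prod_top_bot, logVol_sqMap_prod hT, logVol_sqMap_prod hT,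
    logVol_sqMap_prod hT, logVol_bot] at h
  linarith

/-- `T` has integral Gram matrices. -/
def IsIntegralMap (T : M →ₗ[ℤ] E) : Prop :=
  ∀ x y, ∃ n : ℤ, inner ℝ (T x) (T y) = n

lemma IsIntegralMap.sqMap {T : M →ₗ[ℤ] E} (h : IsIntegralMap T) : IsIntegralMap (sqMap T) := by
  intro x y
  obtain ⟨m, hm⟩ := h x.1 y.1
  obtain ⟨n, hn⟩ := h x.2 y.2
  exact ⟨m + n, by rw [inner_sqMap, hm, hn]; push_cast; rfl⟩

lemma IsIntegralMap.exists_latDet_eq {T : M →ₗ[ℤ] E} (h : IsIntegralMap T) (hT : IsLatticeMap T)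
    (S : Submodule ℤ M) : ∃ n : ℕ, 0 < n ∧ latDet T S = n := by
  choose f hf using h
  have key : latDet T S = ((Matrix.of fun i j =>
      f (Module.finBasis ℤ S i : M) (Module.finBasis ℤ S j : M)).det : ℤ) := by
    rw [Int.cast_det, latDet, gramDet]
    congr 1
    ext i j
    simp [Matrix.gram_apply, hf]
  have hp := latDet_pos hT S
  rw [key] at hp
  have hp' := Int.cast_pos.mp hp
  refine ⟨_, Int.natAbs_pos.mpr hp'.ne', ?_⟩
  rw [key, Nat.cast_natAbs, abs_of_pos hp']

lemma IsIntegralMap.logVol_nonneg {T : M →ₗ[ℤ] E} (h : IsIntegralMap T) (hT : IsLatticeMap T)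
    (S : Submodule ℤ M) : 0 ≤ logVol T S := by
  obtain ⟨n, hn, e⟩ := h.exists_latDet_eq hT S
  have : (1 : ℝ) ≤ n := by exact_mod_cast hn
  rw [logVol, e]
  have := Real.log_nonneg this
  linarith

/-- In every nonempty family of sublattices the covolume attains its minimum. -/
lemma IsIntegralMap.exists_logVol_min {T : M →ₗ[ℤ] E} (h : IsIntegralMap T) (hT : IsLatticeMap T)
    {F : Set (Submodule ℤ M)} (hF : F.Nonempty) :
    ∃ S ∈ F, ∀ S' ∈ F, logVol T S ≤ logVol T S' := by
  choose d hd0 hd using h.exists_latDet_eq hT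
  obtain ⟨S, hS, hmin⟩ := WellFounded.has_min (InvImage.wf d Nat.lt_wfRel.wf) F hF
  refine ⟨S, hS, fun S' hS' => ?_⟩
  have h1 : d S ≤ d S' := not_lt.mp (hmin S' hS')
  rw [logVol, logVol, hd, hd]
  have := hd0 S
  have := Real.log_le_log (by exact_mod_cast hd0 S) (Nat.cast_le (α := ℝ).mpr h1)
  linarith

end ProductLattice

section LatticePointUpperBound

variable {E : Type*} [NormedAddCommGroup E] [InnerProductSpace ℝ E]
variable {M : Type*} [AddCommGroup M] [Module.Free ℤ M] [Module.Finite ℤ M]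

/-- The logarithm of the ratio between the volume of a ball of radius `exp σ` in the span of `S`
and the covolume of `S`, up to normalization. -/
noncomputable def latVal (T : M →ₗ[ℤ] E) (σ : ℝ) (S : Submodule ℤ M) : ℝ :=
  σ * Module.finrank ℤ S - logVol T S

lemma gramDet_update {ι : Type*} [Fintype ι] [DecidableEq ι] (v : ι → E) (i : ι) (x : E)
    (c : ι → ℝ) (hx : x = ∑ j, c j • v j) :
    gramDet (Function.update v i x) = c i ^ 2 * gramDet v := by
  rw [gramDet_linear_combination ((1 : Matrix ι ι ℝ).updateRow i c) v]
  · rw [← Matrix.cramer_transpose_apply, Matrix.transpose_one, Matrix.cramer_one]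
    rfl
  · intro j
    rcases eq_or_ne j i with rfl | h
    · simp [hx]
    · rw [Function.update_of_ne h, Matrix.updateRow_ne h]
      simp [Matrix.one_apply, ite_smul]

/-- Among the finitely many points of `X` there is an independent tuple of full rank such that all
points of `X` have coordinates in `[-1, 1]` with respect to it. -/
lemma exists_linearIndependent_coords_le_one {T : M →ₗ[ℤ] E} (hT : IsLatticeMap T) (X : Finset M) :
    ∃ w : Fin (Module.finrank ℤ (Submodule.span ℤ (X : Set M))) → M, (∀ i, w i ∈ X) ∧
      LinearIndependent ℤ w ∧ ∀ x ∈ X, ∃ c : Fin _ → ℝ, T x = ∑ i, c i • T (w i) ∧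
        ∀ i, |c i| ≤ 1 := by
  classical
  have : FiniteDimensional ℝ (Submodule.span ℝ (T '' (X : Set M))) :=
    FiniteDimensional.span_of_finite ℝ ((X.finite_toSet).image T)
  obtain ⟨f, hfX, hfspan, hf⟩ := Submodule.exists_fun_fin_finrank_span_eq ℝ (T '' (X : Set M))
  set k := Module.finrank ℝ (Submodule.span ℝ (T '' (X : Set M))) with hk
  have of_real : ∀ {n : ℕ} (w : Fin n → M), LinearIndependent ℝ (fun i => T (w i)) →
      LinearIndependent ℤ w := by
    intro n w hw
    have h := hw.restrict_scalars (R := ℤ) (by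
      intro a b hab
      simpa using hab)
    exact h.of_comp T
  have memspan : ∀ x ∈ Submodule.span ℤ (X : Set M), T x ∈ Submodule.span ℝ (T '' (X : Set M)) := by
    intro x hx
    have h1 : T x ∈ Submodule.span ℤ (T '' (X : Set M)) := by
      rw [← Submodule.map_span]; exact Submodule.mem_map_of_mem hx
    exact Submodule.span_le_restrictScalars ℤ ℝ _ h1
  have hrank : Module.finrank ℤ (Submodule.span ℤ (X : Set M)) = k := by
    apply le_antisymm
    · have h1 := hT.linearIndependent (linearIndependent_finBasis (Submodule.span ℤ (X : Set M)))
      have h2 : LinearIndependent ℝ (fun i => (⟨T (Module.finBasis ℤ (Submodule.span ℤ (X : Set M)) i : M),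
          memspan _ (Module.finBasis ℤ (Submodule.span ℤ (X : Set M)) i).2⟩ :
          Submodule.span ℝ (T '' (X : Set M)))) :=
        LinearIndependent.of_comp (Submodule.subtype _) h1
      simpa using h2.fintype_card_le_finrank
    · choose g hgX hg using hfX
      have h1 : LinearIndependent ℤ g := of_real g (by simpa [hg] using hf)
      have h2 : LinearIndependent ℤ (fun i => (⟨g i, Submodule.subset_span (hgX i)⟩ :
          Submodule.span ℤ (X : Set M))) := LinearIndependent.of_comp (Submodule.subtype _) h1
      simpa using h2.fintype_card_le_finrank
  rw [hrank]
  obtain ⟨w, hw, hmax⟩ := (Finset.univ.filter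
    (fun w : Fin k → X => LinearIndependent ℤ (fun i => (w i : M)))).exists_max_image
      (fun w => gramDet (fun i => T (w i : M))) (by
        choose g hgX hg using hfX
        exact ⟨fun i => ⟨g i, hgX i⟩, by
          simp only [Finset.mem_filter, Finset.mem_univ, true_and]
          exact of_real g (by simpa [hg] using hf)⟩)
  simp only [Finset.mem_filter, Finset.mem_univ, true_and] at hw hmax
  have hwR := hT.linearIndependent hw
  have hspan : Submodule.span ℝ (Set.range fun i => T (w i : M)) =
      Submodule.span ℝ (T '' (X : Set M)) := by
    apply Submodule.eq_of_le_of_finrank_eq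
    · rw [Submodule.span_le]
      rintro _ ⟨i, rfl⟩
      exact Submodule.subset_span ⟨_, (w i).2, rfl⟩
    · rw [finrank_span_eq_card hwR]; simp [hk]
  refine ⟨fun i => w i, fun i => (w i).2, hw, fun x hx => ?_⟩
  have h1 : T x ∈ Submodule.span ℝ (Set.range fun i => T (w i : M)) := by
    rw [hspan]; exact Submodule.subset_span ⟨x, hx, rfl⟩
  obtain ⟨c, hc⟩ := (Submodule.mem_span_range_iff_exists_fun ℝ).mp h1
  refine ⟨c, hc.symm, fun i => ?_⟩
  by_contra! hci
  have h2 := gramDet_update (fun i => T (w i : M)) i (T x) c hc.symm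
  have h3 := gramDet_pos hwR
  have h4 : Function.update (fun i => T (w i : M)) i (T x) =
      fun j => T (Function.update w i ⟨x, hx⟩ j : M) := by
    ext j
    rcases eq_or_ne j i with rfl | h
    · simp
    · simp [h]
  rw [h4] at h2
  have h5 : (1 : ℝ) < c i ^ 2 := by
    rw [← sq_abs]; nlinarith
  have h6 := hmax (Function.update w i ⟨x, hx⟩) (of_real (fun j => (Function.update w i ⟨x, hx⟩ j : M)) (by
    apply Matrix.linearIndependent_of_det_gram_ne_zero
    change gramDet _ ≠ 0
    rw [h2]
    positivity))
  rw [h2] at h6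
  nlinarith

/-- Upper bound for the number of lattice points in a ball. -/
theorem exists_card_le_exp_latVal {T : M →ₗ[ℤ] E} (hT : IsLatticeMap T) {V : Submodule ℤ M} {σ : ℝ}
    {X : Finset M} (hXV : ∀ x ∈ X, x ∈ V) (hX : ∀ x ∈ X, ‖T x‖ ≤ Real.exp σ) :
    ∃ S ≤ V, (X.card : ℝ) ≤ 3 ^ Module.finrank ℤ M * Real.exp (latVal T σ S) := by
  classical
  have hex := exists_linearIndependent_coords_le_one hT X
  refine ⟨Submodule.span ℤ (X : Set M), Submodule.span_le.mpr hXV, ?_⟩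
  set S := Submodule.span ℤ (X : Set M) with hS
  set k := Module.finrank ℤ S
  obtain ⟨w, hwX, hw, hc⟩ := hex
  have hwS : ∀ i, w i ∈ S := fun i => Submodule.subset_span (hwX i)
  let w' : Fin k → S := fun i => ⟨w i, hwS i⟩
  have hw' : LinearIndependent ℤ w' := LinearIndependent.of_comp S.subtype hw
  set Q := Submodule.span ℤ (Set.range w')
  have hq := card_quotient_pos hw' (by simp [k])
  have hdet := gramDet_eq_card_sq_mul T hw' (by simp [k])
  have : Finite (S ⧸ Q) := Nat.finite_of_card_ne_zero hq.ne'
  have := Fintype.ofFinite (S ⧸ Q)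
  choose! c hc hc1 using hc
  have hwR := hT.linearIndependent hw
  let F : X → (S ⧸ Q) × (Fin k → Finset.Icc (-1 : ℤ) 1) := fun x =>
    (Submodule.Quotient.mk ⟨x, Submodule.subset_span x.2⟩, fun i => ⟨⌊c x i⌋, by
      have := abs_le.mp (hc1 x x.2 i)
      rw [Finset.mem_Icc]
      exact ⟨Int.le_floor.mpr (by simpa using this.1),
        Int.floor_le_iff.mpr (by push_cast; linarith)⟩⟩)
  have hF : Function.Injective F := by
    intro x y hxy
    simp only [F, Prod.mk.injEq] at hxy
    obtain ⟨h1, h2⟩ := hxy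
    rw [Submodule.Quotient.eq] at h1
    obtain ⟨n, hn⟩ := (Submodule.mem_span_range_iff_exists_fun ℤ).mp h1
    have hn' : ∑ i, n i • w i = (x : M) - y := by
      have := congrArg (S.subtype) hn
      simpa [w'] using this
    have h3 : ∑ i, (n i : ℝ) • T (w i) = ∑ i, (c x i - c y i) • T (w i) := by
      simp only [sub_smul, Finset.sum_sub_distrib]
      rw [← hc x x.2, ← hc y y.2, ← map_sub, ← hn', map_sum]
      simp [Int.cast_smul_eq_zsmul]
    have h4 : ∀ i, (n i : ℝ) = c x i - c y i := by
      have h5 := Fintype.linearIndependent_iff.mp hwR (fun i => (n i : ℝ) - (c x i - c y i)) (by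
        simp only [sub_smul _ (_ - _), Finset.sum_sub_distrib, h3, sub_self])
      intro i
      linarith [h5 i]
    have h6 : ∀ i, n i = 0 := by
      intro i
      have h7 : ⌊c x i⌋ = ⌊c y i⌋ := by
        have := congrFun h2 i
        simpa using this
      have h8 := Int.abs_sub_lt_one_of_floor_eq_floor h7
      rw [← h4 i] at h8
      have : |n i| < 1 := by exact_mod_cast h8
      exact Int.abs_lt_one_iff.mp this
    have h9 : (x : M) - y = 0 := by rw [← hn']; simp [h6]
    exact Subtype.ext (sub_eq_zero.mp h9)
  have hcard := Fintype.card_le_of_injective F hF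
  rw [Fintype.card_coe, Fintype.card_prod, Fintype.card_fun, Fintype.card_coe, Fintype.card_fin,
    Int.card_Icc, ← Nat.card_eq_fintype_card] at hcard
  have hk : k ≤ Module.finrank ℤ M := Submodule.finrank_le S
  have hgram : gramDet (fun i => T (w i)) ≤ (Real.exp (σ * k)) ^ 2 := by
    refine (gramDet_le_prod_norm _).trans ?_
    refine pow_le_pow_left₀ (Finset.prod_nonneg fun _ _ => norm_nonneg _) ?_ 2
    calc ∏ i, ‖T (w i)‖ ≤ ∏ _i : Fin k, Real.exp σ :=
          Finset.prod_le_prod (fun _ _ => norm_nonneg _) fun i _ => hX _ (hwX i)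
      _ = Real.exp (σ * k) := by
          rw [Finset.prod_const, Finset.card_univ, Fintype.card_fin, ← Real.exp_nat_mul, mul_comm]
  have hidx : (Nat.card (S ⧸ Q) : ℝ) ≤ Real.exp (latVal T σ S) := by
    have hp := latDet_pos hT S
    have hlog := Real.log_le_log (gramDet_pos hwR) hgram
    change gramDet (fun i => T (w i)) = _ at hdet
    rw [hdet, Real.log_mul (by positivity) hp.ne', Real.log_pow, Real.log_pow, Real.log_exp] at hlog
    rw [← Real.log_le_iff_le_exp (by exact_mod_cast hq), latVal, logVol]
    push_cast at hlog
    linarith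
  calc (X.card : ℝ) ≤ Nat.card (S ⧸ Q) * 3 ^ k := by exact_mod_cast hcard
    _ ≤ Real.exp (latVal T σ S) * 3 ^ Module.finrank ℤ M := by
        gcongr
        norm_num
    _ = _ := mul_comm _ _

end LatticePointUpperBound

section LatticePointLowerBound

variable {E : Type*} [NormedAddCommGroup E] [InnerProductSpace ℝ E]
variable {M : Type*} [AddCommGroup M] [Module.Free ℤ M] [Module.Finite ℤ M]

lemma half_le_card_Icc_ceil_floor (t : ℝ) {h : ℝ} (hh : 1 ≤ h) :
    h ≤ ((Finset.Icc ⌈t - h⌉ ⌊t + h⌋).card : ℝ) := by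
  rw [Int.card_Icc]
  have h1 := Int.lt_floor_add_one (t + h)
  have h2 := Int.ceil_lt_add_one (t - h)
  have h3 : ((⌊t + h⌋ + 1 - ⌈t - h⌉ : ℤ) : ℝ) ≤ ((⌊t + h⌋ + 1 - ⌈t - h⌉).toNat : ℝ) := by
    exact_mod_cast Int.self_le_toNat _
  push_cast at h3
  linarith

/-- Lower bound, by the Gram–Schmidt process, for the number of lattice points close to `z`. -/
lemma exists_card_near_point {n : ℕ} : ∀ v : Fin n → E, LinearIndependent ℝ v → ∃ s₀ : ℝ, 0 < s₀ ∧
    ∀ s ≥ s₀, ∀ z ∈ Submodule.span ℝ (Set.range v), ∃ Y : Finset (Fin n → ℤ),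
      (s / 2) ^ n ≤ Y.card * listVol (List.ofFn v) ∧
      ∀ y ∈ Y, ‖∑ i, (y i : ℝ) • v i - z‖ ^ 2 ≤ n * (s / 2) ^ 2 := by
  classical
  induction n with
  | zero =>
    intro v hv
    refine ⟨1, one_pos, fun s hs z hz => ⟨Finset.univ, ?_, ?_⟩⟩
    · simp [listVol]
    · intro y hy
      have : z = 0 := by simpa using hz
      simp [this]
  | succ n ih =>
    intro v hv
    set x := v 0 with hx
    set v' : Fin n → E := fun i => v i.succ with hv'
    have hcons : v = Fin.cons x v' := by
      ext i; refine Fin.cases ?_ (fun i => ?_) i <;> simp [hx, hv']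
    have hv'li : LinearIndependent ℝ v' := hv.comp _ (Fin.succ_injective n)
    obtain ⟨s₀, hs₀, ih⟩ := ih v' hv'li
    obtain ⟨c, horth, hdist⟩ := exists_spanDist v' x
    set q := x - ∑ j, c j • v' j with hq
    have hqspan : ∑ j, c j • v' j ∈ Submodule.span ℝ (Set.range v') :=
      Submodule.sum_mem _ fun j _ => Submodule.smul_mem _ _ (Submodule.subset_span ⟨j, rfl⟩)
    have hg : 0 < ‖q‖ := by
      rw [norm_pos_iff]
      intro h0
      have h1 : x ∉ Submodule.span ℝ (Set.range v') := by
        rw [hcons] at hv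
        exact (linearIndependent_finCons.mp hv).2
      apply h1
      rw [sub_eq_zero.mp h0]
      exact hqspan
    have horth' : ∀ y ∈ Submodule.span ℝ (Set.range v'), inner ℝ q y = 0 := by
      intro y hy
      induction hy using Submodule.span_induction with
      | mem y hy => obtain ⟨i, rfl⟩ := hy; rw [real_inner_comm]; exact horth i
      | zero => simp
      | add a b _ _ ha hb => rw [inner_add_right, ha, hb, add_zero]
      | smul r a _ ha => rw [inner_smul_right, ha, mul_zero]
    have hset : {y | y ∈ List.ofFn v'} = Set.range v' := by
      ext y; simp [List.mem_ofFn]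
    have hvol : listVol (List.ofFn v) = ‖q‖ * listVol (List.ofFn v') := by
      rw [List.ofFn_succ]
      change spanDist {y | y ∈ List.ofFn v'} x * _ = _
      rw [hset, hdist]
    refine ⟨max s₀ (2 * ‖q‖), lt_max_of_lt_left hs₀, fun s hs z hz => ?_⟩
    have hs1 : s₀ ≤ s := (le_max_left _ _).trans hs
    have hs2 : 2 * ‖q‖ ≤ s := (le_max_right _ _).trans hs
    have hspos : 0 < s := hs₀.trans_le hs1
    obtain ⟨t, z', hz', rfl⟩ : ∃ (t : ℝ) (z' : E), z' ∈ Submodule.span ℝ (Set.range v') ∧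
        t • x + z' = z := by
      rw [hcons, Fin.range_cons, Submodule.mem_span_insert] at hz
      obtain ⟨t, z', hz', h⟩ := hz
      exact ⟨t, z', hz', h.symm⟩
    set h := s / (2 * ‖q‖) with hh
    have h1 : 1 ≤ h := by rw [hh, le_div_iff₀ (by positivity)]; linarith
    have hmem : ∀ m : ℤ, z' - ((m : ℝ) - t) • ∑ j, c j • v' j ∈
        Submodule.span ℝ (Set.range v') := fun m =>
      Submodule.sub_mem _ hz' (Submodule.smul_mem _ _ hqspan)
    choose Y hYc hYn using fun m : ℤ => ih s hs1 _ (hmem m)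
    let I := Finset.Icc ⌈t - h⌉ ⌊t + h⌋
    let W : Finset (Fin (n + 1) → ℤ) :=
      (I.sigma Y).image fun a : (_ : ℤ) × (Fin n → ℤ) => (Fin.cons a.1 a.2 : Fin (n + 1) → ℤ)
    have hWcard : W.card = ∑ m ∈ I, (Y m).card := by
      rw [Finset.card_image_of_injective, Finset.card_sigma]
      rintro ⟨a, b⟩ ⟨a', b'⟩ hab
      have := Fin.cons_injective2 hab
      obtain ⟨rfl, rfl⟩ := this
      rfl
    refine ⟨W, ?_, ?_⟩
    · rw [hWcard, hvol, Nat.cast_sum, Finset.sum_mul]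
      calc (s / 2) ^ (n + 1) = h * ((s / 2) ^ n * ‖q‖) := by
            rw [hh, pow_succ]; field_simp
        _ ≤ I.card * ((s / 2) ^ n * ‖q‖) := by
            gcongr
            exact half_le_card_Icc_ceil_floor t h1
        _ = ∑ m ∈ I, ((s / 2) ^ n * ‖q‖) := by rw [Finset.sum_const, nsmul_eq_mul]
        _ ≤ ∑ m ∈ I, ((Y m).card : ℝ) * (‖q‖ * listVol (List.ofFn v')) := by
            refine Finset.sum_le_sum fun m _ => ?_
            have := mul_le_mul_of_nonneg_right (hYc m) hg.le
            linarith
    · intro y hy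
      obtain ⟨⟨m, y'⟩, hmy, rfl⟩ := Finset.mem_image.mp hy
      rw [Finset.mem_sigma] at hmy
      obtain ⟨hm, hy'⟩ := hmy
      have hdec : ∑ i, (((Fin.cons m y' : Fin (n + 1) → ℤ) i : ℤ) : ℝ) • v i - (t • x + z') =
          ((m : ℝ) - t) • q + (∑ i, (y' i : ℝ) • v' i -
            (z' - ((m : ℝ) - t) • ∑ j, c j • v' j)) := by
        rw [Fin.sum_univ_succ]
        simp only [Fin.cons_zero, Fin.cons_succ, hq, smul_sub, sub_smul]
        abel
      have hsp : ∑ i, (y' i : ℝ) • v' i - (z' - ((m : ℝ) - t) • ∑ j, c j • v' j) ∈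
          Submodule.span ℝ (Set.range v') :=
        Submodule.sub_mem _ (Submodule.sum_mem _ fun j _ =>
          Submodule.smul_mem _ _ (Submodule.subset_span ⟨j, rfl⟩)) (hmem m)
      have hpyth := norm_add_sq_real (((m : ℝ) - t) • q) (∑ i, (y' i : ℝ) • v' i -
            (z' - ((m : ℝ) - t) • ∑ j, c j • v' j))
      rw [inner_smul_left, horth' _ hsp] at hpyth
      rw [hdec, hpyth]
      have hb := hYn m y' hy'
      have ha : ‖((m : ℝ) - t) • q‖ ^ 2 ≤ (s / 2) ^ 2 := by
        rw [norm_smul]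
        have hm' := Finset.mem_Icc.mp hm
        have e1 := Int.ceil_le.mp hm'.1
        have e2 := Int.le_floor.mp hm'.2
        have e3 : ‖(m : ℝ) - t‖ ≤ h := by
          rw [Real.norm_eq_abs, abs_le]; constructor <;> linarith
        have e4 : h * ‖q‖ = s / 2 := by rw [hh]; field_simp
        rw [← e4]
        gcongr
      push_cast
      simp only [mul_zero, add_zero]
      linarith

/-- Lower bound for the number of points of a sublattice in a ball. -/
theorem exists_exp_latVal_le_card {T : M →ₗ[ℤ] E} (hT : IsLatticeMap T) (S : Submodule ℤ M)
    (σ : ℝ) : ∃ X : Finset M, (∀ x ∈ X, x ∈ S ∧ ‖T x‖ ≤ Real.exp σ) ∧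
      Real.exp (latVal T σ S) ≤
        (2 * (Module.finrank ℤ M + 1)) ^ Module.finrank ℤ M * (X.card : ℝ) := by
  classical
  set n := Module.finrank ℤ M
  set k := Module.finrank ℤ S with hk
  have hkn : k ≤ n := Submodule.finrank_le S
  set b : Fin k → M := S.subtype ∘ Module.finBasis ℤ S with hb
  have hbZ : LinearIndependent ℤ b := linearIndependent_finBasis S
  have hbR : LinearIndependent ℝ (fun i => T (b i)) := hT.linearIndependent hbZ
  have hgram : latDet T S = listVol (List.ofFn fun i => T (b i)) ^ 2 := by
    rw [← gramDet_eq_listVol_sq]; rfl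
  set vol := listVol (List.ofFn fun i => T (b i)) with hvol
  have hvolpos : 0 < vol := by
    refine lt_of_le_of_ne (listVol_nonneg _) fun h0 => ?_
    have := latDet_pos hT S
    rw [hgram, ← h0] at this
    simp at this
  obtain ⟨s₀, hs₀, hnear⟩ := exists_card_near_point _ hbR
  set u := Real.exp σ with hu
  have hupos : 0 < u := Real.exp_pos σ
  have hexp : Real.exp (latVal T σ S) = u ^ k / vol := by
    rw [latVal, logVol, hgram, Real.log_pow, Real.exp_sub, mul_comm, Real.exp_nat_mul]
    congr 1
    rw [show ((2 : ℕ) : ℝ) * Real.log vol / 2 = Real.log vol by push_cast; ring,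
      Real.exp_log hvolpos]
  set K : ℝ := n + 1 with hK
  have hKpos : 0 < K := by positivity
  have hkK : (k : ℝ) ≤ K ^ 2 := by
    have : (k : ℝ) ≤ n := by exact_mod_cast hkn
    have : (0 : ℝ) ≤ n := by positivity
    rw [hK]; nlinarith
  obtain ⟨q, hq⟩ := exists_nat_ge (max 1 (s₀ * K / u))
  have hq1 : (1 : ℝ) ≤ q := (le_max_left _ _).trans hq
  have hq2 : s₀ ≤ q * u / K := by
    have := (le_max_right _ _).trans hq
    rw [div_le_iff₀ hupos] at this
    rw [le_div_iff₀ hKpos]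
    exact this
  have hqN : 0 < q := by exact_mod_cast (by linarith : (0 : ℝ) < q)
  have : NeZero q := ⟨hqN.ne'⟩
  obtain ⟨Y, hYc, hYn⟩ := hnear _ hq2 0 (Submodule.zero_mem _)
  have hYn' : ∀ y ∈ Y, ‖∑ i, (y i : ℝ) • T (b i)‖ ≤ q * u / 2 := by
    intro y hy
    have h1 := hYn y hy
    rw [sub_zero] at h1
    refine le_of_sq_le_sq ?_ (by positivity) 
    refine h1.trans ?_
    calc (k : ℝ) * (q * u / K / 2) ^ 2 ≤ K ^ 2 * (q * u / K / 2) ^ 2 := by gcongr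
      _ = (q * u / 2) ^ 2 := by field_simp
  let f : (Fin k → ℤ) → (Fin k → ZMod q) := fun y i => (y i : ZMod q)
  obtain ⟨r, -, hr⟩ := Finset.exists_le_card_fiber_of_nsmul_le_card_of_maps_to
    (s := Y) (t := Finset.univ) (f := f) (b := (Y.card : ℝ) / q ^ k)
    (fun _ _ => Finset.mem_univ _) Finset.univ_nonempty (by
      rw [Finset.card_univ, Fintype.card_fun, ZMod.card, Fintype.card_fin, nsmul_eq_mul]
      push_cast
      apply le_of_eq
      field_simp)
  set Z := Y.filter fun y => f y = r with hZ
  have hYpos : 0 < Y.card := by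
    rcases Nat.eq_zero_or_pos Y.card with h0 | h0
    · rw [h0] at hYc
      have : 0 < (q * u / K / 2) ^ k := by positivity
      simp at hYc
      linarith
    · exact h0
  have hZpos : 0 < Z.card := by
    have : (0 : ℝ) < Z.card := lt_of_lt_of_le (by positivity) hr
    exact_mod_cast this
  obtain ⟨y₀, hy₀⟩ := Finset.card_pos.mp hZpos
  let F : (Fin k → ℤ) → M := fun y => ∑ i, ((y i - y₀ i) / (q : ℤ)) • b i
  have hdvd : ∀ y ∈ Z, ∀ i, (q : ℤ) ∣ y i - y₀ i := by
    intro y hy i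
    rw [Finset.mem_filter] at hy hy₀
    have h1 := congrFun (hy.2.trans hy₀.2.symm) i
    exact (ZMod.intCast_eq_intCast_iff_dvd_sub _ _ _).mp h1.symm
  have hinj : Set.InjOn F Z := by
    intro y hy y' hy' h
    have h1 := Fintype.linearIndependent_iff.mp hbZ
      (fun i => (y i - y₀ i) / (q : ℤ) - (y' i - y₀ i) / (q : ℤ)) (by
        simp only [sub_smul, Finset.sum_sub_distrib]
        exact sub_eq_zero.mpr h)
    ext i
    have h2 := sub_eq_zero.mp (h1 i)
    have h3 := Int.ediv_mul_cancel (hdvd y hy i)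
    have h4 := Int.ediv_mul_cancel (hdvd y' hy' i)
    rw [h2, h4] at h3
    linarith
  refine ⟨Z.image F, ?_, ?_⟩
  · intro x hx
    obtain ⟨y, hy, rfl⟩ := Finset.mem_image.mp hx
    refine ⟨Submodule.sum_mem _ fun i _ => Submodule.smul_mem _ _
      (Module.finBasis ℤ S i).2, ?_⟩
    have h1 : (q : ℝ) • T (F y) = ∑ i, (y i : ℝ) • T (b i) - ∑ i, (y₀ i : ℝ) • T (b i) := by
      rw [← Finset.sum_sub_distrib, map_sum, Finset.smul_sum]
      refine Finset.sum_congr rfl fun i _ => ?_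
      rw [map_smul, ← sub_smul, ← Int.cast_smul_eq_zsmul ℝ, smul_smul]
      congr 1
      have h3 := Int.ediv_mul_cancel (hdvd y hy i)
      have h4 : (((y i - y₀ i) / (q : ℤ) * (q : ℤ) : ℤ) : ℝ) = ((y i - y₀ i : ℤ) : ℝ) := by rw [h3]
      push_cast at h4
      linarith
    have h2 : (q : ℝ) * ‖T (F y)‖ ≤ q * u := by
      rw [← Real.norm_of_nonneg (by positivity : (0 : ℝ) ≤ q), ← norm_smul, h1,
        Real.norm_of_nonneg (by positivity : (0 : ℝ) ≤ q)]
      refine (norm_sub_le _ _).trans ?_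
      have e1 := hYn' y (Finset.mem_filter.mp hy).1
      have e2 := hYn' y₀ (Finset.mem_filter.mp hy₀).1
      linarith
    exact le_of_mul_le_mul_left h2 (by linarith)
  · rw [Finset.card_image_of_injOn hinj, hexp]
    have h1 : (u / (2 * K)) ^ k ≤ Z.card * vol := by
      have h2 : (u / (2 * K)) ^ k = (q * u / K / 2) ^ k / q ^ k := by
        rw [← div_pow]; congr 1; field_simp
      rw [h2, div_le_iff₀ (by positivity)]
      rw [div_le_iff₀ (by positivity)] at hr
      calc _ ≤ _ := hYc
        _ ≤ (Z.card * (q : ℝ) ^ k) * vol := by gcongr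
        _ = _ := by ring
    rw [div_le_iff₀ hvolpos]
    calc u ^ k = (2 * K) ^ k * (u / (2 * K)) ^ k := by rw [← mul_pow]; congr 1; field_simp
      _ ≤ (2 * K) ^ n * (Z.card * vol) := by
          gcongr
          rw [hK]
          have : (0 : ℝ) ≤ n := by positivity
          linarith
      _ = _ := by ring

end LatticePointLowerBound

section Hull

variable {E : Type*} [NormedAddCommGroup E] [InnerProductSpace ℝ E]
variable {M : Type*} [AddCommGroup M] [Module.Free ℤ M] [Module.Finite ℤ M]

lemma latVal_add_le {T : M →ₗ[ℤ] E} (hT : IsLatticeMap T) {σ τ : ℝ} (h : σ ≤ τ)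
    (W X : Submodule ℤ M) :
    latVal T σ W + latVal T τ X ≤ latVal T σ (W ⊓ X) + latVal T τ (W ⊔ X) := by
  have h1 := logVol_inf_add_logVol_sup_le hT W X
  have h2 := finrank_sup_add_finrank_inf W X
  have h3 : Module.finrank ℤ (W ⊓ X : Submodule ℤ M) ≤ Module.finrank ℤ W :=
    Submodule.finrank_mono inf_le_left
  have h2' : (Module.finrank ℤ (W ⊔ X : Submodule ℤ M) : ℝ) +
      Module.finrank ℤ (W ⊓ X : Submodule ℤ M) = Module.finrank ℤ W + Module.finrank ℤ X := by
    exact_mod_cast h2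
  have h3' : (Module.finrank ℤ (W ⊓ X : Submodule ℤ M) : ℝ) ≤ Module.finrank ℤ W := by
    exact_mod_cast h3
  have h4 : (Module.finrank ℤ (W ⊔ X : Submodule ℤ M) : ℝ) = Module.finrank ℤ W +
      Module.finrank ℤ X - Module.finrank ℤ (W ⊓ X : Submodule ℤ M) := by linarith
  have h5 := mul_nonneg (sub_nonneg.mpr h) (sub_nonneg.mpr h3')
  simp only [latVal, h4]
  linarith

lemma latVal_le_of_finrank_eq {T : M →ₗ[ℤ] E} (hT : IsLatticeMap T) (σ : ℝ)
    {S' S : Submodule ℤ M} (h : S' ≤ S) (hr : Module.finrank ℤ S' = Module.finrank ℤ S) :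
    latVal T σ S' ≤ latVal T σ S := by
  have := logVol_anti hT h hr
  simp only [latVal, hr]
  linarith

/-- A choice of sublattices between `A` and `B`, one for each rank, of minimal covolume. -/
lemma exists_minimizers {T : M →ₗ[ℤ] E} (hT : IsLatticeMap T) (hI : IsIntegralMap T)
    {A B : Submodule ℤ M} (hAB : A ≤ B) : ∃ F : ℕ → Submodule ℤ M, (∀ k, F k ∈ Set.Icc A B) ∧
      ∀ S ∈ Set.Icc A B, Module.finrank ℤ (F (Module.finrank ℤ S)) = Module.finrank ℤ S ∧
        ∀ σ, latVal T σ S ≤ latVal T σ (F (Module.finrank ℤ S)) := by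
  have key : ∀ k, ∃ S ∈ Set.Icc A B, ∀ S' ∈ Set.Icc A B, Module.finrank ℤ S' = k →
      Module.finrank ℤ S = k ∧ logVol T S ≤ logVol T S' := by
    intro k
    by_cases hne : ({S | S ∈ Set.Icc A B ∧ Module.finrank ℤ S = k} : Set _).Nonempty
    · obtain ⟨S, hS, hmin⟩ := hI.exists_logVol_min hT hne
      exact ⟨S, hS.1, fun S' hS' hk => ⟨hS.2, hmin S' ⟨hS', hk⟩⟩⟩
    · refine ⟨A, ⟨le_rfl, hAB⟩, fun S' hS' hk => ?_⟩
      exact (hne ⟨S', hS', hk⟩).elim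
  choose F hF hmin using key
  refine ⟨F, hF, fun S hS => ?_⟩
  obtain ⟨h1, h2⟩ := hmin _ S hS rfl
  refine ⟨h1, fun σ => ?_⟩
  simp only [latVal, h1]
  linarith

/-- The maximum of `latVal T σ` over the sublattices between `A` and `B`. -/
noncomputable def hull (T : M →ₗ[ℤ] E) (A B : Submodule ℤ M) (σ : ℝ) : ℝ :=
  sSup (latVal T σ '' Set.Icc A B)

lemma hull_isGreatest {T : M →ₗ[ℤ] E} (hT : IsLatticeMap T) (hI : IsIntegralMap T)
    {A B : Submodule ℤ M} (hAB : A ≤ B) (σ : ℝ) :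
    IsGreatest (latVal T σ '' Set.Icc A B) (hull T A B σ) := by
  obtain ⟨F, hF, hdom⟩ := exists_minimizers hT hI hAB
  obtain ⟨k, -, hk⟩ := (Finset.range (Module.finrank ℤ M + 1)).exists_max_image
    (fun k => latVal T σ (F k)) ⟨0, by simp⟩
  have : IsGreatest (latVal T σ '' Set.Icc A B) (latVal T σ (F k)) := by
    refine ⟨⟨_, hF k, rfl⟩, ?_⟩
    rintro _ ⟨S, hS, rfl⟩
    refine ((hdom S hS).2 σ).trans (hk _ ?_)
    have := Submodule.finrank_le S
    rw [Finset.mem_range]; omega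
  rw [hull, this.csSup_eq]
  exact this

lemma exists_latVal_eq_hull {T : M →ₗ[ℤ] E} (hT : IsLatticeMap T) (hI : IsIntegralMap T)
    {A B : Submodule ℤ M} (hAB : A ≤ B) (σ : ℝ) :
    ∃ S, A ≤ S ∧ S ≤ B ∧ latVal T σ S = hull T A B σ := by
  obtain ⟨S, hS, h⟩ := (hull_isGreatest hT hI hAB σ).1
  exact ⟨S, hS.1, hS.2, h⟩

lemma latVal_le_hull {T : M →ₗ[ℤ] E} (hT : IsLatticeMap T) (hI : IsIntegralMap T)
    {A B S : Submodule ℤ M} (hA : A ≤ S) (hB : S ≤ B) (σ : ℝ) :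
    latVal T σ S ≤ hull T A B σ :=
  (hull_isGreatest hT hI (hA.trans hB) σ).2 ⟨S, ⟨hA, hB⟩, rfl⟩

lemma hull_mono {T : M →ₗ[ℤ] E} (hT : IsLatticeMap T) (hI : IsIntegralMap T)
    {A A' B B' : Submodule ℤ M} (hAB : A ≤ B) (hA : A' ≤ A) (hB : B ≤ B') (σ : ℝ) :
    hull T A B σ ≤ hull T A' B' σ := by
  obtain ⟨S, h1, h2, h3⟩ := exists_latVal_eq_hull hT hI hAB σ
  rw [← h3]
  exact latVal_le_hull hT hI (hA.trans h1) (h2.trans hB) σ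

lemma continuous_latVal (T : M →ₗ[ℤ] E) (S : Submodule ℤ M) :
    Continuous fun σ => latVal T σ S := by
  unfold latVal
  fun_prop

lemma continuous_hull {T : M →ₗ[ℤ] E} (hT : IsLatticeMap T) (hI : IsIntegralMap T)
    {A B : Submodule ℤ M} (hAB : A ≤ B) : Continuous (hull T A B) := by
  obtain ⟨F, hF, hdom⟩ := exists_minimizers hT hI hAB
  have : hull T A B = fun σ => (Finset.range (Module.finrank ℤ M + 1)).sup' ⟨0, by simp⟩
      (fun k => latVal T σ (F k)) := by
    ext σ
    apply le_antisymm
    · obtain ⟨S, h1, h2, h3⟩ := exists_latVal_eq_hull hT hI hAB σ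
      rw [← h3]
      refine ((hdom S ⟨h1, h2⟩).2 σ).trans (Finset.le_sup' (fun k => latVal T σ (F k)) ?_)
      have := Submodule.finrank_le S
      rw [Finset.mem_range]; omega
    · exact Finset.sup'_le _ _ fun k _ => latVal_le_hull hT hI (hF k).1 (hF k).2 σ
  rw [this]
  exact Continuous.finset_sup'_apply _ fun k _ => continuous_latVal T (F k)

/-- If every sublattice attaining the hull at `σ` has the same rank as `S₀`, then the hull agrees
with `latVal T · S₀` near `σ`. -/
lemma eventually_hull_eq_latVal {T : M →ₗ[ℤ] E} (hT : IsLatticeMap T) (hI : IsIntegralMap T)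
    {A B S₀ : Submodule ℤ M} (hA : A ≤ S₀) (hB : S₀ ≤ B) {σ : ℝ}
    (hatt : latVal T σ S₀ = hull T A B σ)
    (h : ∀ S, A ≤ S → S ≤ B → latVal T σ S = hull T A B σ →
      Module.finrank ℤ S = Module.finrank ℤ S₀) :
    ∀ᶠ τ in nhds σ, hull T A B τ = latVal T τ S₀ := by
  obtain ⟨F, hF, hdom⟩ := exists_minimizers hT hI (hA.trans hB)
  have key : ∀ k ∈ Finset.range (Module.finrank ℤ M + 1), ∀ᶠ τ in nhds σ,
      latVal T τ (F k) ≤ latVal T τ S₀ := by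
    intro k _
    by_cases hk : latVal T σ (F k) = hull T A B σ
    · have hr := h (F k) (hF k).1 (hF k).2 hk
      refine Filter.Eventually.of_forall fun τ => ?_
      rw [← hatt] at hk
      simp only [latVal, hr] at hk ⊢
      linarith
    · have hlt : latVal T σ (F k) < latVal T σ S₀ := by
        rw [hatt]
        exact lt_of_le_of_ne (latVal_le_hull hT hI (hF k).1 (hF k).2 σ) hk
      filter_upwards [(continuous_latVal T (F k)).continuousAt.eventually_lt
        (continuous_latVal T S₀).continuousAt hlt] with τ hτ using hτ.le
  filter_upwards [(Filter.eventually_all_finset _).mpr key] with τ hτ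
  refine le_antisymm ?_ (latVal_le_hull hT hI hA hB τ)
  obtain ⟨S, h1, h2, h3⟩ := exists_latVal_eq_hull hT hI (hA.trans hB) τ
  rw [← h3]
  refine ((hdom S ⟨h1, h2⟩).2 τ).trans (hτ _ ?_)
  have := Submodule.finrank_le S
  rw [Finset.mem_range]; omega

lemma two_mul_hull_le {T : M →ₗ[ℤ] E} (hT : IsLatticeMap T) (hI : IsIntegralMap T)
    {A B : Submodule ℤ M} (hAB : A ≤ B) (σ δ : ℝ) :
    2 * hull T A B σ ≤ hull T A B (σ - δ) + hull T A B (σ + δ) := by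
  obtain ⟨S, h1, h2, h3⟩ := exists_latVal_eq_hull hT hI hAB σ
  have e1 := latVal_le_hull hT hI h1 h2 (σ - δ)
  have e2 := latVal_le_hull hT hI h1 h2 (σ + δ)
  rw [← h3]
  simp only [latVal] at *
  linarith

lemma hull_add_le {T : M →ₗ[ℤ] E} (hT : IsLatticeMap T) (hI : IsIntegralMap T)
    {A B : Submodule ℤ M} (hAB : A ≤ B) (σ : ℝ) {δ : ℝ} (hδ : 0 ≤ δ) :
    hull T A B (σ + δ) ≤ hull T A B σ + δ * Module.finrank ℤ M := by
  obtain ⟨S, h1, h2, h3⟩ := exists_latVal_eq_hull hT hI hAB (σ + δ)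
  have e1 := latVal_le_hull hT hI h1 h2 σ
  have e2 : (Module.finrank ℤ S : ℝ) ≤ Module.finrank ℤ M := by
    exact_mod_cast Submodule.finrank_le S
  rw [← h3]
  simp only [latVal] at *
  nlinarith

end Hull

section Dilation

variable {E : Type*} [NormedAddCommGroup E] [InnerProductSpace ℝ E]
variable {M : Type*} [AddCommGroup M] [Module.Free ℤ M] [Module.Finite ℤ M]

/-- `T'` is obtained from `T` by scaling the real span of the image of `A` by `δ` and leaving the
quotient by that span unchanged. -/
structure IsDilation (T T' : M →ₗ[ℤ] E) (A : Submodule ℤ M) (δ : ℝ) : Prop where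
  smul : ∀ a ∈ A, T' a = δ • T a
  sub_mem : ∀ x, T' x - T x ∈ Submodule.span ℝ (T '' (A : Set M))

lemma span_image_eq_span_range_finBasis (T : M →ₗ[ℤ] E) (A : Submodule ℤ M) :
    Submodule.span ℝ (T '' (A : Set M)) =
      Submodule.span ℝ (Set.range fun i => T (Module.finBasis ℤ A i : M)) := by
  apply le_antisymm
  · rw [Submodule.span_le]
    rintro _ ⟨a, ha, rfl⟩
    have h1 : (⟨a, ha⟩ : A) = ∑ i, (Module.finBasis ℤ A).repr ⟨a, ha⟩ i • Module.finBasis ℤ A i :=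
      ((Module.finBasis ℤ A).sum_repr _).symm
    have h2 : a = ∑ i, (Module.finBasis ℤ A).repr ⟨a, ha⟩ i • (Module.finBasis ℤ A i : M) := by
      have := congrArg (Submodule.subtype A) h1
      simpa only [map_sum, map_smul, Submodule.subtype_apply] using this
    rw [h2, map_sum]
    refine Submodule.sum_mem _ fun i _ => ?_
    rw [map_smul, ← Int.cast_smul_eq_zsmul ℝ]
    exact Submodule.smul_mem _ _ (Submodule.subset_span ⟨i, rfl⟩)
  · apply Submodule.span_mono
    rintro _ ⟨i, rfl⟩
    exact ⟨_, (Module.finBasis ℤ A i).2, rfl⟩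

lemma IsDilation.latDet_eq {T T' : M →ₗ[ℤ] E} {A : Submodule ℤ M} {δ : ℝ}
    (h : IsDilation T T' A δ) {S : Submodule ℤ M} (hAS : A ≤ S) :
    latDet T' S = (δ ^ Module.finrank ℤ A) ^ 2 * latDet T S := by
  obtain ⟨l, b, hb, hbS, -, hl⟩ := exists_extension_span hAS
  set w₀ := Sum.elim b fun i => (Module.finBasis ℤ A i : M) with hw₀
  have hmem : ∀ i, w₀ i ∈ S := fun i => hbS (Submodule.subset_span ⟨i, rfl⟩)
  let w : Fin l ⊕ Fin (Module.finrank ℤ A) → S := fun i => ⟨w₀ i, hmem i⟩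
  have hw : LinearIndependent ℤ w := LinearIndependent.of_comp S.subtype hb
  have hcard : Fintype.card (Fin l ⊕ Fin (Module.finrank ℤ A)) = Module.finrank ℤ S := by
    simp [← hl, add_comm]
  have h1 := gramDet_eq_card_sq_mul T hw hcard
  have h2 := gramDet_eq_card_sq_mul T' hw hcard
  have h3 := card_quotient_pos hw hcard
  have hc : ∀ i, ∃ c : Fin (Module.finrank ℤ A) → ℝ,
      ∑ j, c j • T (Module.finBasis ℤ A j : M) = T' (b i) - T (b i) := by
    intro i
    have := h.sub_mem (b i)
    rw [span_image_eq_span_range_finBasis] at this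
    exact (Submodule.mem_span_range_iff_exists_fun ℝ).mp this
  choose C hC using hc
  have h4 := gramDet_linear_combination
    (Matrix.fromBlocks (1 : Matrix (Fin l) (Fin l) ℝ) (Matrix.of C) 0
      (δ • (1 : Matrix (Fin (Module.finrank ℤ A)) (Fin (Module.finrank ℤ A)) ℝ)))
    (fun i => T (w i : M)) (fun i => T' (w i : M)) (by
      rintro (i | i)
      · simp [w, hw₀, Fintype.sum_sum_type, Matrix.one_apply, hC]
      · simp [w, hw₀, Fintype.sum_sum_type, Matrix.one_apply,
          h.smul _ (Module.finBasis ℤ A i).2])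
  rw [Matrix.det_fromBlocks_zero₂₁] at h4
  simp only [Matrix.det_one, Matrix.det_smul, Fintype.card_fin, one_mul, mul_one] at h4
  rw [h2, h1] at h4
  have h5 : (Nat.card (S ⧸ Submodule.span ℤ (Set.range w)) : ℝ) ^ 2 ≠ 0 := by positivity
  apply mul_left_cancel₀ h5
  rw [h4]
  ring

lemma IsDilation.latDet_eq_of_le {T T' : M →ₗ[ℤ] E} {A : Submodule ℤ M} {δ : ℝ}
    (h : IsDilation T T' A δ) {B : Submodule ℤ M} (hBA : B ≤ A) :
    latDet T' B = (δ ^ Module.finrank ℤ B) ^ 2 * latDet T B := by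
  have h4 := gramDet_linear_combination
    (δ • (1 : Matrix (Fin (Module.finrank ℤ B)) (Fin (Module.finrank ℤ B)) ℝ))
    (fun i => T (Module.finBasis ℤ B i : M)) (fun i => T' (Module.finBasis ℤ B i : M))
    (fun i => by simp [Matrix.one_apply, h.smul _ (hBA (Module.finBasis ℤ B i).2)])
  simpa [latDet, Matrix.det_smul] using h4

lemma latVal_eq_of_latDet_eq {T T' : M →ₗ[ℤ] E} (hT : IsLatticeMap T) {S : Submodule ℤ M}
    {d : ℝ} {k : ℕ} (h : latDet T' S = (Real.exp (-d) ^ k) ^ 2 * latDet T S) (σ : ℝ) :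
    latVal T' σ S = latVal T σ S + k * d := by
  have h1 := latDet_pos hT S
  have h2 : logVol T' S = logVol T S - k * d := by
    rw [logVol, logVol, h, Real.log_mul (by positivity) h1.ne', Real.log_pow, Real.log_pow,
      Real.log_exp]
    push_cast
    ring
  rw [latVal, latVal, h2]
  ring

lemma IsDilation.latVal_eq {T T' : M →ₗ[ℤ] E} {A : Submodule ℤ M} {d : ℝ} (hT : IsLatticeMap T)
    (h : IsDilation T T' A (Real.exp (-d))) {S : Submodule ℤ M} (hAS : A ≤ S) (σ : ℝ) :
    latVal T' σ S = latVal T σ S + Module.finrank ℤ A * d :=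
  latVal_eq_of_latDet_eq hT (h.latDet_eq hAS) σ

lemma IsDilation.latVal_eq_of_le {T T' : M →ₗ[ℤ] E} {A : Submodule ℤ M} {d : ℝ}
    (hT : IsLatticeMap T) (h : IsDilation T T' A (Real.exp (-d))) {B : Submodule ℤ M}
    (hBA : B ≤ A) (σ : ℝ) :
    latVal T' σ B = latVal T σ B + Module.finrank ℤ B * d :=
  latVal_eq_of_latDet_eq hT (h.latDet_eq_of_le hBA) σ

/-- If `A` is scaled down far enough, adding `A` to a sublattice increases its value. -/
lemma IsDilation.latVal_le {T T' : M →ₗ[ℤ] E} {A : Submodule ℤ M} {d σ : ℝ}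
    (hT : IsLatticeMap T) (hI : IsIntegralMap T) (hT' : IsLatticeMap T')
    (h : IsDilation T T' A (Real.exp (-d))) (hd : logVol T A ≤ σ + d) (S : Submodule ℤ M) :
    latVal T' σ S ≤ latVal T σ (S ⊔ A) + Module.finrank ℤ A * d := by
  have h1 := latVal_add_le hT' (le_refl σ) S A
  rw [h.latVal_eq hT le_sup_right, h.latVal_eq_of_le hT inf_le_right,
    h.latVal_eq_of_le hT le_rfl] at h1
  have h2 : latVal T σ (S ⊓ A) + Module.finrank ℤ (S ⊓ A : Submodule ℤ M) * d ≤
      latVal T σ A + Module.finrank ℤ A * d := by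
    have hle : Module.finrank ℤ (S ⊓ A : Submodule ℤ M) ≤ Module.finrank ℤ A :=
      Submodule.finrank_mono inf_le_right
    rcases hle.eq_or_lt with heq | hlt
    · have := latVal_le_of_finrank_eq hT σ inf_le_right heq
      rw [heq]
      linarith
    · have h3 : (Module.finrank ℤ (S ⊓ A : Submodule ℤ M) : ℝ) + 1 ≤ Module.finrank ℤ A := by
        exact_mod_cast hlt
      have h4 := hI.logVol_nonneg hT (S ⊓ A)
      have h5 := hI.logVol_nonneg hT A
      simp only [latVal]
      nlinarith
  linarith

lemma IsDilation.sqMap {T T' : M →ₗ[ℤ] E} {A : Submodule ℤ M} {δ : ℝ}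
    (h : IsDilation T T' A δ) : IsDilation (sqMap T) (sqMap T') (A.prod A) δ where
  smul := by
    rintro ⟨a, b⟩ ⟨ha, hb⟩
    simp only [sqMap_apply, h.smul a ha, h.smul b hb]
    rfl
  sub_mem := by
    rintro ⟨x, y⟩
    have key : ∀ u ∈ Submodule.span ℝ (T '' (A : Set M)), ∀ v ∈ Submodule.span ℝ (T '' (A : Set M)),
        WithLp.toLp 2 (u, v) ∈
          Submodule.span ℝ (_root_.sqMap T '' ((A.prod A : Submodule ℤ (M × M)) : Set (M × M))) := by
      intro u hu v hv
      have e : (WithLp.toLp 2 (u, v) : WithLp 2 (E × E)) =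
          (WithLp.linearEquiv 2 ℝ (E × E)).symm (LinearMap.inl ℝ E E u) +
            (WithLp.linearEquiv 2 ℝ (E × E)).symm (LinearMap.inr ℝ E E v) := by
        rw [← map_add]; simp
      rw [e]
      clear e
      refine Submodule.add_mem _ ?_ ?_
      · induction hu using Submodule.span_induction with
        | mem x hx =>
          obtain ⟨a, ha, rfl⟩ := hx
          exact Submodule.subset_span ⟨(a, 0), ⟨ha, A.zero_mem⟩, by simp [sqMap_apply]⟩
        | zero => rw [map_zero, map_zero]; exact Submodule.zero_mem _
        | add x y _ _ hx hy => rw [map_add, map_add]; exact Submodule.add_mem _ hx hy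
        | smul c x _ hx => rw [map_smul, map_smul]; exact Submodule.smul_mem _ _ hx
      · induction hv using Submodule.span_induction with
        | mem x hx =>
          obtain ⟨a, ha, rfl⟩ := hx
          exact Submodule.subset_span ⟨(0, a), ⟨A.zero_mem, ha⟩, by simp [sqMap_apply]⟩
        | zero => rw [map_zero, map_zero]; exact Submodule.zero_mem _
        | add x y _ _ hx hy => rw [map_add, map_add]; exact Submodule.add_mem _ hx hy
        | smul c x _ hx => rw [map_smul, map_smul]; exact Submodule.smul_mem _ _ hx
    exact key _ (h.sub_mem x) _ (h.sub_mem y)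

lemma exists_isDilation {T : M →ₗ[ℤ] E} (hT : IsLatticeMap T) (A : Submodule ℤ M) {δ : ℝ}
    (hδ : 0 < δ) : ∃ T' : M →ₗ[ℤ] E, IsLatticeMap T' ∧ IsDilation T T' A δ := by
  set W := Submodule.span ℝ (T '' (A : Set M)) with hW
  have : FiniteDimensional ℝ W := by
    rw [hW, span_image_eq_span_range_finBasis]
    exact FiniteDimensional.span_of_finite ℝ (Set.finite_range _)
  let L : E →ₗ[ℝ] E := LinearMap.id - (1 - δ) • W.starProjection.toLinearMap
  have hL : ∀ x, L x = x - (1 - δ) • W.starProjection x := fun x => rfl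
  have hinj : LinearMap.ker L = ⊥ := by
    rw [LinearMap.ker_eq_bot']
    intro x hx
    rw [hL] at hx
    have hx' : x = (1 - δ) • W.starProjection x := sub_eq_zero.mp hx
    have hxW : x ∈ W := by
      rw [hx']
      exact W.smul_mem _ (Submodule.starProjection_apply_mem _ _)
    rw [Submodule.starProjection_eq_self_iff.mpr hxW] at hx
    have : δ • x = 0 := by rw [← hx]; module
    exact (smul_eq_zero.mp this).resolve_left hδ.ne'
  refine ⟨(L.restrictScalars ℤ) ∘ₗ T, fun k w hw => (hT k w hw).map' L hinj, ?_, ?_⟩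
  · intro a ha
    have : T a ∈ W := Submodule.subset_span ⟨a, ha, rfl⟩
    change L (T a) = _
    rw [hL, Submodule.starProjection_eq_self_iff.mpr this]
    module
  · intro x
    change L (T x) - T x ∈ W
    rw [hL, sub_sub_cancel_left]
    exact W.neg_mem (W.smul_mem _ (Submodule.starProjection_apply_mem _ _))

end Dilation

section Twist

variable {E : Type*} [NormedAddCommGroup E] [InnerProductSpace ℝ E]
variable {M : Type*} [AddCommGroup M] [Module.Free ℤ M] [Module.Finite ℤ M]
variable {p : ℕ} [Fact p.Prime]

/-- The lattice of pairs `(x, y)` with `φ x = c * φ y`. -/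
def twist (φ : M →ₗ[ℤ] ZMod p) (c : ZMod p) : Submodule ℤ (M × M) :=
  LinearMap.ker (φ ∘ₗ LinearMap.fst ℤ M M - LinearMap.mulLeft ℤ c ∘ₗ φ ∘ₗ LinearMap.snd ℤ M M)

lemma mem_twist {φ : M →ₗ[ℤ] ZMod p} {c : ZMod p} {x : M × M} :
    x ∈ twist φ c ↔ φ x.1 = c * φ x.2 := by
  simp [twist, LinearMap.mem_ker, sub_eq_zero]

lemma prod_le_twist {φ : M →ₗ[ℤ] ZMod p} {A : Submodule ℤ M} (hA : A ≤ LinearMap.ker φ)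
    (c : ZMod p) : A.prod A ≤ twist φ c := by
  rintro ⟨x, y⟩ ⟨hx, hy⟩
  rw [mem_twist, LinearMap.mem_ker.mp (hA hx), LinearMap.mem_ker.mp (hA hy), mul_zero]

lemma latVal_sqMap_prod {T : M →ₗ[ℤ] E} (hT : IsLatticeMap T) (σ : ℝ) (S : Submodule ℤ M) :
    latVal (sqMap T) σ (S.prod S) = 2 * latVal T σ S := by
  rw [latVal, latVal, logVol_sqMap_prod hT, finrank_submodule_prod]
  push_cast
  ring

lemma latVal_sqMap_le_two_mul_hull {T : M →ₗ[ℤ] E} (hT : IsLatticeMap T) (hI : IsIntegralMap T)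
    {A B : Submodule ℤ M} {X : Submodule ℤ (M × M)} (hA : A.prod A ≤ X) (hB : X ≤ B.prod B)
    (σ : ℝ) : latVal (sqMap T) σ X ≤ 2 * hull T A B σ := by
  have h1 := logVol_fiberFst_add_le hT X
  have h2 : (Module.finrank ℤ X.fiberFst : ℝ) + Module.finrank ℤ (X.map (LinearMap.snd ℤ M M)) =
      Module.finrank ℤ X := by exact_mod_cast finrank_fiberFst_add X
  have h3 : latVal T σ X.fiberFst ≤ hull T A B σ := by
    apply latVal_le_hull hT hI
    · intro a ha
      exact hA (show ((a, 0) : M × M) ∈ A.prod A from ⟨ha, A.zero_mem⟩)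
    · intro a (ha : (a, 0) ∈ X)
      exact (hB ha).1
  have h4 : latVal T σ (X.map (LinearMap.snd ℤ M M)) ≤ hull T A B σ := by
    apply latVal_le_hull hT hI
    · intro a ha
      exact ⟨(0, a), hA (show ((0, a) : M × M) ∈ A.prod A from ⟨A.zero_mem, ha⟩), rfl⟩
    · rintro _ ⟨x, hx, rfl⟩
      exact (hB hx).2
  simp only [latVal, ← h2] at *
  linarith

lemma card_quotient_twist {φ : M →ₗ[ℤ] ZMod p} {S : Submodule ℤ M} (hS : ¬ S ≤ LinearMap.ker φ)
    (c : ZMod p) :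
    Nat.card (S.prod S ⧸ (twist φ c ⊓ S.prod S).submoduleOf (S.prod S)) = p := by
  have hp : p.Prime := Fact.out
  let f := (φ ∘ₗ LinearMap.fst ℤ M M - LinearMap.mulLeft ℤ c ∘ₗ φ ∘ₗ LinearMap.snd ℤ M M) ∘ₗ
    (S.prod S).subtype
  have hker : (twist φ c ⊓ S.prod S).submoduleOf (S.prod S) = LinearMap.ker f := by
    ext x
    simp [Submodule.submoduleOf, f, twist, LinearMap.mem_ker]
  have hsurj : Function.Surjective f := by
    obtain ⟨s, hs, hs'⟩ := Set.not_subset.mp hS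
    have hs0 : φ s ≠ 0 := hs'
    intro z
    refine ⟨⟨((z / φ s).val • s, 0), S.toAddSubmonoid.nsmul_mem hs _, S.zero_mem⟩, ?_⟩
    have : f ⟨((z / φ s).val • s, 0), S.toAddSubmonoid.nsmul_mem hs _, S.zero_mem⟩ = (z / φ s).val • φ s := by
      simp [f]
    rw [this, nsmul_eq_mul, ZMod.natCast_zmod_val, div_mul_cancel₀ _ hs0]
  rw [hker, Nat.card_congr (f.quotKerEquivOfSurjective hsurj).toEquiv, Nat.card_zmod]

lemma finrank_eq_of_card_quotient_pos {S' S : Submodule ℤ M} (h : S' ≤ S)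
    (hc : Nat.card (S ⧸ S'.submoduleOf S) ≠ 0) :
    Module.finrank ℤ S' = Module.finrank ℤ S := by
  have : Finite (S ⧸ S'.submoduleOf S) := (Nat.card_ne_zero.mp hc).2
  rw [← (Submodule.finiteQuotient_iff (S'.submoduleOf S)).mp this]
  exact (Submodule.submoduleOfEquivOfLe h).finrank_eq.symm

/-- The value of the pairs in `S × S` lying in the twisted lattice. -/
lemma latVal_twist_le {T : M →ₗ[ℤ] E} (hT : IsLatticeMap T) (φ : M →ₗ[ℤ] ZMod p) (c : ZMod p)
    (S : Submodule ℤ M) (σ : ℝ) :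
    latVal (sqMap T) σ (twist φ c ⊓ S.prod S) ≤
      max (2 * latVal T σ (S ⊓ LinearMap.ker φ)) (2 * latVal T σ S - Real.log p) := by
  by_cases hS : S ≤ LinearMap.ker φ
  · refine le_max_of_le_left ?_
    rw [inf_eq_right.mpr (prod_le_twist hS c), inf_eq_left.mpr hS, latVal_sqMap_prod hT]
  · refine le_max_of_le_right ?_
    have hc := card_quotient_twist hS c
    have hr := finrank_eq_of_card_quotient_pos (inf_le_right : twist φ c ⊓ S.prod S ≤ _)
      (by rw [hc]; exact (Fact.out : p.Prime).ne_zero)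
    have hv := logVol_of_le hT.sqMap (inf_le_right : twist φ c ⊓ S.prod S ≤ _) hr
    rw [hc] at hv
    rw [← latVal_sqMap_prod hT, latVal, latVal, hv, hr]
    linarith

/-- The hull of the twisted lattice inside `V × V`, relative to `A × A`. -/
noncomputable def twistHull (T : M →ₗ[ℤ] E) (φ : M →ₗ[ℤ] ZMod p) (A V : Submodule ℤ M)
    (c : ZMod p) (σ : ℝ) : ℝ :=
  hull (sqMap T) (A.prod A) (twist φ c ⊓ V.prod V) σ

/-- The hull of the kernel of `φ` inside `V`, relative to `A`. -/
noncomputable def kerHull (T : M →ₗ[ℤ] E) (φ : M →ₗ[ℤ] ZMod p) (A V : Submodule ℤ M) (σ : ℝ) : ℝ :=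
  hull T A (V ⊓ LinearMap.ker φ) σ

/-- The excess of the twisted lattice over the product of `V` and the kernel. -/
noncomputable def gain (T : M →ₗ[ℤ] E) (φ : M →ₗ[ℤ] ZMod p) (A V : Submodule ℤ M)
    (c : ZMod p) (σ : ℝ) : ℝ :=
  twistHull T φ A V c σ - hull T A V σ - kerHull T φ A V σ

/-- The excess of the twisted lattice over the trivial contributions. -/
noncomputable def margin (T : M →ₗ[ℤ] E) (φ : M →ₗ[ℤ] ZMod p) (A V : Submodule ℤ M)
    (c : ZMod p) (σ : ℝ) : ℝ :=
  twistHull T φ A V c σ - max (2 * kerHull T φ A V σ) (2 * hull T A V σ - Real.log p)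

variable {T : M →ₗ[ℤ] E} (hT : IsLatticeMap T) (hI : IsIntegralMap T) {φ : M →ₗ[ℤ] ZMod p}
  {A V : Submodule ℤ M} (hAV : A ≤ V) (hA : A ≤ LinearMap.ker φ) (c : ZMod p)
include hT hI hAV hA

lemma prod_le_twist_inf : A.prod A ≤ twist φ c ⊓ V.prod V :=
  le_inf (prod_le_twist hA c) (Submodule.prod_mono hAV hAV)

lemma twistHull_sub_mono {σ τ : ℝ} (h : σ ≤ τ) :
    twistHull T φ A V c σ + 2 * kerHull T φ A V τ ≤
      twistHull T φ A V c τ + 2 * kerHull T φ A V σ := by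
  have hAi := prod_le_twist_inf hT hI hAV hA c
  obtain ⟨W, hW1, hW2, hW⟩ := exists_latVal_eq_hull hT.sqMap hI.sqMap hAi σ
  obtain ⟨S, hS1, hS2, hS⟩ := exists_latVal_eq_hull hT hI (le_inf hAV hA) τ
  have hSV : S.prod S ≤ twist φ c ⊓ V.prod V :=
    prod_le_twist_inf hT hI (hS2.trans inf_le_left) (hS2.trans inf_le_right) c
  have h1 := latVal_add_le hT.sqMap h W (S.prod S)
  have h2 := latVal_sqMap_le_two_mul_hull hT hI (le_inf hW1 (Submodule.prod_mono hS1 hS1))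
    ((inf_le_right : W ⊓ S.prod S ≤ _).trans (Submodule.prod_mono hS2 hS2)) σ
  have h3 := latVal_le_hull hT.sqMap hI.sqMap (hW1.trans (le_sup_left : W ≤ W ⊔ S.prod S))
    (sup_le hW2 hSV) τ
  rw [latVal_sqMap_prod hT, hS, hW] at h1
  unfold twistHull kerHull
  linarith

lemma twistHull_sub_anti {σ τ : ℝ} (h : σ ≤ τ) :
    twistHull T φ A V c τ + 2 * hull T A V σ ≤ twistHull T φ A V c σ + 2 * hull T A V τ := by
  have hAi := prod_le_twist_inf hT hI hAV hA c
  obtain ⟨W, hW1, hW2, hW⟩ := exists_latVal_eq_hull hT.sqMap hI.sqMap hAi τ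
  obtain ⟨S, hS1, hS2, hS⟩ := exists_latVal_eq_hull hT hI hAV σ
  have h1 := latVal_add_le hT.sqMap h (S.prod S) W
  have h2 := latVal_sqMap_le_two_mul_hull hT hI (hW1.trans (le_sup_right : W ≤ S.prod S ⊔ W))
    (sup_le (Submodule.prod_mono hS2 hS2) (hW2.trans inf_le_right)) τ
  have h3 := latVal_le_hull hT.sqMap hI.sqMap
    (le_inf (Submodule.prod_mono hS1 hS1) hW1) ((inf_le_right : S.prod S ⊓ W ≤ W).trans hW2) σ
  rw [latVal_sqMap_prod hT, hS, hW] at h1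
  unfold twistHull
  linarith

lemma continuous_twistHull : Continuous (twistHull T φ A V c) :=
  continuous_hull hT.sqMap hI.sqMap (prod_le_twist_inf hT hI hAV hA c)

lemma continuous_kerHull : Continuous (kerHull T φ A V) :=
  continuous_hull hT hI (le_inf hAV hA)

lemma continuous_gain : Continuous (gain T φ A V c) :=
  ((continuous_twistHull hT hI hAV hA c).sub (continuous_hull hT hI hAV)).sub
    (continuous_kerHull hT hI hAV hA)

lemma continuous_margin : Continuous (margin T φ A V c) :=
  (continuous_twistHull hT hI hAV hA c).sub
    ((continuous_const.mul (continuous_kerHull hT hI hAV hA)).max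
      ((continuous_const.mul (continuous_hull hT hI hAV)).sub continuous_const))

lemma latVal_twist_le_max {S : Submodule ℤ M} (hAS : A ≤ S) (hSV : S ≤ V) (σ : ℝ) :
    latVal (sqMap T) σ (twist φ c ⊓ S.prod S) ≤
      max (2 * kerHull T φ A V σ) (2 * hull T A V σ - Real.log p) := by
  refine (latVal_twist_le hT φ c S σ).trans (max_le_max ?_ ?_)
  · have := latVal_le_hull hT hI (le_inf hAS hA) (inf_le_inf_right (LinearMap.ker φ) hSV) σ
    unfold kerHull
    linarith
  · have := latVal_le_hull hT hI hAS hSV σ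
    linarith

lemma margin_nonpos_of_le {σ : ℝ} (hσ : σ ≤ -2 * logVol T A) : margin T φ A V c σ ≤ 0 := by
  have hAi := prod_le_twist_inf hT hI hAV hA c
  obtain ⟨U, hU1, hU2, hU⟩ := exists_latVal_eq_hull hT.sqMap hI.sqMap hAi σ
  rw [margin, sub_nonpos, twistHull, ← hU]
  have hv := hI.logVol_nonneg hT A
  have hrk : 2 * Module.finrank ℤ A ≤ Module.finrank ℤ U := by
    have := Submodule.finrank_mono hU1
    rw [finrank_submodule_prod] at this
    omega
  rcases hrk.eq_or_lt with heq | hlt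
  · have hsnd : ∀ X : Submodule ℤ (M × M), A.prod A ≤ X →
        Module.finrank ℤ X = 2 * Module.finrank ℤ A →
        A ≤ X.map (LinearMap.snd ℤ M M) ∧
          Module.finrank ℤ (X.map (LinearMap.snd ℤ M M)) ≤ Module.finrank ℤ A := by
      intro X hX hr
      have h1 : A ≤ X.fiberFst := fun a ha =>
        hX (show ((a, 0) : M × M) ∈ A.prod A from ⟨ha, A.zero_mem⟩)
      have h2 : A ≤ X.map (LinearMap.snd ℤ M M) := fun a ha =>
        ⟨(0, a), hX (show ((0, a) : M × M) ∈ A.prod A from ⟨A.zero_mem, ha⟩), rfl⟩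
      have h3 := Submodule.finrank_mono h1
      have h5 := finrank_fiberFst_add X
      exact ⟨h2, by omega⟩
    obtain ⟨hQ1, hQ2⟩ := hsnd U hU1 heq.symm
    let e := LinearEquiv.prodComm ℤ M M
    have hP := hsnd (U.map e.toLinearMap)
      (fun x hx => ⟨(x.2, x.1), hU1 ⟨hx.2, hx.1⟩, rfl⟩)
      (by rw [LinearEquiv.finrank_map_eq]; exact heq.symm)
    rw [← Submodule.map_comp] at hP
    obtain ⟨hP1, hP2⟩ := hP
    set P := U.map (LinearMap.snd ℤ M M ∘ₗ e.toLinearMap) with hPdef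
    set Q := U.map (LinearMap.snd ℤ M M) with hQdef
    have hUS : U ≤ twist φ c ⊓ (P ⊔ Q).prod (P ⊔ Q) := by
      refine le_inf (hU2.trans inf_le_left) fun x hx => ⟨?_, ?_⟩
      · exact Submodule.mem_sup_left ⟨x, hx, rfl⟩
      · exact Submodule.mem_sup_right ⟨x, hx, rfl⟩
    have hPV : P ⊔ Q ≤ V := by
      refine sup_le ?_ ?_
      · rintro _ ⟨x, hx, rfl⟩
        exact (hU2 hx).2.1
      · rintro _ ⟨x, hx, rfl⟩
        exact (hU2 hx).2.2
    have hr : Module.finrank ℤ (P ⊔ Q : Submodule ℤ M) ≤ Module.finrank ℤ A := by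
      have h1 := finrank_sup_add_finrank_inf P Q
      have h2 := Submodule.finrank_mono (le_inf hP1 hQ1)
      omega
    have hr2 : Module.finrank ℤ U =
        Module.finrank ℤ (twist φ c ⊓ (P ⊔ Q).prod (P ⊔ Q) : Submodule ℤ (M × M)) := by
      apply le_antisymm (Submodule.finrank_mono hUS)
      refine (Submodule.finrank_mono inf_le_right).trans ?_
      rw [finrank_submodule_prod]
      omega
    exact (latVal_le_of_finrank_eq hT.sqMap σ hUS hr2).trans
      (latVal_twist_le_max hT hI hAV hA c (hP1.trans le_sup_left) hPV σ)
  · refine le_max_of_le_left ?_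
    have h1 := latVal_le_hull hT hI le_rfl (le_inf hAV hA) σ
    have h2 := hI.sqMap.logVol_nonneg hT.sqMap U
    have h3 : 2 * (Module.finrank ℤ A : ℝ) + 1 ≤ Module.finrank ℤ U := by exact_mod_cast hlt
    unfold kerHull
    simp only [latVal] at *
    nlinarith

lemma margin_nonpos_of_ge {σ : ℝ} (hσ : logVol (sqMap T) (twist φ c ⊓ V.prod V) ≤ σ) :
    margin T φ A V c σ ≤ 0 := by
  have hAi := prod_le_twist_inf hT hI hAV hA c
  obtain ⟨U, hU1, hU2, hU⟩ := exists_latVal_eq_hull hT.sqMap hI.sqMap hAi σ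
  rw [margin, sub_nonpos, twistHull, ← hU]
  refine le_trans ?_ (latVal_twist_le_max hT hI hAV hA c hAV le_rfl σ)
  rcases (Submodule.finrank_mono hU2).eq_or_lt with heq | hlt
  · exact latVal_le_of_finrank_eq hT.sqMap σ hU2 heq
  · have h1 := hI.sqMap.logVol_nonneg hT.sqMap U
    have h2 := hI.sqMap.logVol_nonneg hT.sqMap (twist φ c ⊓ V.prod V)
    have h3 : (Module.finrank ℤ U : ℝ) + 1 ≤
        Module.finrank ℤ (twist φ c ⊓ V.prod V : Submodule ℤ (M × M)) := by exact_mod_cast hlt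
    simp only [latVal]
    nlinarith

end Twist

section Recursion

variable {E : Type*} [NormedAddCommGroup E] [InnerProductSpace ℝ E]
variable {M : Type*} [AddCommGroup M] [Module.Free ℤ M] [Module.Finite ℤ M]
variable {p : ℕ} [Fact p.Prime]
variable {T : M →ₗ[ℤ] E} (hT : IsLatticeMap T) (hI : IsIntegralMap T) {φ : M →ₗ[ℤ] ZMod p}
  {A V : Submodule ℤ M} (hAV : A ≤ V) (hA : A ≤ LinearMap.ker φ) (c : ZMod p)
include hT hI hAV hA

lemma gain_margin_le_of_hull_attained {S : Submodule ℤ M} {σ : ℝ} (hAS : A ≤ S) (hSV : S ≤ V)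
    (hS : latVal T σ S = hull T A V σ) :
    gain T φ A V c σ ≤ gain T φ A S c σ ∧ margin T φ A V c σ ≤ margin T φ A S c σ := by
  have h1 : hull T A S σ = hull T A V σ :=
    le_antisymm (hull_mono hT hI hAS le_rfl hSV σ) (hS ▸ latVal_le_hull hT hI hAS le_rfl σ)
  have h2 : kerHull T φ A S σ ≤ kerHull T φ A V σ :=
    hull_mono hT hI (le_inf hAS hA) le_rfl (inf_le_inf_right _ hSV) σ
  have h3 : twistHull T φ A V c σ ≤ twistHull T φ A S c σ := by
    obtain ⟨W, hW1, hW2, hW⟩ := exists_latVal_eq_hull hT.sqMap hI.sqMap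
      (prod_le_twist_inf hT hI hAV hA c) σ
    have e1 := latVal_add_le hT.sqMap (le_refl σ) W (S.prod S)
    have e2 := latVal_sqMap_le_two_mul_hull hT hI (hW1.trans (le_sup_left : W ≤ W ⊔ S.prod S))
      (sup_le (hW2.trans inf_le_right) (Submodule.prod_mono hSV hSV)) σ
    have e3 := latVal_le_hull hT.sqMap hI.sqMap
      (le_inf hW1 (Submodule.prod_mono hAS hAS))
      (le_inf ((inf_le_left : W ⊓ S.prod S ≤ W).trans (hW2.trans inf_le_left)) inf_le_right) σ
    rw [latVal_sqMap_prod hT, hS, hW] at e1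
    unfold twistHull
    linarith
  unfold gain margin
  rw [h1]
  refine ⟨by linarith, ?_⟩
  have : max (2 * kerHull T φ A S σ) (2 * hull T A V σ - Real.log p) ≤
      max (2 * kerHull T φ A V σ) (2 * hull T A V σ - Real.log p) :=
    max_le_max (by linarith) le_rfl
  linarith

lemma gain_margin_le_of_kerHull_attained {S : Submodule ℤ M} {σ : ℝ} (hAS : A ≤ S)
    (hSV : S ≤ V ⊓ LinearMap.ker φ) (hS : latVal T σ S = kerHull T φ A V σ) :
    gain T φ A V c σ ≤ gain T φ S V c σ ∧ margin T φ A V c σ ≤ margin T φ S V c σ := by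
  have h1 : kerHull T φ S V σ = kerHull T φ A V σ :=
    le_antisymm (hull_mono hT hI hSV hAS le_rfl σ) (hS ▸ latVal_le_hull hT hI le_rfl hSV σ)
  have h2 : hull T S V σ ≤ hull T A V σ :=
    hull_mono hT hI (hSV.trans inf_le_left) hAS le_rfl σ
  have h3 : twistHull T φ A V c σ ≤ twistHull T φ S V c σ := by
    obtain ⟨W, hW1, hW2, hW⟩ := exists_latVal_eq_hull hT.sqMap hI.sqMap
      (prod_le_twist_inf hT hI hAV hA c) σ
    have e1 := latVal_add_le hT.sqMap (le_refl σ) W (S.prod S)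
    have e2 := latVal_sqMap_le_two_mul_hull hT hI (le_inf hW1 (Submodule.prod_mono hAS hAS))
      ((inf_le_right : W ⊓ S.prod S ≤ _).trans (Submodule.prod_mono hSV hSV)) σ
    have e3 := latVal_le_hull hT.sqMap hI.sqMap (le_sup_right : S.prod S ≤ W ⊔ S.prod S)
      (sup_le hW2 (prod_le_twist_inf hT hI (hSV.trans inf_le_left) (hSV.trans inf_le_right) c)) σ
    rw [latVal_sqMap_prod hT, hS, hW] at e1
    unfold twistHull
    unfold kerHull at e1
    linarith
  unfold gain margin
  rw [h1]
  refine ⟨by linarith, ?_⟩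
  have : max (2 * kerHull T φ A V σ) (2 * hull T S V σ - Real.log p) ≤
      max (2 * kerHull T φ A V σ) (2 * hull T A V σ - Real.log p) :=
    max_le_max le_rfl (by linarith)
  linarith

/-- The leftmost maximiser of `gain` over the region where `margin` is at least `κ`. -/
lemma exists_leftmost_gain {κ t : ℝ} (hκ : 0 < κ)
    (h : ∃ σ, κ ≤ margin T φ A V c σ ∧ -t ≤ gain T φ A V c σ) :
    ∃ σ, κ ≤ margin T φ A V c σ ∧ -t ≤ gain T φ A V c σ ∧
      (∀ τ, κ ≤ margin T φ A V c τ → gain T φ A V c τ ≤ gain T φ A V c σ) ∧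
      ∀ τ, κ ≤ margin T φ A V c τ → gain T φ A V c τ = gain T φ A V c σ → σ ≤ τ := by
  set I := {σ | κ ≤ margin T φ A V c σ} with hIdef
  have hcm := continuous_margin hT hI hAV hA c
  have hcg := continuous_gain hT hI hAV hA c
  have hclosed : IsClosed I := isClosed_le continuous_const hcm
  have hsub : I ⊆ Set.Icc (-2 * logVol T A) (logVol (sqMap T) (twist φ c ⊓ V.prod V)) := by
    intro σ hσ
    rw [Set.mem_Icc]
    have hσ' : κ ≤ margin T φ A V c σ := hσ
    constructor
    · by_contra hlt
      have := margin_nonpos_of_le hT hI hAV hA c (not_le.mp hlt).le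
      linarith
    · by_contra hlt
      have := margin_nonpos_of_ge hT hI hAV hA c (not_le.mp hlt).le
      linarith
  have hcomp : IsCompact I := isCompact_Icc.of_isClosed_subset hclosed hsub
  obtain ⟨σ₁, hσ₁, hσ₁'⟩ := h
  obtain ⟨σ₀, hσ₀, hmax⟩ := hcomp.exists_isMaxOn ⟨σ₁, hσ₁⟩ hcg.continuousOn
  have hcomp' : IsCompact (I ∩ {σ | gain T φ A V c σ = gain T φ A V c σ₀}) :=
    hcomp.inter_right (isClosed_eq hcg continuous_const)
  obtain ⟨σ, hσ, hleast⟩ := hcomp'.exists_isLeast ⟨σ₀, hσ₀, rfl⟩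
  have heq : gain T φ A V c σ = gain T φ A V c σ₀ := hσ.2
  refine ⟨σ, hσ.1, ?_, ?_, ?_⟩
  · rw [heq]
    exact hσ₁'.trans (hmax hσ₁)
  · intro τ hτ
    rw [heq]
    exact hmax hτ
  · intro τ hτ hτ'
    exact hleast ⟨hτ, hτ'.trans heq⟩

lemma exists_gain_margin_cases {κ t : ℝ} (hκ : 0 < κ) {F F' : ℕ → Submodule ℤ M}
    (hF : ∀ k, F k ∈ Set.Icc A V)
    (hFmin : ∀ S ∈ Set.Icc A V, Module.finrank ℤ (F (Module.finrank ℤ S)) = Module.finrank ℤ S ∧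
        ∀ σ, latVal T σ S ≤ latVal T σ (F (Module.finrank ℤ S)))
    (hF' : ∀ k, F' k ∈ Set.Icc A (V ⊓ LinearMap.ker φ))
    (hFmin' : ∀ S ∈ Set.Icc A (V ⊓ LinearMap.ker φ),
      Module.finrank ℤ (F' (Module.finrank ℤ S)) = Module.finrank ℤ S ∧
        ∀ σ, latVal T σ S ≤ latVal T σ (F' (Module.finrank ℤ S)))
    (h : ∃ σ, κ ≤ margin T φ A V c σ ∧ -t ≤ gain T φ A V c σ) :
    (∃ k ≤ Module.finrank ℤ M, Module.finrank ℤ (F k) < Module.finrank ℤ V ∧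
      ∃ σ, κ ≤ margin T φ A (F k) c σ ∧ -t ≤ gain T φ A (F k) c σ) ∨
    (∃ k ≤ Module.finrank ℤ M, Module.finrank ℤ A < Module.finrank ℤ (F' k) ∧
      ∃ σ, κ ≤ margin T φ (F' k) V c σ ∧ -t ≤ gain T φ (F' k) V c σ) ∨
    ∃ σ, margin T φ A V c σ = κ ∧ -t ≤ gain T φ A V c σ := by
  obtain ⟨σ, hσm, hσt, hmax, hleft⟩ := exists_leftmost_gain hT hI hAV hA c hκ h
  by_cases hi : ∃ S, A ≤ S ∧ S ≤ V ∧ latVal T σ S = hull T A V σ ∧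
      Module.finrank ℤ S < Module.finrank ℤ V
  · obtain ⟨S, h1, h2, h3, h4⟩ := hi
    obtain ⟨hr, hv⟩ := hFmin S ⟨h1, h2⟩
    have hFS := hF (Module.finrank ℤ S)
    have hatt : latVal T σ (F (Module.finrank ℤ S)) = hull T A V σ :=
      le_antisymm (latVal_le_hull hT hI hFS.1 hFS.2 σ) (h3 ▸ hv σ)
    obtain ⟨e1, e2⟩ := gain_margin_le_of_hull_attained hT hI hAV hA c hFS.1 hFS.2 hatt
    exact Or.inl ⟨_, Submodule.finrank_le S, by rwa [hr], σ, by linarith, by linarith⟩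
  by_cases hii : ∃ S, A ≤ S ∧ S ≤ V ⊓ LinearMap.ker φ ∧ latVal T σ S = kerHull T φ A V σ ∧
      Module.finrank ℤ A < Module.finrank ℤ S
  · obtain ⟨S, h1, h2, h3, h4⟩ := hii
    obtain ⟨hr, hv⟩ := hFmin' S ⟨h1, h2⟩
    have hFS := hF' (Module.finrank ℤ S)
    have hatt : latVal T σ (F' (Module.finrank ℤ S)) = kerHull T φ A V σ :=
      le_antisymm (latVal_le_hull hT hI hFS.1 hFS.2 σ) (h3 ▸ hv σ)
    obtain ⟨e1, e2⟩ := gain_margin_le_of_kerHull_attained hT hI hAV hA c hFS.1 hFS.2 hatt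
    exact Or.inr (Or.inl ⟨_, Submodule.finrank_le S, by rwa [hr], σ, by linarith, by linarith⟩)
  rcases hσm.eq_or_lt with heq | hlt
  · exact Or.inr (Or.inr ⟨σ, heq.symm, hσt⟩)
  exfalso
  push Not at hi hii
  have hrV : ∀ S, A ≤ S → S ≤ V → latVal T σ S = hull T A V σ →
      Module.finrank ℤ S = Module.finrank ℤ V := fun S h1 h2 h3 =>
    le_antisymm (Submodule.finrank_mono h2) (hi S h1 h2 h3)
  have hVatt : latVal T σ V = hull T A V σ := by
    obtain ⟨S, h1, h2, h3⟩ := exists_latVal_eq_hull hT hI hAV σ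
    refine le_antisymm (latVal_le_hull hT hI hAV le_rfl σ) ?_
    rw [← h3]
    exact latVal_le_of_finrank_eq hT σ h2 (hrV S h1 h2 h3)
  have hev1 := eventually_hull_eq_latVal hT hI hAV le_rfl hVatt hrV
  obtain ⟨S₀, hS1, hS2, hS3⟩ := exists_latVal_eq_hull hT hI (le_inf hAV hA) σ
  have hrA : ∀ S, A ≤ S → S ≤ V ⊓ LinearMap.ker φ →
      latVal T σ S = hull T A (V ⊓ LinearMap.ker φ) σ →
      Module.finrank ℤ S = Module.finrank ℤ A := fun S h1 h2 h3 =>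
    le_antisymm (hii S h1 h2 h3) (Submodule.finrank_mono h1)
  have hev2 := eventually_hull_eq_latVal hT hI hS1 hS2 hS3
    (fun S h1 h2 h3 => by rw [hrA S h1 h2 h3, hrA S₀ hS1 hS2 hS3])
  have hev3 : ∀ᶠ τ in nhds σ, κ < margin T φ A V c τ :=
    continuousAt_const.eventually_lt (continuous_margin hT hI hAV hA c).continuousAt hlt
  obtain ⟨δ, hδ, hball⟩ := Metric.eventually_nhds_iff.mp ((hev1.and hev2).and hev3)
  have hm := hball (y := σ - δ / 2) (by rw [Real.dist_eq]; rw [abs_lt]; constructor <;> linarith)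
  have hp := hball (y := σ + δ / 2) (by rw [Real.dist_eq]; rw [abs_lt]; constructor <;> linarith)
  have hconv := two_mul_hull_le hT.sqMap hI.sqMap (prod_le_twist_inf hT hI hAV hA c) σ (δ / 2)
  have g1 := hmax _ hp.2.le
  have g2 := hmax _ hm.2.le
  have key : gain T φ A V c (σ - δ / 2) = gain T φ A V c σ := by
    refine le_antisymm g2 ?_
    have e0 : kerHull T φ A V σ = latVal T σ S₀ := hS3.symm
    unfold gain kerHull at *
    rw [hm.1.1, hm.1.2]
    rw [hp.1.1, hp.1.2] at g1
    rw [← hVatt, ← hS3] at g1 ⊢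
    unfold twistHull at *
    simp only [latVal] at *
    linarith
  have := hleft _ hm.2.le key
  linarith

omit hAV hA in
open Classical in
lemma card_gain_margin_le {κ t L : ℝ} (hκ : 0 < κ)
    (hleaf : ∀ A V : Submodule ℤ M, A ≤ V → A ≤ LinearMap.ker φ →
      (#{c : ZMod p | c ≠ 0 ∧ ∃ σ, margin T φ A V c σ = κ ∧ -t ≤ gain T φ A V c σ} : ℝ) ≤ L)
    (N : ℕ) (A V : Submodule ℤ M) (hAV : A ≤ V) (hA : A ≤ LinearMap.ker φ)
    (hN : Module.finrank ℤ V ≤ Module.finrank ℤ A + N) :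
    (#{c : ZMod p | c ≠ 0 ∧ ∃ σ, κ ≤ margin T φ A V c σ ∧ -t ≤ gain T φ A V c σ} : ℝ) ≤
      (2 * Module.finrank ℤ M + 3) ^ N * L := by
  have hL : 0 ≤ L := (Nat.cast_nonneg _).trans (hleaf A V hAV hA)
  induction N generalizing A V with
  | zero =>
    obtain ⟨F, hF, hFmin⟩ := exists_minimizers hT hI hAV
    obtain ⟨F', hF', hFmin'⟩ := exists_minimizers hT hI (le_inf hAV hA)
    rw [pow_zero, one_mul]
    refine le_trans ?_ (hleaf A V hAV hA)
    refine Nat.cast_le.mpr (Finset.card_le_card fun c hc => ?_)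
    rw [Finset.mem_filter] at hc ⊢
    refine ⟨hc.1, hc.2.1, ?_⟩
    rcases exists_gain_margin_cases hT hI hAV hA c hκ hF hFmin hF' hFmin' hc.2.2 with
      ⟨k, -, hk, -⟩ | ⟨k, -, hk, -⟩ | h
    · have := Submodule.finrank_mono (hF k).1
      omega
    · have := Submodule.finrank_mono ((hF' k).2.trans inf_le_left)
      omega
    · exact h
  | succ N ih =>
    obtain ⟨F, hF, hFmin⟩ := exists_minimizers hT hI hAV
    obtain ⟨F', hF', hFmin'⟩ := exists_minimizers hT hI (le_inf hAV hA)
    set n := Module.finrank ℤ M with hn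
    set bad : Submodule ℤ M → Submodule ℤ M → Finset (ZMod p) := fun A V =>
      {c : ZMod p | c ≠ 0 ∧ ∃ σ, κ ≤ margin T φ A V c σ ∧ -t ≤ gain T φ A V c σ} with hbad
    set leaf : Finset (ZMod p) :=
      {c : ZMod p | c ≠ 0 ∧ ∃ σ, margin T φ A V c σ = κ ∧ -t ≤ gain T φ A V c σ} with hleafdef
    have hbad_mem : ∀ A V c, c ∈ bad A V ↔
        c ≠ 0 ∧ ∃ σ, κ ≤ margin T φ A V c σ ∧ -t ≤ gain T φ A V c σ := by
      intro A V c; simp [hbad]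
    set X := (range (n + 1)).filter fun k => Module.finrank ℤ (F k) < Module.finrank ℤ V
    set Y := (range (n + 1)).filter fun k => Module.finrank ℤ A < Module.finrank ℤ (F' k)
    have hsub : bad A V ⊆ (X.biUnion fun k => bad A (F k)) ∪
        ((Y.biUnion fun k => bad (F' k) V) ∪ leaf) := by
      intro c hc
      rw [hbad_mem] at hc
      simp only [Finset.mem_union, Finset.mem_biUnion]
      rcases exists_gain_margin_cases hT hI hAV hA c hκ hF hFmin hF' hFmin' hc.2 with
        ⟨k, hkn, hk, h⟩ | ⟨k, hkn, hk, h⟩ | h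
      · exact Or.inl ⟨k, by simp [X, hk]; omega, (hbad_mem _ _ _).mpr ⟨hc.1, h⟩⟩
      · exact Or.inr (Or.inl ⟨k, by simp [Y, hk]; omega, (hbad_mem _ _ _).mpr ⟨hc.1, h⟩⟩)
      · exact Or.inr (Or.inr (by simp [hleafdef, hc.1, h]))
    set B : ℝ := (2 * n + 3) ^ N * L with hB
    have hLB : L ≤ B := le_mul_of_one_le_left hL (one_le_pow₀ (by linarith [n.cast_nonneg (α := ℝ)]))
    have hX : (#(X.biUnion fun k => bad A (F k)) : ℝ) ≤ (n + 1) * B := by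
      have h1 : (#(X.biUnion fun k => bad A (F k)) : ℝ) ≤ ∑ k ∈ X, (#(bad A (F k)) : ℝ) := by
        exact_mod_cast Finset.card_biUnion_le
      refine h1.trans ((Finset.sum_le_card_nsmul X _ B fun k hk => ?_).trans ?_)
      · rw [Finset.mem_filter] at hk
        exact ih A (F k) (hF k).1 hA (by omega)
      · rw [nsmul_eq_mul]
        refine mul_le_mul_of_nonneg_right ?_ (hL.trans hLB)
        have : #X ≤ n + 1 := (Finset.card_filter_le _ _).trans (by simp)
        exact_mod_cast this
    have hY : (#(Y.biUnion fun k => bad (F' k) V) : ℝ) ≤ (n + 1) * B := by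
      have h1 : (#(Y.biUnion fun k => bad (F' k) V) : ℝ) ≤ ∑ k ∈ Y, (#(bad (F' k) V) : ℝ) := by
        exact_mod_cast Finset.card_biUnion_le
      refine h1.trans ((Finset.sum_le_card_nsmul Y _ B fun k hk => ?_).trans ?_)
      · rw [Finset.mem_filter] at hk
        exact ih (F' k) V ((hF' k).2.trans inf_le_left) ((hF' k).2.trans inf_le_right) (by omega)
      · rw [nsmul_eq_mul]
        refine mul_le_mul_of_nonneg_right ?_ (hL.trans hLB)
        have : #Y ≤ n + 1 := (Finset.card_filter_le _ _).trans (by simp)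
        exact_mod_cast this
    have hcard : (#(bad A V) : ℝ) ≤ (#(X.biUnion fun k => bad A (F k)) : ℝ) +
        ((#(Y.biUnion fun k => bad (F' k) V) : ℝ) + #leaf) := by
      have h1 := Finset.card_le_card hsub
      have h2 := Finset.card_union_le (X.biUnion fun k => bad A (F k))
        ((Y.biUnion fun k => bad (F' k) V) ∪ leaf)
      have h3 := Finset.card_union_le (Y.biUnion fun k => bad (F' k) V) leaf
      exact_mod_cast (h1.trans h2).trans (Nat.add_le_add_left h3 _)
    have hl := hleaf A V hAV hA
    have : (2 * (n : ℝ) + 3) ^ (N + 1) * L = (2 * n + 3) * B := by rw [hB]; ring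
    rw [this]
    linarith

end Recursion

section Counting

variable {E : Type*} [NormedAddCommGroup E] [InnerProductSpace ℝ E]
variable {M : Type*} [AddCommGroup M] [Module.Free ℤ M] [Module.Finite ℤ M]

/-- The loss in the lower bound for the number of lattice points. -/
def pointLoss (n : ℕ) : ℝ := (2 * (n + 1)) ^ n

lemma one_le_pointLoss (n : ℕ) : 1 ≤ pointLoss n :=
  one_le_pow₀ (by linarith [n.cast_nonneg (α := ℝ)])

/-- Relative to `A`, hulls count lattice points up to a common normalisation `D`. -/
lemma exists_counting_map {T : M →ₗ[ℤ] E} (hT : IsLatticeMap T) (hI : IsIntegralMap T)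
    (A : Submodule ℤ M) (σ₀ : ℝ) : ∃ (T' : M →ₗ[ℤ] E) (D : ℝ),
    (∀ B, A ≤ B → ∀ σ ≥ σ₀, ∀ X : Finset M, (∀ x ∈ X, x ∈ B ∧ ‖T' x‖ ≤ Real.exp σ) →
      (#X : ℝ) ≤ 3 ^ Module.finrank ℤ M * Real.exp (hull T A B σ + D)) ∧
    (∀ B, A ≤ B → ∃ X : Finset M, (∀ x ∈ X, x ∈ B ∧ ‖T' x‖ ≤ Real.exp σ₀) ∧
      Real.exp (hull T A B σ₀ + D) ≤ pointLoss (Module.finrank ℤ M) * #X) ∧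
    ∀ B, A.prod A ≤ B → ∃ X : Finset (M × M),
      (∀ x ∈ X, x ∈ B ∧ ‖T' x.1‖ ≤ Real.exp σ₀ ∧ ‖T' x.2‖ ≤ Real.exp σ₀) ∧
      Real.exp (hull (sqMap T) (A.prod A) B σ₀ + 2 * D) ≤
        pointLoss (2 * Module.finrank ℤ M) * #X := by
  set d := logVol T A - σ₀ with hd
  obtain ⟨T', hT', hdil⟩ := exists_isDilation hT A (Real.exp_pos (-d))
  refine ⟨T', Module.finrank ℤ A * d, ?_, ?_, ?_⟩
  · intro B hAB σ hσ X hX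
    obtain ⟨S, hS, hcard⟩ := exists_card_le_exp_latVal hT' (fun x hx => (hX x hx).1)
      (fun x hx => (hX x hx).2)
    refine hcard.trans ?_
    gcongr
    refine (hdil.latVal_le hT hI hT' (by linarith) S).trans ?_
    have := latVal_le_hull hT hI (le_sup_right : A ≤ S ⊔ A) (sup_le hS hAB) σ
    linarith
  · intro B hAB
    obtain ⟨S, h1, h2, h3⟩ := exists_latVal_eq_hull hT hI hAB σ₀
    obtain ⟨X, hX, hcard⟩ := exists_exp_latVal_le_card hT' S σ₀
    refine ⟨X, fun x hx => ⟨h2 (hX x hx).1, (hX x hx).2⟩, ?_⟩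
    rw [← h3, ← hdil.latVal_eq hT h1]
    exact hcard
  · intro B hAB
    obtain ⟨S, h1, h2, h3⟩ := exists_latVal_eq_hull hT.sqMap hI.sqMap hAB σ₀
    obtain ⟨X, hX, hcard⟩ := exists_exp_latVal_le_card hT'.sqMap S σ₀
    refine ⟨X, fun x hx => ⟨h2 (hX x hx).1, ?_⟩, ?_⟩
    · have e1 := (hX x hx).2
      have e2 := norm_sq_sqMap T' x
      constructor <;> refine le_trans ?_ e1 <;>
        refine le_of_sq_le_sq ?_ (norm_nonneg _) <;> rw [e2] <;> nlinarith [sq_nonneg ‖T' x.1‖, sq_nonneg ‖T' x.2‖]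
    · have e1 := hdil.sqMap.latVal_eq hT.sqMap h1 σ₀
      rw [finrank_submodule_prod] at e1
      have e2 : hull (sqMap T) (A.prod A) B σ₀ + 2 * (Module.finrank ℤ A * d) =
          latVal (sqMap T') σ₀ S := by
        rw [e1, h3]; push_cast; ring
      rw [e2]
      have hr : Module.finrank ℤ (M × M) = 2 * Module.finrank ℤ M := by
        rw [Module.finrank_prod]; ring
      rw [hr] at hcard
      exact hcard

lemma Set.finite_of_forall_card_le {α : Type*} {s : Set α} {C : ℝ}
    (h : ∀ X : Finset α, ↑X ⊆ s → (#X : ℝ) ≤ C) : s.Finite := by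
  by_contra hs
  obtain ⟨X, hX, hcard⟩ := Set.Infinite.exists_subset_card_eq hs (⌊C⌋₊ + 1)
  have h1 := h X hX
  have h2 := Nat.lt_floor_add_one C
  rw [hcard] at h1
  push_cast at h1
  linarith

end Counting

section Variance

variable {p : ℕ} [Fact p.Prime]

lemma sum_card_mul_sub_eq {α : Type*} [DecidableEq α] (Y : Finset α) (f : α → ZMod p) :
    ∑ c : ZMod p, #{x ∈ (Y ×ˢ Y) ×ˢ (Y ×ˢ Y) | f x.1.1 - f x.1.2 = c * (f x.2.1 - f x.2.2)} ≤
      #Y ^ 4 + p * #{x ∈ Y ×ˢ Y | f x.1 = f x.2} ^ 2 := by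
  set D := {x ∈ Y ×ˢ Y | f x.1 = f x.2} with hD
  set Q := (Y ×ˢ Y) ×ˢ (Y ×ˢ Y) with hQ
  have h1 : ∀ x ∈ Q, #{c : ZMod p | f x.1.1 - f x.1.2 = c * (f x.2.1 - f x.2.2)} ≤
      1 + if x ∈ D ×ˢ D then p else 0 := by
    intro x hx
    by_cases h2 : f x.2.1 - f x.2.2 = 0
    · by_cases h3 : f x.1.1 - f x.1.2 = 0
      · have hmem : x ∈ D ×ˢ D := by
          simp only [hQ, Finset.mem_product] at hx
          simp [hD, hx.1.1, hx.1.2, hx.2.1, hx.2.2, sub_eq_zero.mp h2, sub_eq_zero.mp h3]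
        rw [if_pos hmem]
        refine (Finset.card_le_univ _).trans ?_
        rw [ZMod.card]
        omega
      · rw [Finset.card_eq_zero.mpr]
        · omega
        · rw [Finset.filter_eq_empty_iff]
          intro c _ hc
          rw [h2, mul_zero] at hc
          exact h3 hc
    · refine le_trans (Finset.card_le_one.mpr ?_) (Nat.le_add_right _ _)
      intro a ha b hb
      simp only [Finset.mem_filter, Finset.mem_univ, true_and] at ha hb
      exact mul_right_cancel₀ h2 (ha.symm.trans hb)
  calc _ = ∑ x ∈ Q, #{c : ZMod p | f x.1.1 - f x.1.2 = c * (f x.2.1 - f x.2.2)} := by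
        simp only [Finset.card_filter]
        exact Finset.sum_comm
    _ ≤ ∑ x ∈ Q, (1 + if x ∈ D ×ˢ D then p else 0) := Finset.sum_le_sum h1
    _ = #Q + #{x ∈ Q | x ∈ D ×ˢ D} * p := by
        rw [Finset.sum_add_distrib, Finset.sum_const, smul_eq_mul, mul_one, ← Finset.sum_filter,
          Finset.sum_const, smul_eq_mul]
    _ ≤ _ := by
        have e1 : #Q = #Y ^ 4 := by rw [hQ]; simp only [Finset.card_product]; ring
        have e2 : #{x ∈ Q | x ∈ D ×ˢ D} ≤ #D ^ 2 := by
          rw [sq, ← Finset.card_product]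
          exact Finset.card_le_card fun x hx => (Finset.mem_filter.mp hx).2
        rw [e1, mul_comm p]
        gcongr

lemma card_pow_four_le {α : Type*} [DecidableEq α] (Y : Finset α) (f : α → ZMod p) (c : ZMod p) :
    #Y ^ 4 ≤
      p * #{x ∈ (Y ×ˢ Y) ×ˢ (Y ×ˢ Y) | f x.1.1 - f x.1.2 = c * (f x.2.1 - f x.2.2)} := by
  have h1 : #(Y ×ˢ Y) = ∑ z : ZMod p, #{x ∈ Y ×ˢ Y | f x.1 - c * f x.2 = z} :=
    Finset.card_eq_sum_card_fiberwise fun _ _ => Finset.mem_coe.mpr (Finset.mem_univ _)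
  have h2 : ∑ z : ZMod p, #{x ∈ Y ×ˢ Y | f x.1 - c * f x.2 = z} ^ 2 =
      #{x ∈ (Y ×ˢ Y) ×ˢ (Y ×ˢ Y) | f x.1.1 - f x.1.2 = c * (f x.2.1 - f x.2.2)} := by
    simp_rw [sq, ← Finset.card_product]
    rw [← Finset.card_sigma]
    refine Finset.card_bij' (fun x _ => ((x.2.1.1, x.2.2.1), (x.2.1.2, x.2.2.2)))
      (fun x _ => ⟨f x.1.1 - c * f x.2.1, ((x.1.1, x.2.1), (x.1.2, x.2.2))⟩) ?_ ?_ ?_ ?_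
    · rintro ⟨z, ⟨⟨a, b⟩, ⟨a', b'⟩⟩⟩ hx
      simp only [Finset.mem_sigma, Finset.mem_univ, Finset.mem_product, Finset.mem_filter,
        true_and] at hx ⊢
      refine ⟨by tauto, ?_⟩
      have := hx.1.2.trans hx.2.2.symm
      linear_combination this
    · rintro ⟨⟨a, b⟩, ⟨a', b'⟩⟩ hx
      simp only [Finset.mem_sigma, Finset.mem_univ, Finset.mem_product, Finset.mem_filter,
        true_and] at hx ⊢
      refine ⟨by tauto, by tauto, ?_⟩
      linear_combination -hx.2
    · rintro ⟨z, ⟨⟨a, b⟩, ⟨a', b'⟩⟩⟩ hx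
      simp only [Finset.mem_sigma, Finset.mem_univ, Finset.mem_product, Finset.mem_filter,
        true_and] at hx
      simp [hx.1.2]
    · rintro ⟨⟨a, b⟩, ⟨a', b'⟩⟩ hx
      rfl
  have h3 := sq_sum_le_card_mul_sum_sq (s := (Finset.univ : Finset (ZMod p)))
    (f := fun z => #{x ∈ Y ×ˢ Y | f x.1 - c * f x.2 = z})
  rw [← h1, h2, Finset.card_univ, ZMod.card, Finset.card_product] at h3
  calc #Y ^ 4 = (#Y * #Y) ^ 2 := by ring
    _ ≤ _ := h3

lemma card_mul_le_of_forall_le_card {α : Type*} [DecidableEq α] (Y : Finset α) (f : α → ZMod p)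
    (Ω : Finset (ZMod p)) {q : ℝ}
    (hq : ∀ c ∈ Ω,
      q ≤ #{x ∈ (Y ×ˢ Y) ×ˢ (Y ×ˢ Y) | f x.1.1 - f x.1.2 = c * (f x.2.1 - f x.2.2)})
    (hqp : 2 * (#Y : ℝ) ^ 4 ≤ p * q) :
    (#Ω : ℝ) * q ≤ 2 * p * (#{x ∈ Y ×ˢ Y | f x.1 = f x.2} : ℝ) ^ 2 := by
  have hp : (0 : ℝ) < p := by exact_mod_cast (Fact.out : p.Prime).pos
  set N : ZMod p → ℕ := fun c =>
    #{x ∈ (Y ×ˢ Y) ×ˢ (Y ×ˢ Y) | f x.1.1 - f x.1.2 = c * (f x.2.1 - f x.2.2)}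
  have h1 : ∑ c : ZMod p, ((p : ℝ) * N c - (#Y : ℝ) ^ 4) ≤
      p * (p * (#{x ∈ Y ×ˢ Y | f x.1 = f x.2} : ℝ) ^ 2) := by
    have e1 : ((∑ c, N c : ℕ) : ℝ) ≤ (#Y : ℝ) ^ 4 + p * (#{x ∈ Y ×ˢ Y | f x.1 = f x.2} : ℝ) ^ 2 := by
      exact_mod_cast sum_card_mul_sub_eq Y f
    rw [Finset.sum_sub_distrib, ← Finset.mul_sum, Finset.sum_const, Finset.card_univ, ZMod.card,
      nsmul_eq_mul]
    push_cast at e1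
    nlinarith
  have h2 : ∑ c ∈ Ω, ((p : ℝ) * N c - (#Y : ℝ) ^ 4) ≤
      ∑ c : ZMod p, ((p : ℝ) * N c - (#Y : ℝ) ^ 4) := by
    refine Finset.sum_le_sum_of_subset_of_nonneg (Finset.subset_univ _) fun c _ _ => ?_
    have : (#Y : ℝ) ^ 4 ≤ p * N c := by exact_mod_cast card_pow_four_le Y f c
    linarith
  have h3 : #Ω • ((p : ℝ) * q / 2) ≤ ∑ c ∈ Ω, ((p : ℝ) * N c - (#Y : ℝ) ^ 4) := by
    refine Finset.card_nsmul_le_sum _ _ _ fun c hc => ?_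
    have := mul_le_mul_of_nonneg_left (hq c hc) hp.le
    linarith
  rw [nsmul_eq_mul] at h3
  have h4 := (h3.trans h2).trans h1
  refine le_of_mul_le_mul_left ?_ hp
  linarith

end Variance

section Leaf

variable {E : Type*} [NormedAddCommGroup E] [InnerProductSpace ℝ E]
variable {M : Type*} [AddCommGroup M] [Module.Free ℤ M] [Module.Finite ℤ M]
variable {p : ℕ} [Fact p.Prime]

/-- The margin above which twisted lattices are controlled by moments. -/
def momentLoss (n : ℕ) : ℝ := 2 * 72 ^ (2 * n) * pointLoss n ^ 2 * pointLoss (2 * n)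

variable {T : M →ₗ[ℤ] E} (hT : IsLatticeMap T) (hI : IsIntegralMap T) {φ : M →ₗ[ℤ] ZMod p}
  {A V : Submodule ℤ M} (hAV : A ≤ V) (hA : A ≤ LinearMap.ker φ)
include hT hI hAV hA

lemma card_le_of_kerHull_le_twistHull {κ σ : ℝ}
    (hκ : momentLoss (Module.finrank ℤ M) ≤ Real.exp κ) (Ω : Finset (ZMod p))
    (hΩ : ∀ c ∈ Ω, 2 * kerHull T φ A V σ + κ ≤ twistHull T φ A V c σ) :
    (#Ω : ℝ) ≤ Real.exp (2 * (hull T A V σ - kerHull T φ A V σ)) := by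
  classical
  obtain ⟨T', D, hup, -, hlow⟩ := exists_counting_map hT hI A σ
  set n := Module.finrank ℤ M
  have hfin : ∀ B, A ≤ B → {x | x ∈ B ∧ ‖T' x‖ ≤ Real.exp σ}.Finite := fun B hB =>
    Set.finite_of_forall_card_le fun X hX => hup B hB σ le_rfl X fun x hx => hX hx
  set Y := (hfin V hAV).toFinset with hYdef
  set Z := (hfin (V ⊓ LinearMap.ker φ) (le_inf hAV hA)).toFinset with hZdef
  have hY : (#Y : ℝ) ≤ 3 ^ n * Real.exp (hull T A V σ + D) :=
    hup V hAV σ le_rfl Y fun x hx => by simpa [hYdef] using hx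
  have hZ : (#Z : ℝ) ≤ 3 ^ n * Real.exp (kerHull T φ A V σ + D) :=
    hup _ (le_inf hAV hA) σ le_rfl Z fun x hx => by simpa [hZdef] using hx
  choose X hX hXc using fun c => hlow _ (prod_le_twist_inf hT hI hAV hA c)
  set g := Real.exp (hull T A V σ + D) with hg
  set z := Real.exp (kerHull T φ A V σ + D) with hz
  have hz0 : 0 < z := Real.exp_pos _
  set K := pointLoss (2 * n) with hKdef
  have hK : 1 ≤ K := one_le_pointLoss _
  have hK9 : 2 * 9 ^ n * K ≤ Real.exp κ := by
    refine le_trans ?_ hκ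
    have h1 : (9 : ℝ) ^ n ≤ 72 ^ (2 * n) := by
      rw [pow_mul]; gcongr; norm_num
    have h2 : 1 ≤ pointLoss n ^ 2 := one_le_pow₀ (one_le_pointLoss n)
    unfold momentLoss
    calc 2 * 9 ^ n * K ≤ 2 * 72 ^ (2 * n) * 1 * K := by rw [mul_one]; gcongr
      _ ≤ _ := by gcongr
  have hdiff : ∀ c ∈ Ω, (9 : ℝ) ^ n * z ^ 2 ≤ #{x ∈ X c | φ x.2 ≠ 0} := by
    intro c hc
    have h1 : #{x ∈ X c | ¬ φ x.2 ≠ 0} ≤ #(Z ×ˢ Z) := by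
      refine Finset.card_le_card fun x hx => ?_
      rw [Finset.mem_filter, not_not] at hx
      obtain ⟨hxB, hx1, hx2⟩ := hX c x hx.1
      have hm := mem_twist.mp hxB.1
      rw [hx.2, mul_zero] at hm
      simp only [Finset.mem_product, hZdef, Set.Finite.mem_toFinset, Set.mem_ofPred_eq,
        Submodule.mem_inf, LinearMap.mem_ker]
      exact ⟨⟨⟨hxB.2.1, hm⟩, hx1⟩, ⟨⟨hxB.2.2, hx.2⟩, hx2⟩⟩
    have h2 := Finset.card_filter_add_card_filter_not (s := X c) (fun x => φ x.2 ≠ 0)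
    have h1' : (#{x ∈ X c | ¬ φ x.2 ≠ 0} : ℝ) ≤ 9 ^ n * z ^ 2 := by
      rw [Finset.card_product] at h1
      calc (#{x ∈ X c | ¬ φ x.2 ≠ 0} : ℝ) ≤ #Z * #Z := by exact_mod_cast h1
        _ ≤ (3 ^ n * z) * (3 ^ n * z) := by gcongr
        _ = 9 ^ n * z ^ 2 := by
          rw [show (9 : ℝ) = 3 * 3 by norm_num, mul_pow]; ring
    have h2' : (#{x ∈ X c | φ x.2 ≠ 0} : ℝ) + #{x ∈ X c | ¬ φ x.2 ≠ 0} = #(X c) := by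
      exact_mod_cast h2
    have h3 : 2 * 9 ^ n * K * z ^ 2 ≤ K * #(X c) := by
      calc 2 * 9 ^ n * K * z ^ 2 ≤ Real.exp κ * z ^ 2 := by gcongr
        _ = Real.exp (2 * kerHull T φ A V σ + κ + 2 * D) := by
          rw [hz, ← Real.exp_nat_mul, ← Real.exp_add]; push_cast; ring_nf
        _ ≤ Real.exp (twistHull T φ A V c σ + 2 * D) := by gcongr; exact hΩ c hc
        _ ≤ _ := hXc c
    have h4 : 2 * 9 ^ n * z ^ 2 ≤ (#(X c) : ℝ) := by
      refine le_of_mul_le_mul_left ?_ (lt_of_lt_of_le one_pos hK)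
      linarith
    linarith
  have hdisj : ∑ c ∈ Ω, #{x ∈ X c | φ x.2 ≠ 0} ≤ #(Y ×ˢ Y) := by
    rw [← Finset.card_biUnion]
    · refine Finset.card_le_card fun x hx => ?_
      simp only [Finset.mem_biUnion, Finset.mem_filter] at hx
      obtain ⟨c, -, hx, -⟩ := hx
      obtain ⟨hxB, hx1, hx2⟩ := hX c x hx
      simp only [Finset.mem_product, hYdef, Set.Finite.mem_toFinset, Set.mem_ofPred_eq]
      exact ⟨⟨hxB.2.1, hx1⟩, ⟨hxB.2.2, hx2⟩⟩
    · intro c _ c' _ hne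
      refine Finset.disjoint_left.mpr fun x hx hx' => ?_
      rw [Finset.mem_filter] at hx hx'
      have e1 := mem_twist.mp (hX c x hx.1).1.1
      have e2 := mem_twist.mp (hX c' x hx'.1).1.1
      exact hne (mul_right_cancel₀ hx.2 (e1.symm.trans e2))
  have h5 : (#Ω : ℝ) * (9 ^ n * z ^ 2) ≤ 9 ^ n * g ^ 2 := by
    calc (#Ω : ℝ) * (9 ^ n * z ^ 2) = #Ω • ((9 : ℝ) ^ n * z ^ 2) := by rw [nsmul_eq_mul]
      _ ≤ ∑ c ∈ Ω, (#{x ∈ X c | φ x.2 ≠ 0} : ℝ) := Finset.card_nsmul_le_sum _ _ _ hdiff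
      _ ≤ #Y * #Y := by rw [Finset.card_product] at hdisj; exact_mod_cast hdisj
      _ ≤ (3 ^ n * g) * (3 ^ n * g) := by gcongr
      _ = 9 ^ n * g ^ 2 := by
        rw [show (9 : ℝ) = 3 * 3 by norm_num, mul_pow]; ring
  have h6 : Real.exp (2 * (hull T A V σ - kerHull T φ A V σ)) * z ^ 2 = g ^ 2 := by
    rw [hz, hg, ← Real.exp_nat_mul, ← Real.exp_nat_mul, ← Real.exp_add]
    push_cast
    ring_nf
  have h9 : (0 : ℝ) < 9 ^ n * z ^ 2 := by positivity
  refine le_of_mul_le_mul_right ?_ h9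
  calc _ ≤ _ := h5
    _ = _ := by rw [← h6]; ring

lemma card_le_of_hull_le_twistHull {κ σ : ℝ}
    (hκ : momentLoss (Module.finrank ℤ M) ≤ Real.exp κ) (Ω : Finset (ZMod p))
    (hΩ : ∀ c ∈ Ω, 2 * hull T A V σ - Real.log p + κ ≤ twistHull T φ A V c σ) :
    (#Ω : ℝ) ≤ Real.exp (2 * (Real.log p - (hull T A V σ - kerHull T φ A V σ))) := by
  classical
  have hp : (0 : ℝ) < p := by exact_mod_cast (Fact.out : p.Prime).pos
  obtain ⟨T', D, hup, hlow1, hlow⟩ := exists_counting_map hT hI A σ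
  set n := Module.finrank ℤ M
  have hl2 : 0 ≤ Real.log 2 := Real.log_nonneg (by norm_num)
  have hl4 : 0 ≤ Real.log 4 := Real.log_nonneg (by norm_num)
  have hfin : ∀ B, A ≤ B → ∀ τ ≥ σ, {x | x ∈ B ∧ ‖T' x‖ ≤ Real.exp τ}.Finite := fun B hB τ hτ =>
    Set.finite_of_forall_card_le fun X hX => hup B hB τ hτ X fun x hx => hX hx
  set Y := (hfin V hAV (σ + Real.log 2) (by linarith)).toFinset with hYdef
  set Z := (hfin (V ⊓ LinearMap.ker φ) (le_inf hAV hA) (σ + Real.log 4) (by linarith)).toFinset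
    with hZdef
  have hYmem : ∀ x, x ∈ Y ↔ x ∈ V ∧ ‖T' x‖ ≤ 2 * Real.exp σ := by
    intro x
    simp [hYdef, Real.exp_add, Real.exp_log, mul_comm]
  have hZmem : ∀ x, x ∈ Z ↔ (x ∈ V ∧ φ x = 0) ∧ ‖T' x‖ ≤ 4 * Real.exp σ := by
    intro x
    simp [hZdef, Real.exp_add, Real.exp_log, mul_comm]
  set g := Real.exp (hull T A V σ + D) with hg
  set z := Real.exp (kerHull T φ A V σ + D) with hz
  have hz0 : 0 < z := Real.exp_pos _
  have hg0 : 0 < g := Real.exp_pos _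
  have hgrow : ∀ B, A ≤ B → ∀ a : ℝ, 1 ≤ a →
      Real.exp (hull T A B (σ + Real.log a) + D) ≤ a ^ n * Real.exp (hull T A B σ + D) := by
    intro B hB a ha
    have h1 := hull_add_le hT hI hB σ (Real.log_nonneg ha)
    have h2 : a ^ n = Real.exp (Real.log a * n) := by
      rw [mul_comm, Real.exp_nat_mul, Real.exp_log (by linarith)]
    rw [h2, ← Real.exp_add]
    exact Real.exp_le_exp.mpr (by linarith)
  have hY : (#Y : ℝ) ≤ 6 ^ n * g := by
    have h1 := hup V hAV (σ + Real.log 2) (by linarith) Y fun x hx => by simpa [hYdef] using hx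
    have h2 := hgrow V hAV 2 (by norm_num)
    calc (#Y : ℝ) ≤ 3 ^ n * (2 ^ n * g) := h1.trans (by gcongr)
      _ = 6 ^ n * g := by rw [← mul_assoc, ← mul_pow]; norm_num
  have hZ : (#Z : ℝ) ≤ 12 ^ n * z := by
    have h1 := hup _ (le_inf hAV hA) (σ + Real.log 4) (by linarith) Z
      fun x hx => by simpa [hZdef] using hx
    have h2 := hgrow _ (le_inf hAV hA) 4 (by norm_num)
    calc (#Z : ℝ) ≤ 3 ^ n * (4 ^ n * z) := h1.trans (by gcongr; exact h2)
      _ = 12 ^ n * z := by rw [← mul_assoc, ← mul_pow]; norm_num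
  obtain ⟨X₁, hX₁, hX₁c⟩ := hlow1 V hAV
  choose X hX hXc using fun c => hlow _ (prod_le_twist_inf hT hI hAV hA c)
  set K₁ := pointLoss n with hK₁def
  set K := pointLoss (2 * n) with hKdef
  have hK : 1 ≤ K := one_le_pointLoss _
  have hK₁ : 1 ≤ K₁ := one_le_pointLoss _
  have hKK : 2 * 72 ^ (2 * n) * K₁ ^ 2 * K ≤ Real.exp κ := hκ
  set q := g ^ 4 * Real.exp κ / (p * K₁ ^ 2 * K) with hq
  have hpairs : #{x ∈ Y ×ˢ Y | φ x.1 = φ x.2} ≤ #Y * #Z := by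
    rw [← Finset.card_product]
    refine Finset.card_le_card_of_injOn (fun x => (x.2, x.1 - x.2)) ?_ ?_
    · intro x hx
      simp only [Finset.coe_filter, Finset.mem_product, Set.mem_ofPred_eq, hYmem] at hx
      simp only [Finset.coe_product, Set.mem_prod, Finset.mem_coe, hYmem, hZmem]
      refine ⟨hx.1.2, ⟨V.sub_mem hx.1.1.1 hx.1.2.1, by rw [map_sub, hx.2, sub_self]⟩, ?_⟩
      rw [map_sub]
      have := norm_sub_le (T' x.1) (T' x.2)
      linarith [hx.1.1.2, hx.1.2.2]
    · rintro ⟨a, b⟩ _ ⟨a', b'⟩ _ h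
      simp only [Prod.mk.injEq] at h
      obtain ⟨rfl, h⟩ := h
      rw [sub_left_inj] at h
      rw [h]
  have hcount : ∀ c ∈ Ω, q ≤
      #{x ∈ (Y ×ˢ Y) ×ˢ (Y ×ˢ Y) | φ x.1.1 - φ x.1.2 = c * (φ x.2.1 - φ x.2.2)} := by
    intro c hc
    have h1 : #((X₁ ×ˢ X₁) ×ˢ X c) ≤
        #{x ∈ (Y ×ˢ Y) ×ˢ (Y ×ˢ Y) | φ x.1.1 - φ x.1.2 = c * (φ x.2.1 - φ x.2.2)} := by
      refine Finset.card_le_card_of_injOn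
        (fun x => ((x.1.1 + x.2.1, x.1.1), (x.1.2 + x.2.2, x.1.2))) ?_ ?_
      · intro x hx
        simp only [Finset.coe_product, Set.mem_prod, Finset.mem_coe] at hx
        obtain ⟨⟨h1, h2⟩, h3⟩ := hx
        obtain ⟨h1V, h1n⟩ := hX₁ _ h1
        obtain ⟨h2V, h2n⟩ := hX₁ _ h2
        obtain ⟨hB, hn1, hn2⟩ := hX c _ h3
        have e1 := norm_add_le (T' x.1.1) (T' x.2.1)
        have e2 := norm_add_le (T' x.1.2) (T' x.2.2)
        have hpos := Real.exp_pos σ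
        simp only [Finset.coe_filter, Finset.mem_product, Set.mem_ofPred_eq, hYmem, map_add,
          add_sub_cancel_left]
        exact ⟨⟨⟨⟨V.add_mem h1V hB.2.1, by linarith⟩, h1V, by linarith⟩,
          ⟨V.add_mem h2V hB.2.2, by linarith⟩, h2V, by linarith⟩, mem_twist.mp hB.1⟩
      · rintro ⟨⟨a, b⟩, ⟨x, y⟩⟩ _ ⟨⟨a', b'⟩, ⟨x', y'⟩⟩ _ h
        simp only [Prod.mk.injEq] at h
        obtain ⟨⟨h1, rfl⟩, h2, rfl⟩ := h
        simp only [add_right_inj] at h1 h2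
        rw [h1, h2]
    have h2 : (#X₁ : ℝ) ^ 2 * #(X c) ≤
        #{x ∈ (Y ×ˢ Y) ×ˢ (Y ×ˢ Y) | φ x.1.1 - φ x.1.2 = c * (φ x.2.1 - φ x.2.2)} := by
      rw [Finset.card_product, Finset.card_product, ← sq] at h1
      exact_mod_cast h1
    refine le_trans ?_ h2
    have h3 : g ^ 2 * Real.exp κ / p ≤ K * #(X c) := by
      calc g ^ 2 * Real.exp κ / p
          = Real.exp (2 * hull T A V σ - Real.log p + κ + 2 * D) := by
            rw [show 2 * hull T A V σ - Real.log p + κ + 2 * D =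
              (2 : ℕ) * (hull T A V σ + D) + κ - Real.log p by push_cast; ring, Real.exp_sub,
              Real.exp_log hp, Real.exp_add, Real.exp_nat_mul]
        _ ≤ Real.exp (twistHull T φ A V c σ + 2 * D) := by gcongr; exact hΩ c hc
        _ ≤ _ := hXc c
    have h4 : g ^ 2 * (g ^ 2 * Real.exp κ / p) ≤ (K₁ * #X₁) ^ 2 * (K * #(X c)) := by gcongr
    rw [hq, div_le_iff₀ (by positivity)]
    have h5 : g ^ 2 * (g ^ 2 * Real.exp κ / p) * p = g ^ 4 * Real.exp κ := by
      field_simp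
    calc g ^ 4 * Real.exp κ = g ^ 2 * (g ^ 2 * Real.exp κ / p) * p := h5.symm
      _ ≤ (K₁ * #X₁) ^ 2 * (K * #(X c)) * p := by gcongr
      _ = _ := by ring
  have hq2 : 2 * (#Y : ℝ) ^ 4 ≤ p * q := by
    have e1 : p * q = g ^ 4 * Real.exp κ / (K₁ ^ 2 * K) := by
      rw [hq]; field_simp
    rw [e1, le_div_iff₀ (by positivity)]
    have e2 : ((6 : ℝ) ^ n) ^ 4 ≤ 72 ^ (2 * n) := by
      rw [← pow_mul, mul_comm n 4, pow_mul, pow_mul]; gcongr; norm_num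
    calc 2 * (#Y : ℝ) ^ 4 * (K₁ ^ 2 * K) ≤ 2 * (6 ^ n * g) ^ 4 * (K₁ ^ 2 * K) := by gcongr
      _ = 2 * (6 ^ n) ^ 4 * K₁ ^ 2 * K * g ^ 4 := by ring
      _ ≤ 2 * 72 ^ (2 * n) * K₁ ^ 2 * K * g ^ 4 := by gcongr
      _ ≤ Real.exp κ * g ^ 4 := by gcongr
      _ = _ := by ring
  have hmain := card_mul_le_of_forall_le_card Y φ Ω hcount hq2
  have hE : (#{x ∈ Y ×ˢ Y | φ x.1 = φ x.2} : ℝ) ≤ 72 ^ n * (g * z) := by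
    calc (#{x ∈ Y ×ˢ Y | φ x.1 = φ x.2} : ℝ) ≤ #Y * #Z := by exact_mod_cast hpairs
      _ ≤ (6 ^ n * g) * (12 ^ n * z) := by gcongr
      _ = (6 * 12) ^ n * (g * z) := by rw [mul_pow]; ring
      _ = _ := by norm_num
  have h6 : Real.exp (2 * (Real.log p - (hull T A V σ - kerHull T φ A V σ))) =
      p ^ 2 * z ^ 2 / g ^ 2 := by
    rw [eq_div_iff (by positivity), hz, hg, ← Real.exp_nat_mul, ← Real.exp_nat_mul,
      ← Real.exp_add]
    nth_rewrite 2 [← Real.exp_log hp]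
    rw [← Real.exp_nat_mul, ← Real.exp_add]
    push_cast
    ring_nf
  rw [h6, le_div_iff₀ (by positivity)]
  have h7 : (#Ω : ℝ) * q ≤ 2 * p * (72 ^ n * (g * z)) ^ 2 := hmain.trans (by gcongr)
  rw [hq, mul_div_assoc', div_le_iff₀ (by positivity)] at h7
  have h8 : (#Ω : ℝ) * (g ^ 4 * Real.exp κ) ≤ g ^ 2 * p ^ 2 * z ^ 2 * Real.exp κ := by
    calc _ ≤ _ := h7
      _ = g ^ 2 * p ^ 2 * z ^ 2 * (2 * 72 ^ (2 * n) * K₁ ^ 2 * K) := by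
        rw [mul_comm 2 n, pow_mul]; ring
      _ ≤ _ := by gcongr
  have h9 : 0 < g ^ 2 * Real.exp κ := by positivity
  refine le_of_mul_le_mul_right ?_ h9
  linarith

omit hAV hA in
open Classical in
lemma card_margin_eq_le {κ t : ℝ} (hκ : momentLoss (Module.finrank ℤ M) ≤ Real.exp κ)
    (A V : Submodule ℤ M) (hAV : A ≤ V) (hA : A ≤ LinearMap.ker φ) :
    (#{c : ZMod p | c ≠ 0 ∧ ∃ σ, margin T φ A V c σ = κ ∧ -t ≤ gain T φ A V c σ} : ℝ) ≤
      2 * Real.exp (2 * (κ + t)) := by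
  set Ω₁ : Finset (ZMod p) := {c | ∃ σ, 2 * kerHull T φ A V σ + κ ≤ twistHull T φ A V c σ ∧
    hull T A V σ - kerHull T φ A V σ ≤ κ + t} with hΩ₁
  set Ω₂ : Finset (ZMod p) := {c | ∃ σ, 2 * hull T A V σ - Real.log p + κ ≤
    twistHull T φ A V c σ ∧ Real.log p - (hull T A V σ - kerHull T φ A V σ) ≤ κ + t} with hΩ₂
  have hsub : ({c : ZMod p | c ≠ 0 ∧ ∃ σ, margin T φ A V c σ = κ ∧ -t ≤ gain T φ A V c σ} :
      Finset (ZMod p)) ⊆ Ω₁ ∪ Ω₂ := by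
    intro c hc
    rw [Finset.mem_filter] at hc
    obtain ⟨-, -, σ, h1, h2⟩ := hc
    rw [margin] at h1
    rw [gain] at h2
    rw [Finset.mem_union]
    rcases le_total (2 * kerHull T φ A V σ) (2 * hull T A V σ - Real.log p) with h | h
    · rw [max_eq_right h] at h1
      exact Or.inr (Finset.mem_filter.mpr ⟨Finset.mem_univ _, σ, by linarith, by linarith⟩)
    · rw [max_eq_left h] at h1
      exact Or.inl (Finset.mem_filter.mpr ⟨Finset.mem_univ _, σ, by linarith, by linarith⟩)
  have h1 : (#Ω₁ : ℝ) ≤ Real.exp (2 * (κ + t)) := by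
    rcases Ω₁.eq_empty_or_nonempty with h0 | hne
    · rw [h0]; simp [Real.exp_nonneg]
    have hmem : ∀ c : Ω₁, ∃ σ, 2 * kerHull T φ A V σ + κ ≤ twistHull T φ A V c σ ∧
        hull T A V σ - kerHull T φ A V σ ≤ κ + t := fun c => (Finset.mem_filter.mp c.2).2
    choose s hs1 hs2 using hmem
    have : Nonempty Ω₁ := hne.to_subtype
    obtain ⟨c₀, hc₀⟩ := Finite.exists_max s
    refine (card_le_of_kerHull_le_twistHull hT hI hAV hA hκ (σ := s c₀) Ω₁ fun c hc => ?_).trans ?_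
    · have e1 := twistHull_sub_mono hT hI hAV hA c (hc₀ ⟨c, hc⟩)
      have e2 := hs1 ⟨c, hc⟩
      simp only at e2
      linarith
    · gcongr
      exact hs2 c₀
  have h2 : (#Ω₂ : ℝ) ≤ Real.exp (2 * (κ + t)) := by
    rcases Ω₂.eq_empty_or_nonempty with h0 | hne
    · rw [h0]; simp [Real.exp_nonneg]
    have hmem : ∀ c : Ω₂, ∃ σ, 2 * hull T A V σ - Real.log p + κ ≤
        twistHull T φ A V c σ ∧ Real.log p - (hull T A V σ - kerHull T φ A V σ) ≤ κ + t :=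
      fun c => (Finset.mem_filter.mp c.2).2
    choose s hs1 hs2 using hmem
    have : Nonempty Ω₂ := hne.to_subtype
    obtain ⟨c₀, hc₀⟩ := Finite.exists_min s
    refine (card_le_of_hull_le_twistHull hT hI hAV hA hκ (σ := s c₀) Ω₂ fun c hc => ?_).trans ?_
    · have e1 := twistHull_sub_anti hT hI hAV hA c (hc₀ ⟨c, hc⟩)
      have e2 := hs1 ⟨c, hc⟩
      simp only at e2
      linarith
    · gcongr
      exact hs2 c₀
  have h3 : (#({c : ZMod p | c ≠ 0 ∧ ∃ σ, margin T φ A V c σ = κ ∧ -t ≤ gain T φ A V c σ} :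
      Finset (ZMod p)) : ℝ) ≤ #Ω₁ + #Ω₂ := by
    exact_mod_cast (Finset.card_le_card hsub).trans (Finset.card_union_le _ _)
  linarith

omit hAV hA in
open Classical in
/-- Few multipliers `c` have a twisted lattice exceeding the trivial contributions. -/
theorem card_margin_gain_le {κ t : ℝ} (hκ : momentLoss (Module.finrank ℤ M) ≤ Real.exp κ)
    (hκ0 : 0 < κ) :
    (#{c : ZMod p | c ≠ 0 ∧ ∃ σ, κ ≤ margin T φ ⊥ ⊤ c σ ∧ -t ≤ gain T φ ⊥ ⊤ c σ} : ℝ) ≤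
      (2 * Module.finrank ℤ M + 3) ^ Module.finrank ℤ M * (2 * Real.exp (2 * (κ + t))) :=
  card_gain_margin_le hT hI hκ0 (card_margin_eq_le hT hI hκ) _ ⊥ ⊤ bot_le bot_le (by simp)

end Leaf

section BoxEnergy

variable {r : ℕ}

/-- The map `x ↦ (w_j x_j)` into Euclidean space. -/
noncomputable def diagMap (w : Fin r → ℕ) : (Fin r → ℤ) →ₗ[ℤ] EuclideanSpace ℝ (Fin r) where
  toFun x := WithLp.toLp 2 fun j => (w j : ℝ) * x j
  map_add' x y := by ext j; simp [mul_add]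
  map_smul' c x := by ext j; simp [mul_left_comm]

lemma diagMap_apply (w : Fin r → ℕ) (x : Fin r → ℤ) (j : Fin r) :
    diagMap w x j = (w j : ℝ) * x j := rfl

lemma inner_diagMap (w : Fin r → ℕ) (x y : Fin r → ℤ) :
    inner ℝ (diagMap w x) (diagMap w y) = ∑ j, ((w j : ℝ) * x j) * (w j * y j) := by
  simp [PiLp.inner_apply, diagMap_apply, mul_comm]

lemma norm_sq_diagMap (w : Fin r → ℕ) (x : Fin r → ℤ) :
    ‖diagMap w x‖ ^ 2 = ∑ j, ((w j : ℝ) * x j) ^ 2 := by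
  rw [← real_inner_self_eq_norm_sq, inner_diagMap]
  simp [sq]

lemma isIntegralMap_diagMap (w : Fin r → ℕ) : IsIntegralMap (diagMap w) := fun x y =>
  ⟨∑ j, (w j * x j) * (w j * y j), by rw [inner_diagMap]; push_cast; rfl⟩

lemma isLatticeMap_diagMap {w : Fin r → ℕ} (hw : ∀ j, 0 < w j) : IsLatticeMap (diagMap w) := by
  refine IsLatticeMap.of_basis (Pi.basisFun ℤ (Fin r)) ?_
  refine linearIndependent_of_ne_zero_of_inner_eq_zero (𝕜 := ℝ) (fun i h => ?_) (fun i j hij => ?_)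
  · have h1 := congrArg (fun v : EuclideanSpace ℝ (Fin r) => v i) h
    simp [diagMap_apply, (hw i).ne'] at h1
  · simp only [Function.comp_apply, inner_diagMap]
    refine Finset.sum_eq_zero fun l _ => ?_
    by_cases hl : l = i
    · subst hl; simp [hij]
    · simp [hl]

variable {p : ℕ} [Fact p.Prime]

/-- The linear form with coefficients `d`. -/
def linForm (d : Fin r → ZMod p) : (Fin r → ℤ) →ₗ[ℤ] ZMod p where
  toFun x := ∑ j, (x j : ZMod p) * d j
  map_add' x y := by simp [add_mul, Finset.sum_add_distrib]
  map_smul' c x := by simp [Finset.mul_sum, mul_assoc]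

lemma linForm_apply (d : Fin r → ZMod p) (x : Fin r → ℤ) :
    linForm d x = ∑ j, (x j : ZMod p) * d j := rfl

/-- The threshold for the multiplicities of ratios. -/
def ratioThreshold (r : ℕ) : ℝ := 36 ^ r * momentLoss r * pointLoss r ^ 2

/-- The constant in the distributional bound for multiplicities of ratios. -/
def ratioConst (r : ℕ) : ℝ :=
  2 * (2 * r + 3) ^ r * momentLoss r ^ 2 * pointLoss r ^ 4 * 324 ^ r

lemma two_le_momentLoss (n : ℕ) : 2 ≤ momentLoss n := by
  have h1 : (1 : ℝ) ≤ 72 ^ (2 * n) := one_le_pow₀ (by norm_num)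
  have h2 : 1 ≤ pointLoss n ^ 2 := one_le_pow₀ (one_le_pointLoss n)
  have h3 := one_le_pointLoss (2 * n)
  unfold momentLoss
  calc (2 : ℝ) = 2 * 1 * 1 * 1 := by norm_num
    _ ≤ _ := by gcongr

open Classical in
/-- Few multipliers `c` admit at least `τ` small solutions of `φ x = c φ y`. -/
theorem card_mul_sq_le_of_proper {N : Fin r → ℕ} {d : Fin r → ZMod p} (hN : ∀ j, 0 < N j)
    (hproper : ∀ x : Fin r → ℤ, (∀ j, |x j| < N j) → linForm d x = 0 → x = 0)
    (hp : (∏ j, N j) ^ 2 ≤ p) {τ : ℝ} (hτ : ratioThreshold r ≤ τ) :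
    (#{c : ZMod p | c ≠ 0 ∧ ∃ X : Finset ((Fin r → ℤ) × (Fin r → ℤ)), τ ≤ #X ∧ ∀ x ∈ X,
      (∀ j, 4 * r * |x.1 j| ≤ N j ∧ 4 * r * |x.2 j| ≤ N j) ∧
        linForm d x.1 = c * linForm d x.2} : ℝ) * τ ^ 2 ≤
      ratioConst r * (∏ j, N j : ℕ) ^ 2 := by
  set w : Fin r → ℕ := fun j => ∏ i ∈ univ.erase j, N i with hw
  set W := ∏ j, N j with hW
  have hwN : ∀ j, w j * N j = W := fun j => by
    rw [hw, hW, mul_comm]; exact Finset.mul_prod_erase _ _ (Finset.mem_univ j)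
  have hw0 : ∀ j, 0 < w j := fun j => Finset.prod_pos fun i _ => hN i
  have hW0 : 0 < W := Finset.prod_pos fun i _ => hN i
  have hT := isLatticeMap_diagMap hw0
  have hI := isIntegralMap_diagMap w
  set φ := linForm d with hφ
  set T := diagMap w with hTdef
  have hrank : Module.finrank ℤ (Fin r → ℤ) = r := by simp
  have hrank2 : Module.finrank ℤ ((Fin r → ℤ) × (Fin r → ℤ)) = 2 * r := by simp; ring
  set σ := Real.log (W / 2) with hσ
  have hWr : (0 : ℝ) < W := by exact_mod_cast hW0
  have hexp : Real.exp σ = W / 2 := Real.exp_log (by positivity)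
  have hcoord : ∀ x : Fin r → ℤ, ‖T x‖ ≤ Real.exp σ → ∀ j, 2 * |x j| ≤ N j := by
    intro x hx j
    have h1 : ((w j : ℝ) * x j) ^ 2 ≤ ‖T x‖ ^ 2 := by
      rw [norm_sq_diagMap]
      exact Finset.single_le_sum (f := fun j => ((w j : ℝ) * x j) ^ 2)
        (fun i _ => sq_nonneg _) (Finset.mem_univ j)
    have h2 : (w j : ℝ) * |(x j : ℝ)| ≤ W / 2 := by
      have := abs_le_of_sq_le_sq h1 (norm_nonneg _)
      rw [abs_mul, abs_of_nonneg (Nat.cast_nonneg _)] at this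
      rw [← hexp]
      exact this.trans hx
    rw [← hwN j] at h2
    push_cast at h2
    have h3 : (0 : ℝ) < w j := by exact_mod_cast hw0 j
    have h4 : 2 * |(x j : ℝ)| ≤ N j := by
      refine le_of_mul_le_mul_left ?_ h3
      linarith
    exact_mod_cast h4
  set K := pointLoss r with hK
  have hK1 : 1 ≤ K := one_le_pointLoss r
  have hΓ : Real.exp (hull T ⊥ ⊤ σ) ≤ K * (2 ^ r * W) := by
    obtain ⟨S, -, -, hS⟩ := exists_latVal_eq_hull hT hI (bot_le : (⊥ : Submodule ℤ _) ≤ ⊤) σ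
    obtain ⟨X, hX, hc⟩ := exists_exp_latVal_le_card hT S σ
    rw [hS, hrank] at hc
    refine hc.trans (mul_le_mul_of_nonneg_left ?_ (by positivity))
    have h1 : X ⊆ Fintype.piFinset fun j => Finset.Icc (-((N j / 2 : ℕ) : ℤ)) (N j / 2 : ℕ) := by
      intro x hx
      rw [Fintype.mem_piFinset]
      intro j
      have := hcoord x (hX x hx).2 j
      rw [Finset.mem_Icc, ← abs_le]
      omega
    have h2 : #X ≤ ∏ j, (2 * N j) := by
      refine (Finset.card_le_card h1).trans ?_
      rw [Fintype.card_piFinset]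
      refine Finset.prod_le_prod' fun j _ => ?_
      rw [Int.card_Icc]
      have := hN j
      omega
    rw [Finset.prod_mul_distrib, Finset.prod_const, Finset.card_univ, Fintype.card_fin] at h2
    exact_mod_cast h2
  have h0 : Real.exp (kerHull T φ ⊥ ⊤ σ) ≤ K := by
    obtain ⟨S, -, hSle, hS⟩ := exists_latVal_eq_hull hT hI
      (bot_le : (⊥ : Submodule ℤ _) ≤ ⊤ ⊓ LinearMap.ker φ) σ
    obtain ⟨X, hX, hc⟩ := exists_exp_latVal_le_card hT S σ
    rw [hS, hrank] at hc
    refine hc.trans (le_trans (mul_le_mul_of_nonneg_left ?_ (by positivity)) (mul_one K).le)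
    have h1 : X ⊆ {0} := by
      intro x hx
      rw [Finset.mem_singleton]
      refine hproper x (fun j => ?_) (hSle (hX x hx).1).2
      have := hcoord x (hX x hx).2 j
      have := hN j
      omega
    exact_mod_cast Finset.card_le_card h1
  set κ := Real.log (momentLoss r) with hκ
  have hmL : 2 ≤ momentLoss r := two_le_momentLoss r
  have hexpκ : Real.exp κ = momentLoss r := Real.exp_log (by linarith)
  have hκ0 : 0 < κ := Real.log_pos (by linarith)
  have hthr : 0 < ratioThreshold r := by
    unfold ratioThreshold
    positivity
  have hτ0 : 0 < τ := hthr.trans_le hτ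
  set t := Real.log (K ^ 2 * 18 ^ r * W / τ) with ht
  have hexpt : Real.exp t = K ^ 2 * 18 ^ r * W / τ := Real.exp_log (by positivity)
  have hmain := card_margin_gain_le (φ := φ) hT hI (κ := κ) (t := t)
    (by rw [hrank, hexpκ]) hκ0
  rw [hrank] at hmain
  have hsub : ({c : ZMod p | c ≠ 0 ∧ ∃ X : Finset ((Fin r → ℤ) × (Fin r → ℤ)), τ ≤ #X ∧ ∀ x ∈ X,
      (∀ j, 4 * r * |x.1 j| ≤ N j ∧ 4 * r * |x.2 j| ≤ N j) ∧
        φ x.1 = c * φ x.2} : Finset (ZMod p)) ⊆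
      ({c : ZMod p | c ≠ 0 ∧ ∃ σ, κ ≤ margin T φ ⊥ ⊤ c σ ∧ -t ≤ gain T φ ⊥ ⊤ c σ} :
        Finset (ZMod p)) := by
    intro c hc
    rw [Finset.mem_filter] at hc ⊢
    obtain ⟨-, hc0, X, hXτ, hX⟩ := hc
    refine ⟨Finset.mem_univ _, hc0, σ, ?_⟩
    have hnorm : ∀ y : Fin r → ℤ, (∀ j, 4 * r * |y j| ≤ N j) → ‖T y‖ ^ 2 ≤ W ^ 2 / 8 := by
      intro y hy
      rw [norm_sq_diagMap]
      rcases Nat.eq_zero_or_pos r with hr | hr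
      · subst hr
        simp only [Finset.univ_eq_empty, Finset.sum_empty]
        positivity
      have hr' : (1 : ℝ) ≤ r := by exact_mod_cast hr
      have h1 : ∀ j ∈ (univ : Finset (Fin r)), ((w j : ℝ) * y j) ^ 2 ≤ W ^ 2 / (16 * r ^ 2) := by
        intro j _
        have h2 : 4 * r * |(y j : ℝ)| ≤ N j := by exact_mod_cast hy j
        have h3 : (w j : ℝ) * (4 * r * |(y j : ℝ)|) ≤ W := by
          rw [← hwN j]; push_cast; gcongr
        rw [le_div_iff₀ (by positivity)]
        calc ((w j : ℝ) * y j) ^ 2 * (16 * (r : ℝ) ^ 2) = ((w j : ℝ) * (4 * r * |(y j : ℝ)|)) ^ 2 := by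
              rw [mul_pow, mul_pow, mul_pow, mul_pow, sq_abs]; ring
          _ ≤ (W : ℝ) ^ 2 := by gcongr
      refine (Finset.sum_le_card_nsmul _ _ _ h1).trans ?_
      rw [Finset.card_univ, Fintype.card_fin, nsmul_eq_mul, mul_div_assoc',
        div_le_div_iff₀ (by positivity) (by norm_num)]
      have : (r : ℝ) ≤ r ^ 2 := by nlinarith
      have := mul_le_mul_of_nonneg_right this (sq_nonneg (W : ℝ))
      nlinarith [sq_nonneg (W : ℝ), sq_nonneg ((W : ℝ) * r)]
    obtain ⟨S, hS, hcard⟩ := exists_card_le_exp_latVal hT.sqMap (V := twist φ c)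
      (σ := σ) (X := X) (fun x hx => mem_twist.mpr (hX x hx).2) (fun x hx => by
        have e1 := hnorm x.1 fun j => ((hX x hx).1 j).1
        have e2 := hnorm x.2 fun j => ((hX x hx).1 j).2
        have e3 := norm_sq_sqMap T x
        rw [hexp]
        refine abs_le_of_sq_le_sq' ?_ (by positivity) |>.2
        rw [e3]
        linarith)
    have htw : latVal (sqMap T) σ S ≤ twistHull T φ ⊥ ⊤ c σ :=
      latVal_le_hull hT.sqMap hI.sqMap (by simp) (le_inf hS (by simp)) σ
    have hlow : τ / 9 ^ r ≤ Real.exp (twistHull T φ ⊥ ⊤ c σ) := by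
      rw [div_le_iff₀ (by positivity)]
      rw [hrank2, pow_mul] at hcard
      calc τ ≤ #X := hXτ
        _ ≤ _ := hcard
        _ ≤ (3 ^ 2) ^ r * Real.exp (twistHull T φ ⊥ ⊤ c σ) := by gcongr
        _ = _ := by norm_num [mul_comm]
    have hthrτ : 36 ^ r * momentLoss r * K ^ 2 ≤ τ := hτ
    have hpow : (36 : ℝ) ^ r = 4 ^ r * 9 ^ r := by rw [← mul_pow]; norm_num
    have hlow' : 4 ^ r * momentLoss r * K ^ 2 ≤ Real.exp (twistHull T φ ⊥ ⊤ c σ) := by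
      refine le_trans ?_ hlow
      rw [le_div_iff₀ (by positivity)]
      rw [hpow] at hthrτ
      linarith
    have h4 : (1 : ℝ) ≤ 4 ^ r := one_le_pow₀ (by norm_num)
    have hpp : (0 : ℝ) < p := by exact_mod_cast (Fact.out : p.Prime).pos
    constructor
    · rw [margin, le_sub_iff_add_le, ← le_sub_iff_add_le', max_le_iff]
      constructor
      · rw [le_sub_iff_add_le', ← Real.exp_le_exp, Real.exp_add, hexpκ]
        refine le_trans ?_ hlow'
        have : Real.exp (2 * kerHull T φ ⊥ ⊤ σ) ≤ K ^ 2 := by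
          rw [show 2 * kerHull T φ ⊥ ⊤ σ = (2 : ℕ) * kerHull T φ ⊥ ⊤ σ by norm_num,
            Real.exp_nat_mul]
          gcongr
        calc momentLoss r * Real.exp (2 * kerHull T φ ⊥ ⊤ σ) ≤ momentLoss r * K ^ 2 := by gcongr
          _ ≤ 4 ^ r * (momentLoss r * K ^ 2) := le_mul_of_one_le_left (by positivity) h4
          _ = _ := by ring
      · rw [le_sub_iff_add_le', ← Real.exp_le_exp, Real.exp_add, hexpκ, Real.exp_sub,
          Real.exp_log hpp]
        refine le_trans ?_ hlow'
        have h5 : Real.exp (2 * hull T ⊥ ⊤ σ) ≤ (K * (2 ^ r * W)) ^ 2 := by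
          rw [show 2 * hull T ⊥ ⊤ σ = (2 : ℕ) * hull T ⊥ ⊤ σ by norm_num, Real.exp_nat_mul]
          gcongr
        have h6 : (W : ℝ) ^ 2 ≤ p := by exact_mod_cast hp
        calc momentLoss r * (Real.exp (2 * hull T ⊥ ⊤ σ) / p)
            ≤ momentLoss r * ((K * (2 ^ r * W)) ^ 2 / p) := by gcongr
          _ = 4 ^ r * momentLoss r * K ^ 2 * (W ^ 2 / p) := by
            rw [show (4 : ℝ) ^ r = (2 ^ r) ^ 2 by rw [← pow_mul, mul_comm, pow_mul]; norm_num]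
            ring
          _ ≤ 4 ^ r * momentLoss r * K ^ 2 * 1 := by
            gcongr
            exact (div_le_one hpp).mpr h6
          _ = _ := mul_one _
    · rw [gain, neg_le_iff_add_nonneg', ← Real.one_le_exp_iff, Real.exp_add, hexpt, Real.exp_sub,
        Real.exp_sub, mul_div_assoc', le_div_iff₀ (Real.exp_pos _), one_mul, mul_div_assoc',
        le_div_iff₀ (Real.exp_pos _)]
      calc Real.exp (kerHull T φ ⊥ ⊤ σ) * Real.exp (hull T ⊥ ⊤ σ) ≤ K * (K * (2 ^ r * W)) := by
            gcongr
        _ = K ^ 2 * 18 ^ r * W / τ * (τ / 9 ^ r) := by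
            rw [show (18 : ℝ) = 2 * 9 by norm_num, mul_pow]
            field_simp
        _ ≤ _ := by gcongr
  have hcard : (#({c : ZMod p | c ≠ 0 ∧ ∃ X : Finset ((Fin r → ℤ) × (Fin r → ℤ)), τ ≤ #X ∧
      ∀ x ∈ X, (∀ j, 4 * r * |x.1 j| ≤ N j ∧ 4 * r * |x.2 j| ≤ N j) ∧
        φ x.1 = c * φ x.2} : Finset (ZMod p)) : ℝ) ≤
      (2 * r + 3) ^ r * (2 * Real.exp (2 * (κ + t))) :=
    (Nat.cast_le.mpr (Finset.card_le_card hsub)).trans hmain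
  have hexp2 : Real.exp (2 * (κ + t)) = (momentLoss r * (K ^ 2 * 18 ^ r * W / τ)) ^ 2 := by
    rw [show 2 * (κ + t) = (2 : ℕ) * (κ + t) by norm_num, Real.exp_nat_mul, Real.exp_add, hexpκ,
      hexpt]
  rw [hexp2] at hcard
  calc _ ≤ (2 * r + 3) ^ r * (2 * (momentLoss r * (K ^ 2 * 18 ^ r * W / τ)) ^ 2) * τ ^ 2 :=
        mul_le_mul_of_nonneg_right hcard (sq_nonneg τ)
    _ = _ := by
      rw [ratioConst, ← hK, show (324 : ℝ) ^ r = (18 ^ r) ^ 2 by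
        rw [← pow_mul, mul_comm r 2, pow_mul]; norm_num]
      field_simp

end BoxEnergy

section RatioCount

/-- A distributional bound `#{m ≥ s} s² ≤ A` for `s ≥ τ` controls the sum of `m`. -/
lemma sum_le_of_card_mul_sq_le {α : Type*} (U : Finset α) (m : α → ℕ) {M τ : ℕ} (hτ : 0 < τ)
    (hM : ∀ u ∈ U, m u ≤ M) {A : ℝ}
    (hA : ∀ s : ℕ, τ ≤ s → (#{u ∈ U | s ≤ m u} : ℝ) * s ^ 2 ≤ A) :
    ((∑ u ∈ U, m u : ℕ) : ℝ) ≤ τ * #U + A / τ * (1 + Real.log M) := by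
  have hτ' : (0 : ℝ) < τ := by exact_mod_cast hτ
  have hA0 : 0 ≤ A := le_trans (by positivity) (hA τ le_rfl)
  have h1 : ∀ u ∈ U, m u ≤ τ + ∑ s ∈ Finset.Icc 1 M, if max s τ ≤ m u then 1 else 0 := by
    intro u hu
    by_cases h : τ ≤ m u
    · have : ∑ s ∈ Finset.Icc 1 M, (if max s τ ≤ m u then 1 else 0) = m u := by
        rw [← Finset.card_filter]
        have : Finset.filter (fun s => max s τ ≤ m u) (Finset.Icc 1 M) = Finset.Icc 1 (m u) := by
          ext s
          have := hM u hu
          simp only [Finset.mem_filter, Finset.mem_Icc, max_le_iff]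
          omega
        rw [this]
        simp
      omega
    · omega
  have h2 : ∑ u ∈ U, m u ≤ τ * #U + ∑ s ∈ Finset.Icc 1 M, #{u ∈ U | max s τ ≤ m u} := by
    refine (Finset.sum_le_sum h1).trans ?_
    rw [Finset.sum_add_distrib, Finset.sum_comm, Finset.sum_const, smul_eq_mul, mul_comm]
    simp only [Finset.card_filter, le_refl]
  have h3 : ∀ s ∈ Finset.Icc 1 M, (#{u ∈ U | max s τ ≤ m u} : ℝ) ≤ A / τ * (s : ℝ)⁻¹ := by
    intro s hs
    have hs1 : (1 : ℝ) ≤ s := by exact_mod_cast (Finset.mem_Icc.mp hs).1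
    have h4 := hA (max s τ) (le_max_right _ _)
    have h5 : (τ : ℝ) * s ≤ ((max s τ : ℕ) : ℝ) ^ 2 := by
      rw [sq]
      have e1 : (s : ℝ) ≤ (max s τ : ℕ) := by exact_mod_cast le_max_left _ _
      have e2 : (τ : ℝ) ≤ (max s τ : ℕ) := by exact_mod_cast le_max_right _ _
      gcongr
    rw [← div_eq_mul_inv, div_div, le_div_iff₀ (by positivity)]
    exact le_trans (mul_le_mul_of_nonneg_left h5 (Nat.cast_nonneg _)) h4
  have h4 : ∑ s ∈ Finset.Icc 1 M, (s : ℝ)⁻¹ ≤ 1 + Real.log M := by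
    have := harmonic_le_one_add_log M
    rw [harmonic_eq_sum_Icc] at this
    push_cast at this
    exact this
  calc ((∑ u ∈ U, m u : ℕ) : ℝ)
      ≤ ((τ * #U + ∑ s ∈ Finset.Icc 1 M, #{u ∈ U | max s τ ≤ m u} : ℕ) : ℝ) := by exact_mod_cast h2
    _ = τ * #U + ∑ s ∈ Finset.Icc 1 M, (#{u ∈ U | max s τ ≤ m u} : ℝ) := by push_cast; rfl
    _ ≤ τ * #U + ∑ s ∈ Finset.Icc 1 M, A / τ * (s : ℝ)⁻¹ := by
        gcongr with s hs; exact h3 s hs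
    _ ≤ τ * #U + A / τ * (1 + Real.log M) := by
        rw [← Finset.mul_sum]
        gcongr

variable {r p : ℕ} [Fact p.Prime]

/-- The integer points of the box with sides `N j / q`. -/
noncomputable def cornerBox (N : Fin r → ℕ) (q : ℕ) : Finset (Fin r → ℤ) :=
  Fintype.piFinset fun j => Finset.Icc (0 : ℤ) ((N j / q : ℕ) : ℤ)

lemma mem_cornerBox {N : Fin r → ℕ} {q : ℕ} {x : Fin r → ℤ} :
    x ∈ cornerBox N q ↔ ∀ j, 0 ≤ x j ∧ x j ≤ ((N j / q : ℕ) : ℤ) := by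
  simp [cornerBox]

lemma card_cornerBox (N : Fin r → ℕ) (q : ℕ) : #(cornerBox N q) = ∏ j, (N j / q + 1) := by
  rw [cornerBox, Fintype.card_piFinset]
  refine Finset.prod_congr rfl fun j _ => ?_
  rw [Int.card_Icc, sub_zero]
  exact Int.toNat_natCast (N j / q + 1)

lemma prod_le_pow_mul_card_cornerBox (N : Fin r → ℕ) {q : ℕ} (hq : 0 < q) :
    ∏ j, N j ≤ q ^ r * #(cornerBox N q) := by
  have : q ^ r = ∏ _j : Fin r, q := by simp
  rw [card_cornerBox, this, ← Finset.prod_mul_distrib]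
  refine Finset.prod_le_prod' fun j _ => ?_
  have := Nat.lt_mul_div_succ (N j) hq
  exact this.le

lemma card_cornerBox_le {N : Fin r → ℕ} {q : ℕ} (hN : ∀ j, 0 < N j) (hq : 2 ≤ q) :
    #(cornerBox N q) ≤ ∏ j, N j := by
  rw [card_cornerBox]
  refine Finset.prod_le_prod' fun j _ => ?_
  have h1 : N j / q ≤ N j / 2 := Nat.div_le_div_left hq (by norm_num)
  have := hN j
  omega

/-- The ratios `(x₀ + φ i) / φ h` with `i, h` in the corner box and `h ≠ 0`. -/
noncomputable def ratioSet (d : Fin r → ZMod p) (x₀ : ZMod p) (N : Fin r → ℕ) (q : ℕ) : Finset (ZMod p) :=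
  (cornerBox N q ×ˢ (cornerBox N q).erase 0).image
    fun z => (x₀ + linForm d z.1) / linForm d z.2

lemma linForm_ne_zero_of_mem_cornerBox {N : Fin r → ℕ} {d : Fin r → ZMod p} {q : ℕ}
    (hN : ∀ j, 0 < N j) (hq : 2 ≤ q)
    (hproper : ∀ x : Fin r → ℤ, (∀ j, |x j| < N j) → linForm d x = 0 → x = 0)
    {h : Fin r → ℤ} (hh : h ∈ (cornerBox N q).erase 0) : linForm d h ≠ 0 := by
  intro h0
  rw [Finset.mem_erase, mem_cornerBox] at hh
  refine hh.1 (hproper h (fun j => ?_) h0)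
  obtain ⟨h1, h2⟩ := hh.2 j
  have h3 : N j / q ≤ N j / 2 := Nat.div_le_div_left hq (by norm_num)
  have := hN j
  rw [abs_of_nonneg h1]
  omega

/-- There are many ratios. -/
theorem sq_prod_le_card_ratioSet {N : Fin r → ℕ} {d : Fin r → ZMod p} {x₀ : ZMod p} {k τ : ℕ}
    (hr : 0 < r) (hk : 0 < k) (hN : ∀ j, 0 < N j)
    (hproper : ∀ x : Fin r → ℤ, (∀ j, |x j| < N j) → linForm d x = 0 → x = 0)
    (hp : (∏ j, N j) ^ 2 ≤ p) (hx₀ : ∀ i ∈ cornerBox N (4 * k * r), x₀ + linForm d i ≠ 0)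
    (hbig : (4 * k * r) ^ r < ∏ j, N j) (hτ : ratioThreshold r ≤ τ)
    (hτ' : 4 * ratioConst r * (4 * k * r) ^ (2 * r) * (1 + Real.log p) ≤ τ) :
    ((∏ j, N j : ℕ) : ℝ) ^ 2 ≤
      (4 * k * r) ^ (2 * r) * (4 * τ * #(ratioSet d x₀ N (4 * k * r))) := by
  classical
  set q := 4 * k * r with hq
  set P := ∏ j, N j with hP
  set H := cornerBox N q with hH
  set U := ratioSet d x₀ N q with hU
  have hq4 : 4 ≤ q := by
    rw [hq, mul_assoc]
    have : 0 < k * r := Nat.mul_pos hk hr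
    omega
  have hq4r : 4 * r ≤ q := by
    rw [hq]
    nlinarith
  have hPH : P ≤ q ^ r * #H := prod_le_pow_mul_card_cornerBox N (by omega)
  have hHP : #H ≤ P := card_cornerBox_le hN (by omega)
  have hH2 : 2 ≤ #H := by
    by_contra h
    have : #H ≤ 1 := by omega
    have := Nat.mul_le_mul_left (q ^ r) this
    omega
  set f : (Fin r → ℤ) × (Fin r → ℤ) → ZMod p :=
    fun z => (x₀ + linForm d z.1) / linForm d z.2 with hf
  set E := H ×ˢ H.erase 0 with hE
  have h0H : (0 : Fin r → ℤ) ∈ H := by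
    rw [hH, mem_cornerBox]; exact fun j => ⟨le_rfl, Int.natCast_nonneg _⟩
  have hEcard : #E = #H * (#H - 1) := by
    rw [hE, Finset.card_product, Finset.card_erase_of_mem h0H]
  have hUE : U = E.image f := rfl
  set m : ZMod p → ℕ := fun u => #{z ∈ E | f z = u} with hm
  have hsum : ∑ u ∈ U, m u = #E := (Finset.card_eq_sum_card_image f E).symm
  have hE2 : #E ≤ p := by
    rw [hEcard]
    calc #H * (#H - 1) ≤ P * P := Nat.mul_le_mul hHP (by omega)
      _ = P ^ 2 := (sq P).symm
      _ ≤ p := hp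
  have hmM : ∀ u ∈ U, m u ≤ p := fun u _ => (Finset.card_filter_le _ _).trans hE2
  have hdist : ∀ s : ℕ, τ ≤ s → (#{u ∈ U | s ≤ m u} : ℝ) * s ^ 2 ≤ ratioConst r * P ^ 2 := by
    intro s hs
    have hs' : ratioThreshold r ≤ s := hτ.trans (by exact_mod_cast hs)
    refine le_trans (mul_le_mul_of_nonneg_right ?_ (sq_nonneg _))
      (card_mul_sq_le_of_proper hN hproper hp hs')
    refine Nat.cast_le.mpr (Finset.card_le_card fun u hu => ?_)
    rw [Finset.mem_filter] at hu ⊢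
    obtain ⟨huU, hsu⟩ := hu
    rw [hUE, Finset.mem_image] at huU
    obtain ⟨z₀, hz₀, hzu⟩ := huU
    have hz : ∀ z ∈ E, linForm d z.2 ≠ 0 ∧ x₀ + linForm d z.1 ≠ 0 ∧ z.1 ∈ H ∧ z.2 ∈ H := by
      intro z hz
      rw [hE, Finset.mem_product] at hz
      exact ⟨linForm_ne_zero_of_mem_cornerBox hN (by omega) hproper hz.2, hx₀ _ hz.1, hz.1,
        Finset.mem_of_mem_erase hz.2⟩
    refine ⟨Finset.mem_univ _, ?_, ?_⟩
    · rw [← hzu]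
      exact div_ne_zero (hz z₀ hz₀).2.1 (hz z₀ hz₀).1
    · refine ⟨({z ∈ E | f z = u}).image fun z => z - z₀, ?_, ?_⟩
      · rw [Finset.card_image_of_injective _ (sub_left_injective)]
        exact_mod_cast hsu
      · intro x hx
        rw [Finset.mem_image] at hx
        obtain ⟨z, hzf, rfl⟩ := hx
        rw [Finset.mem_filter] at hzf
        obtain ⟨hz1, hz2, hz3, hz4⟩ := hz z hzf.1
        obtain ⟨hy1, hy2, hy3, hy4⟩ := hz z₀ hz₀
        have hbd : ∀ a ∈ H, ∀ b ∈ H, ∀ j, 4 * (r : ℤ) * |a j - b j| ≤ N j := by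
          intro a ha b hb j
          have ha' := mem_cornerBox.mp ha j
          have hb' := mem_cornerBox.mp hb j
          have h1 : |a j - b j| ≤ ((N j / q : ℕ) : ℤ) := by rw [abs_le]; omega
          have h2 : q * (N j / q) ≤ N j := Nat.mul_div_le _ _
          calc 4 * (r : ℤ) * |a j - b j| ≤ (q : ℤ) * ((N j / q : ℕ) : ℤ) := by
                gcongr
                exact_mod_cast hq4r
            _ ≤ N j := by exact_mod_cast h2
        refine ⟨fun j => ⟨hbd _ hz3 _ hy3 j, hbd _ hz4 _ hy4 j⟩, ?_⟩
        have e1 : x₀ + linForm d z.1 = u * linForm d z.2 := by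
          rw [← hzf.2, hf]; field_simp
        have e2 : x₀ + linForm d z₀.1 = u * linForm d z₀.2 := by
          rw [← hzu, hf]; field_simp
        rw [Prod.fst_sub, Prod.snd_sub, map_sub, map_sub]
        linear_combination e1 - e2
  have hp1 : (1 : ℝ) ≤ p := by exact_mod_cast (Fact.out : p.Prime).one_lt.le
  have hC : 0 < ratioConst r := by
    have := two_le_momentLoss r
    have := one_le_pointLoss r
    unfold ratioConst
    positivity
  have hτ0 : 0 < τ := by
    have h1 : 0 < 4 * ratioConst r * (4 * k * r) ^ (2 * r) * (1 + Real.log p) := by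
      have := Real.log_nonneg hp1
      have : (0 : ℝ) < k := by exact_mod_cast hk
      have : (0 : ℝ) < r := by exact_mod_cast hr
      positivity
    exact_mod_cast h1.trans_le hτ'
  have hmain := sum_le_of_card_mul_sq_le U m hτ0 hmM hdist
  rw [hsum, hEcard] at hmain
  have hqr : (q : ℝ) = 4 * k * r := by rw [hq]; push_cast; rfl
  rw [← hqr] at hτ' ⊢
  have hτr : (0 : ℝ) < τ := by exact_mod_cast hτ0
  have hPH' : (P : ℝ) ^ 2 ≤ q ^ (2 * r) * (#H : ℝ) ^ 2 := by
    have : (P : ℝ) ≤ q ^ r * #H := by exact_mod_cast hPH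
    calc (P : ℝ) ^ 2 ≤ (q ^ r * #H) ^ 2 := by gcongr
      _ = _ := by ring
  have hlog : 0 ≤ 1 + Real.log p := by linarith [Real.log_nonneg hp1]
  have herr : ratioConst r * P ^ 2 / τ * (1 + Real.log p) ≤ (#H : ℝ) ^ 2 / 4 := by
    rw [div_mul_eq_mul_div, div_le_iff₀ hτr]
    calc ratioConst r * P ^ 2 * (1 + Real.log p)
        ≤ ratioConst r * (q ^ (2 * r) * (#H : ℝ) ^ 2) * (1 + Real.log p) := by gcongr
      _ = (4 * ratioConst r * q ^ (2 * r) * (1 + Real.log p)) * ((#H : ℝ) ^ 2 / 4) := by ring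
      _ ≤ τ * ((#H : ℝ) ^ 2 / 4) := by gcongr
      _ = _ := mul_comm _ _
  have hcast : ((#H * (#H - 1) : ℕ) : ℝ) = #H * ((#H : ℝ) - 1) := by
    rw [Nat.cast_mul, Nat.cast_sub (by omega)]; simp
  rw [hcast] at hmain
  have hH2' : (2 : ℝ) ≤ #H := by exact_mod_cast hH2
  have hfin : (#H : ℝ) ^ 2 ≤ 4 * τ * #U := by nlinarith
  exact hPH'.trans (by gcongr)

end RatioCount

section Stepanov

open Polynomial

variable {K : Type*} [Field K]

/-- The operator with `D^k (f^e h) = f^(e-k) * stepOp f e k h`. -/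
noncomputable def stepOp (f : K[X]) (e : ℕ) : ℕ → K[X] →ₗ[K] K[X]
  | 0 => LinearMap.id
  | k + 1 => LinearMap.mulLeft K (((e - k : ℕ) : K[X]) * derivative f) ∘ₗ stepOp f e k +
      LinearMap.mulLeft K f ∘ₗ derivative ∘ₗ stepOp f e k

lemma stepOp_succ (f : K[X]) (e k : ℕ) (h : K[X]) :
    stepOp f e (k + 1) h =
      ((e - k : ℕ) : K[X]) * derivative f * stepOp f e k h + f * derivative (stepOp f e k h) := rfl

lemma iterate_derivative_pow_mul (f h : K[X]) {e k : ℕ} (hk : k ≤ e) :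
    derivative^[k] (f ^ e * h) = f ^ (e - k) * stepOp f e k h := by
  induction k with
  | zero => rfl
  | succ k ih =>
    rw [Function.iterate_succ_apply', ih (by omega), stepOp_succ, derivative_mul, derivative_pow]
    obtain ⟨i, hi⟩ : ∃ i, e - k = i + 1 := ⟨e - k - 1, by omega⟩
    have : e - (k + 1) = i := by omega
    rw [this, hi]
    simp only [Nat.add_sub_cancel, pow_succ, map_natCast]
    ring

lemma natDegree_stepOp_le (f h : K[X]) (e k : ℕ) :
    (stepOp f e k h).natDegree ≤ h.natDegree + k * f.natDegree := by
  induction k with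
  | zero => simp [stepOp]
  | succ k ih =>
    rw [stepOp_succ]
    have h1 := natDegree_derivative_le f
    have h2 := natDegree_derivative_le (stepOp f e k h)
    have e1 : (k + 1) * f.natDegree = k * f.natDegree + f.natDegree := by ring
    refine natDegree_add_le_of_degree_le ?_ ?_
    · refine natDegree_mul_le.trans ?_
      have : (((e - k : ℕ) : K[X]) * derivative f).natDegree ≤ 0 + (derivative f).natDegree :=
        natDegree_mul_le.trans (by rw [natDegree_natCast])
      omega
    · refine natDegree_mul_le.trans ?_
      omega

lemma iterate_derivative_mul_of_derivative_eq_zero {g : K[X]} (hg : derivative g = 0) (h : K[X])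
    (k : ℕ) : derivative^[k] (g * h) = g * derivative^[k] h := by
  induction k with
  | zero => rfl
  | succ k ih =>
    rw [Function.iterate_succ_apply', ih, Function.iterate_succ_apply', derivative_mul, hg]
    ring

/-- A solvable system of linear conditions: the auxiliary polynomials. -/
lemma exists_auxiliary (f : K[X]) {l m n J : ℕ} (hn : 0 < n)
    (hdim : l * (n + l * f.natDegree + J) < 2 * J * n) :
    ∃ r s : Fin J → K[X], (∀ j, (r j).natDegree < n ∧ (s j).natDegree < n) ∧
      (∃ j, r j ≠ 0 ∨ s j ≠ 0) ∧
      ∀ k < l, ∑ j : Fin J, X ^ (j : ℕ) * (stepOp f l k (r j) + stepOp f (l + m) k (s j)) = 0 := by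
  set M := n + l * f.natDegree + J with hM
  set V := (Fin J → degreeLT K n) × (Fin J → degreeLT K n)
  let Ψ : ℕ → V →ₗ[K] K[X] := fun k => ∑ j : Fin J, LinearMap.mulLeft K (X ^ (j : ℕ)) ∘ₗ
    (stepOp f l k ∘ₗ Submodule.subtype _ ∘ₗ LinearMap.proj j ∘ₗ LinearMap.fst K _ _ +
      stepOp f (l + m) k ∘ₗ Submodule.subtype _ ∘ₗ LinearMap.proj j ∘ₗ LinearMap.snd K _ _)
  let L : V →ₗ[K] (Fin l → Fin M → K) :=
    LinearMap.pi fun k => LinearMap.pi fun i => lcoeff K (i : ℕ) ∘ₗ Ψ k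
  have hfd : Module.finrank K (degreeLT K n) = n := by
    rw [(degreeLTEquiv K n).finrank_eq, Module.finrank_fin_fun]
  have : FiniteDimensional K (degreeLT K n) :=
    Module.Finite.equiv (degreeLTEquiv K n).symm
  have hlt : Module.finrank K (Fin l → Fin M → K) < Module.finrank K V := by
    rw [Module.finrank_prod]
    simp only [Module.finrank_pi_fintype, Module.finrank_self, mul_one, hfd, Finset.sum_const, Finset.card_univ, Fintype.card_fin,
      smul_eq_mul]
    linarith [mul_assoc 2 J n]
  obtain ⟨v, hv, hv0⟩ := Submodule.exists_mem_ne_zero_of_ne_bot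
    (LinearMap.ker_ne_bot_of_finrank_lt (f := L) hlt)
  have hdeg : ∀ g : degreeLT K n, (g : K[X]).natDegree < n := by
    intro g
    by_cases hg : (g : K[X]) = 0
    · simpa [hg] using hn
    · exact (natDegree_lt_iff_degree_lt hg).mpr (mem_degreeLT.mp g.2)
  refine ⟨fun j => v.1 j, fun j => v.2 j, fun j => ⟨hdeg _, hdeg _⟩, ?_, ?_⟩
  · by_contra! hcon
    refine hv0 (Prod.ext (funext fun j => Subtype.ext (hcon j).1)
      (funext fun j => Subtype.ext (hcon j).2))
  · intro k hk
    have hΨ : Ψ k v = ∑ j : Fin J, X ^ (j : ℕ) *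
        (stepOp f l k (v.1 j) + stepOp f (l + m) k (v.2 j)) := by
      simp only [Ψ, LinearMap.sum_apply, LinearMap.comp_apply, LinearMap.add_apply]
      rfl
    rw [← hΨ]
    ext i
    rw [coeff_zero]
    by_cases hi : i < M
    · exact congrFun (congrFun (LinearMap.mem_ker.mp hv) ⟨k, hk⟩) ⟨i, hi⟩
    · refine coeff_eq_zero_of_natDegree_lt (lt_of_lt_of_le ?_ (not_lt.mp hi))
      have hkl : k * f.natDegree ≤ l * f.natDegree := Nat.mul_le_mul_right _ hk.le
      have : (Ψ k v).natDegree ≤ M - 1 := by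
        rw [hΨ]
        refine natDegree_sum_le_of_forall_le _ _ fun j _ => ?_
        refine natDegree_mul_le.trans ?_
        rw [natDegree_X_pow]
        have h1 := natDegree_stepOp_le f (v.1 j) l k
        have h2 := natDegree_stepOp_le f (v.2 j) (l + m) k
        have h3 := hdeg (v.1 j)
        have h4 := hdeg (v.2 j)
        have h5 := natDegree_add_le (stepOp f l k (v.1 j)) (stepOp f (l + m) k (v.2 j))
        have := j.2
        rcases le_total (stepOp f l k (v.1 j)).natDegree
          (stepOp f (l + m) k (v.2 j)).natDegree with h | h
        · rw [max_eq_right h] at h5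
          omega
        · rw [max_eq_left h] at h5
          omega
      omega

variable {p : ℕ} [Fact p.Prime]

lemma X_pow_dvd_pow_sub_C (f : (ZMod p)[X]) : X ^ p ∣ f ^ p - C (f.eval 0) := by
  rw [← ZMod.expand_card f, X_pow_dvd_iff]
  intro i hi
  rw [coeff_sub, coeff_expand (Fact.out : p.Prime).pos, coeff_C]
  by_cases h0 : i = 0
  · simp [h0, coeff_zero_eq_eval_zero]
  · rw [if_neg (fun h => by have := Nat.le_of_dvd (by omega) h; omega), if_neg h0, sub_zero]

/-- If `f` has a root of odd order, `r + s f^((p-1)/2)` is not divisible by `X^p` for small degree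
`r, s`, unless both vanish. -/
lemma eq_zero_of_X_pow_dvd {f r s : (ZMod p)[X]} {m n : ℕ} (hm : p = 2 * m + 1)
    (hf0 : f.eval 0 ≠ 0) {a : ZMod p} (ha : Odd (f.rootMultiplicity a))
    (hr : r.natDegree < n) (hs : s.natDegree < n) (hdeg : 2 * n + f.natDegree ≤ p)
    (h : X ^ p ∣ r + s * f ^ m) : r = 0 ∧ s = 0 := by
  have hf : f ≠ 0 := by rintro rfl; simp at hf0
  have h1 : X ^ p ∣ r ^ 2 * f - C (f.eval 0) * s ^ 2 := by
    have h2 : r ^ 2 * f - C (f.eval 0) * s ^ 2 =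
        (r + s * f ^ m) * ((r - s * f ^ m) * f) + s ^ 2 * (f ^ p - C (f.eval 0)) := by
      rw [show f ^ p = f ^ m * f ^ m * f by
        rw [← pow_add, ← pow_succ]
        congr 1
        omega]
      ring
    rw [h2]
    exact dvd_add (Dvd.dvd.mul_right h _) (Dvd.dvd.mul_left (X_pow_dvd_pow_sub_C f) _)
  have h2 : r ^ 2 * f - C (f.eval 0) * s ^ 2 = 0 := by
    refine eq_zero_of_dvd_of_natDegree_lt h1 ?_
    rw [natDegree_X_pow]
    refine lt_of_le_of_lt (natDegree_sub_le _ _) (max_lt ?_ ?_)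
    · refine lt_of_le_of_lt natDegree_mul_le ?_
      rw [natDegree_pow]; omega
    · refine lt_of_le_of_lt natDegree_mul_le ?_
      rw [natDegree_pow, natDegree_C]; omega
  have h3 : r ^ 2 * f = C (f.eval 0) * s ^ 2 := sub_eq_zero.mp h2
  have hC : C (f.eval 0) ≠ 0 := C_ne_zero.mpr hf0
  by_cases hs0 : s = 0
  · refine ⟨?_, hs0⟩
    rw [hs0] at h3
    simpa [hf] using h3
  · exfalso
    have hne : C (f.eval 0) * s ^ 2 ≠ 0 := mul_ne_zero hC (pow_ne_zero _ hs0)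
    have hr0 : r ≠ 0 := by rintro rfl; rw [← h3] at hne; simp at hne
    have e1 := congrArg (rootMultiplicity a) h3
    rw [rootMultiplicity_mul (h3 ▸ hne), rootMultiplicity_mul hne, sq, sq,
      rootMultiplicity_mul (mul_ne_zero hr0 hr0), rootMultiplicity_mul (mul_ne_zero hs0 hs0),
      rootMultiplicity_C] at e1
    obtain ⟨i, hi⟩ := ha
    omega

lemma mul_card_le_natDegree {K : Type*} [Field K] {g : K[X]} {l : ℕ}
    {A : Finset K} (hA : ∀ a ∈ A, l ≤ g.rootMultiplicity a) : l * #A ≤ g.natDegree := by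
  classical
  have h : l • A.val ≤ g.roots := by
    rw [Multiset.le_iff_count]
    intro a
    rw [Multiset.count_nsmul, count_roots]
    by_cases ha : a ∈ A
    · rw [Multiset.count_eq_one_of_mem A.nodup ha]
      simpa using hA a ha
    · rw [Multiset.count_eq_zero_of_notMem ha]
      simp
  have := (Multiset.card_le_card h).trans g.card_roots'
  simpa using this

/-- Stepanov's bound with free parameters. -/
theorem stepanov {f : (ZMod p)[X]} {l m n J : ℕ} (hm : p = 2 * m + 1) (hf0 : f.eval 0 ≠ 0)
    {a₀ : ZMod p} (ha₀ : Odd (f.rootMultiplicity a₀)) (hn : 0 < n) (hl : l ≤ p)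
    (hdeg : 2 * n + f.natDegree ≤ p) (hdim : l * (n + l * f.natDegree + J) < 2 * J * n) :
    l * #{a : ZMod p | f.eval a ^ m = 1} ≤ l * f.natDegree + p * J + f.natDegree * m := by
  obtain ⟨r, s, hrs, ⟨j₁, hj₁⟩, hΨ⟩ := exists_auxiliary f (m := m) hn hdim
  set Φ := f ^ l * ∑ j : Fin J, X ^ (p * (j : ℕ)) * (r j + s j * f ^ m) with hΦ
  have hf : f ≠ 0 := by rintro rfl; simp at hf0
  have hp0 := (Fact.out : p.Prime).pos
  have hΦ0 : Φ ≠ 0 := by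
    intro h0
    have hsum : ∑ j : Fin J, X ^ (p * (j : ℕ)) * (r j + s j * f ^ m) = 0 := by
      rcases mul_eq_zero.mp h0 with h | h
      · exact absurd h (pow_ne_zero _ hf)
      · exact h
    have hall : ∀ i : ℕ, ∀ hi : i < J, r ⟨i, hi⟩ = 0 ∧ s ⟨i, hi⟩ = 0 := by
      intro i
      induction i using Nat.strong_induction_on with
      | _ i ih =>
        intro hi
        refine eq_zero_of_X_pow_dvd hm hf0 ha₀ (hrs _).1 (hrs _).2 hdeg ?_
        have h1 : X ^ (p * i) * X ^ p ∣ X ^ (p * i) * (r ⟨i, hi⟩ + s ⟨i, hi⟩ * f ^ m) := by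
          rw [← Finset.add_sum_erase _ _ (Finset.mem_univ (⟨i, hi⟩ : Fin J))] at hsum
          rw [eq_neg_of_add_eq_zero_left hsum]
          refine (dvd_neg).mpr (Finset.dvd_sum fun j hj => ?_)
          rcases lt_trichotomy (j : ℕ) i with hji | hji | hji
          · obtain ⟨e1, e2⟩ := ih j hji j.2
            simp only [Fin.eta] at e1 e2
            rw [e1, e2]
            simp
          · exact absurd (Fin.ext hji) (Finset.ne_of_mem_erase hj)
          · refine Dvd.dvd.mul_right ?_ _
            rw [← pow_add]
            refine pow_dvd_pow _ ?_
            calc p * i + p = p * (i + 1) := by ring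
              _ ≤ p * j := Nat.mul_le_mul_left _ hji
        exact (mul_dvd_mul_iff_left (pow_ne_zero _ X_ne_zero)).mp h1
    obtain ⟨e1, e2⟩ := hall j₁ j₁.2
    rcases hj₁ with h | h
    · exact h e1
    · exact h e2
  have hder : ∀ k ≤ l, derivative^[k] Φ = f ^ (l - k) * ∑ j : Fin J, X ^ (p * (j : ℕ)) *
      (stepOp f l k (r j) + f ^ m * stepOp f (l + m) k (s j)) := by
    intro k hk
    have e1 : Φ = ∑ j : Fin J, (X ^ (p * (j : ℕ)) * (f ^ l * r j) +
        X ^ (p * (j : ℕ)) * (f ^ (l + m) * s j)) := by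
      rw [hΦ, Finset.mul_sum]
      refine Finset.sum_congr rfl fun j _ => ?_
      rw [pow_add]
      ring
    rw [e1, iterate_derivative_sum, Finset.mul_sum]
    refine Finset.sum_congr rfl fun j _ => ?_
    have hX : derivative (X ^ (p * (j : ℕ)) : (ZMod p)[X]) = 0 := by
      rw [derivative_X_pow]
      simp
    rw [iterate_map_add, iterate_derivative_mul_of_derivative_eq_zero hX,
      iterate_derivative_mul_of_derivative_eq_zero hX, iterate_derivative_pow_mul _ _ hk,
      iterate_derivative_pow_mul _ _ (by omega), show l + m - k = l - k + m by omega, pow_add]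
    ring
  have hroot : ∀ a ∈ ({a : ZMod p | f.eval a ^ m = 1} : Finset (ZMod p)),
      l ≤ Φ.rootMultiplicity a := by
    intro a ha
    rw [Finset.mem_filter] at ha
    rcases Nat.eq_zero_or_pos l with hl0 | hl0
    · omega
    have hlt : l - 1 < Φ.rootMultiplicity a := by
      refine lt_rootMultiplicity_of_isRoot_iterate_derivative_of_mem_nonZeroDivisors hΦ0 ?_ ?_
      · intro k hk
        rw [IsRoot, hder k (by omega), eval_mul]
        have h2 := congrArg (eval a) (hΨ k (by omega))
        simp only [eval_finsetSum, eval_mul, eval_pow, eval_X, eval_add, eval_zero] at h2 ⊢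
        rw [Finset.sum_congr rfl fun j _ => by
          rw [ha.2, one_mul, pow_mul, ZMod.pow_card], h2, mul_zero]
      · refine mem_nonZeroDivisors_of_ne_zero fun h => ?_
        rw [ZMod.natCast_eq_zero_iff, (Fact.out : p.Prime).dvd_factorial] at h
        omega
    omega
  refine (mul_card_le_natDegree hroot).trans ?_
  refine natDegree_mul_le.trans ?_
  rw [natDegree_pow, add_assoc]
  refine Nat.add_le_add_left ?_ _
  refine natDegree_sum_le_of_forall_le _ _ fun j _ => ?_
  refine natDegree_mul_le.trans ?_
  rw [natDegree_X_pow]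
  have h1 : (r j + s j * f ^ m).natDegree ≤ p + f.natDegree * m := by
    obtain ⟨h2, h3⟩ := hrs j
    refine natDegree_add_le_of_degree_le (by omega) (natDegree_mul_le.trans ?_)
    rw [natDegree_pow, mul_comm m]
    omega
  have h2 : p * (j : ℕ) + p ≤ p * J := by
    calc p * (j : ℕ) + p = p * (j + 1) := by ring
      _ ≤ p * J := Nat.mul_le_mul_left _ j.2
  omega

end Stepanov

section CharacterSums

open Polynomial

variable {p : ℕ} [Fact p.Prime]

theorem card_eval_pow_eq_one_le {f : (ZMod p)[X]} {m : ℕ} (hm : p = 2 * m + 1)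
    (hf0 : f.eval 0 ≠ 0) (hd : 1 ≤ f.natDegree) {a₀ : ZMod p}
    (ha₀ : Odd (f.rootMultiplicity a₀)) :
    (#{a : ZMod p | f.eval a ^ m = 1} : ℝ) ≤ p / 2 + 20 * f.natDegree * √p := by
  set d := f.natDegree with hdef
  set A : Finset (ZMod p) := {a : ZMod p | f.eval a ^ m = 1} with hA
  set l := Nat.sqrt p with hl
  have hll : l * l ≤ p := Nat.sqrt_le p
  have hlp : √(p : ℝ) ≤ l + 1 := by
    rw [Real.sqrt_le_left (by positivity), sq]
    exact_mod_cast (Nat.lt_succ_sqrt p).le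
  have hsq : √(p : ℝ) * √(p : ℝ) = p := Real.mul_self_sqrt (Nat.cast_nonneg p)
  have hs0 : 0 ≤ √(p : ℝ) := Real.sqrt_nonneg _
  have hdr : (1 : ℝ) ≤ d := by exact_mod_cast hd
  by_cases hcase : l < 8 * d + 10
  · have h1 : (#A : ℝ) ≤ p := by
      have := Finset.card_le_univ A
      rw [ZMod.card] at this
      exact_mod_cast this
    have h2 : √(p : ℝ) ≤ 18 * d := by
      have : (l : ℝ) + 1 ≤ 8 * d + 10 := by exact_mod_cast hcase
      linarith
    nlinarith
  · push Not at hcase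
    have hlp' : l ≤ p := Nat.sqrt_le_self p
    have h324 : 18 * 18 ≤ l * l := Nat.mul_self_le_mul_self (by omega)
    have hdl : d * 18 ≤ l * l := Nat.mul_le_mul (by omega) (by omega)
    have hst := stepanov (f := f) (l := l) (n := p / 4) (J := l / 2 + 4 * d + 5) hm hf0 ha₀
      (by omega) hlp' (by rw [← hdef]; omega) (by
        rw [← hdef]
        set n := p / 4 with hn
        set J := l / 2 + 4 * d + 5 with hJ
        have hJl : J ≤ l := by omega
        have hJ2 : l + 8 * d + 9 ≤ 2 * J := by omega
        have hpn : p ≤ 7 * n := by omega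
        have e1 : l * (l * d) ≤ 7 * n * d := by
          rw [← mul_assoc]
          exact Nat.mul_le_mul_right _ (hll.trans hpn)
        have e2 : l * J ≤ 7 * n := (Nat.mul_le_mul_left l hJl).trans (hll.trans hpn)
        have e3 := Nat.mul_le_mul_right n hJ2
        have hn1 : 1 ≤ n := by omega
        nlinarith)
    rw [← hdef] at hst
    have hst' : (l : ℝ) * #A ≤ l * d + p * (l / 2 + 4 * d + 5) + d * (p / 2) := by
      have e1 : (l : ℝ) * #A ≤ l * d + p * ((l / 2 : ℕ) + 4 * d + 5) + d * m := by
        exact_mod_cast hst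
      have e2 : ((l / 2 : ℕ) : ℝ) ≤ l / 2 := Nat.cast_div_le
      have e3 : (m : ℝ) ≤ p / 2 := by
        rw [hm]; push_cast; linarith
      refine e1.trans ?_
      gcongr
    have hl18 : (18 : ℝ) ≤ l := by exact_mod_cast (by omega : 18 ≤ l)
    have hs1 : 1 ≤ √(p : ℝ) := by
      rw [Real.one_le_sqrt]
      exact_mod_cast (Fact.out : p.Prime).one_lt.le
    have hpl : (p : ℝ) ≤ 19 / 18 * (l * √(p : ℝ)) := by nlinarith
    have hkey : (l : ℝ) * #A ≤ l * (p / 2 + 20 * d * √p) := by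
      have e1 : (l : ℝ) * d ≤ l * d * √p := le_mul_of_one_le_right (by positivity) hs1
      have e2 : (p : ℝ) * (4 * d + 5) + d * (p / 2) ≤ 10 * d * p := by
        have : (0 : ℝ) ≤ p := Nat.cast_nonneg p
        nlinarith
      have e3 := mul_le_mul_of_nonneg_left hpl (by positivity : (0 : ℝ) ≤ 10 * d)
      have e4 : 0 ≤ (l : ℝ) * d * √p := by positivity
      nlinarith
    exact le_of_mul_le_mul_left hkey (by linarith)

theorem sum_quadraticChar_eval_le {f : (ZMod p)[X]} (hp2 : p ≠ 2)
    (hf0 : f.eval 0 ≠ 0) (hd : 1 ≤ f.natDegree) {a₀ : ZMod p}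
    (ha₀ : Odd (f.rootMultiplicity a₀)) :
    ((∑ u : ZMod p, quadraticChar (ZMod p) (f.eval u) : ℤ) : ℝ) ≤ 41 * f.natDegree * √p := by
  obtain ⟨m, hm⟩ := (Fact.out : p.Prime).odd_of_ne_two hp2
  have hp := (Fact.out : p.Prime).two_le
  have hchar : ringChar (ZMod p) ≠ 2 := by rwa [ZMod.ringChar_zmod_n]
  have hpt : ∀ v : ZMod p, quadraticChar (ZMod p) v =
      2 * (if v ^ m = 1 then 1 else 0) - 1 + (if v = 0 then 1 else 0) := by
    intro v
    by_cases hv : v = 0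
    · subst hv
      rw [MulChar.map_zero, zero_pow (by omega)]
      simp
    · rw [quadraticChar_eq_pow_of_char_ne_two hchar hv, ZMod.card, show p / 2 = m by omega]
      by_cases h : v ^ m = 1 <;> simp [h, hv]
  have hf : f ≠ 0 := by rintro rfl; simp at hf0
  have hzero : #{u : ZMod p | f.eval u = 0} ≤ f.natDegree := by
    refine card_le_degree_of_subset_roots fun u hu => ?_
    rw [Finset.mem_val, Finset.mem_filter] at hu
    exact (mem_roots hf).mpr hu.2
  have hsum : ∑ u : ZMod p, quadraticChar (ZMod p) (f.eval u) =
      2 * #{a : ZMod p | f.eval a ^ m = 1} - p + #{u : ZMod p | f.eval u = 0} := by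
    simp_rw [hpt]
    rw [Finset.sum_add_distrib, Finset.sum_sub_distrib, ← Finset.mul_sum]
    rw [Finset.sum_boole, Finset.sum_boole, Finset.sum_const, Finset.card_univ, ZMod.card,
      nsmul_eq_mul, mul_one]
  rw [hsum]
  push_cast
  have h1 := card_eval_pow_eq_one_le hm hf0 hd ha₀
  have h2 : (#{u : ZMod p | f.eval u = 0} : ℝ) ≤ f.natDegree := by exact_mod_cast hzero
  have hs1 : 1 ≤ √(p : ℝ) := by
    rw [Real.one_le_sqrt]
    exact_mod_cast (Fact.out : p.Prime).one_lt.le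
  have h3 : (f.natDegree : ℝ) ≤ f.natDegree * √p := le_mul_of_one_le_right (by positivity) hs1
  linarith

lemma sum_prod_quadraticChar_le (hp2 : p ≠ 2) {S : Finset (ZMod p)} (hS : S.Nonempty)
    (h0 : (0 : ZMod p) ∉ S) :
    ((∑ u : ZMod p, ∏ b ∈ S, quadraticChar (ZMod p) (u + b) : ℤ) : ℝ) ≤ 41 * #S * √p := by
  set f : (ZMod p)[X] := ∏ b ∈ S, (X + C b) with hf
  have heval : ∀ u, f.eval u = ∏ b ∈ S, (u + b) := fun u => by
    rw [hf, eval_prod]; simp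
  have hdeg : f.natDegree = #S := by
    rw [hf, natDegree_prod_of_monic _ _ fun b _ => monic_X_add_C b]
    simp
  obtain ⟨b₀, hb₀⟩ := hS
  have hodd : Odd (f.rootMultiplicity (-b₀)) := by
    set g : (ZMod p)[X] := ∏ b ∈ S.erase b₀, (X + C b) with hg
    have hfg : f = (X - C (-b₀)) * g := by
      rw [hf, ← Finset.mul_prod_erase S _ hb₀, map_neg, sub_neg_eq_add]
    have hg0 : ¬ g.IsRoot (-b₀) := by
      rw [IsRoot, hg, eval_prod, Finset.prod_eq_zero_iff]
      rintro ⟨b, hb, h⟩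
      refine Finset.ne_of_mem_erase hb ?_
      simp only [eval_add, eval_X, eval_C] at h
      linear_combination h
    have hgne : g ≠ 0 := by rintro h; rw [h] at hg0; simp at hg0
    rw [hfg, rootMultiplicity_mul (mul_ne_zero (X_sub_C_ne_zero _) hgne),
      rootMultiplicity_X_sub_C_self, rootMultiplicity_eq_zero hg0]
    exact odd_one
  have hmain := sum_quadraticChar_eval_le (f := f) hp2 (by
      rw [heval]
      refine Finset.prod_ne_zero_iff.mpr fun b hb => ?_
      rw [zero_add]
      exact fun h => h0 (h ▸ hb))
    (by rw [hdeg]; exact Finset.card_pos.mpr ⟨b₀, hb₀⟩) hodd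
  rw [hdeg] at hmain
  simpa only [heval, map_prod] using hmain

/-- Few `u` have all the shifts `u + b` among the quadratic residues. -/
theorem card_forall_quadraticChar_eq_one_le (hp2 : p ≠ 2) {B : Finset (ZMod p)}
    (h0 : (0 : ZMod p) ∉ B) :
    (#{u : ZMod p | ∀ b ∈ B, quadraticChar (ZMod p) (u + b) = 1} : ℝ) ≤
      p / 2 ^ #B + 41 * #B * √p := by
  set k := #B with hk
  have hnonneg : ∀ v : ZMod p, 0 ≤ 1 + quadraticChar (ZMod p) v := by
    intro v
    by_cases hv : v = 0
    · simp [hv]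
    · rcases quadraticChar_dichotomy hv with h | h <;> simp [h]
  have h1 : 2 ^ k * (#{u : ZMod p | ∀ b ∈ B, quadraticChar (ZMod p) (u + b) = 1} : ℤ) ≤
      ∑ u : ZMod p, ∏ b ∈ B, (1 + quadraticChar (ZMod p) (u + b)) := by
    rw [Finset.card_filter, Nat.cast_sum, Finset.mul_sum]
    refine Finset.sum_le_sum fun u _ => ?_
    by_cases h : ∀ b ∈ B, quadraticChar (ZMod p) (u + b) = 1
    · rw [if_pos h, Finset.prod_congr rfl fun b hb => by rw [h b hb], Finset.prod_const]
      norm_num [hk]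
    · rw [if_neg h]
      simpa using Finset.prod_nonneg fun b _ => hnonneg (u + b)
  have h2 : ∑ u : ZMod p, ∏ b ∈ B, (1 + quadraticChar (ZMod p) (u + b)) =
      ∑ S ∈ B.powerset, ∑ u : ZMod p, ∏ b ∈ S, quadraticChar (ZMod p) (u + b) := by
    rw [Finset.sum_comm]
    exact Finset.sum_congr rfl fun u _ => Finset.prod_one_add _
  have h3 : ∀ S ∈ B.powerset,
      ((∑ u : ZMod p, ∏ b ∈ S, quadraticChar (ZMod p) (u + b) : ℤ) : ℝ) ≤
        (if S = ∅ then (p : ℝ) else 0) + 41 * k * √p := by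
    intro S hS
    rw [Finset.mem_powerset] at hS
    rcases S.eq_empty_or_nonempty with h | h
    · subst h
      simp only [Finset.prod_empty, Finset.sum_const, Finset.card_univ, ZMod.card, if_true]
      simp only [nsmul_eq_mul, mul_one, Int.cast_natCast]
      have : 0 ≤ 41 * (k : ℝ) * √p := by positivity
      linarith
    · rw [if_neg h.ne_empty, zero_add]
      refine (sum_prod_quadraticChar_le hp2 h fun h' => h0 (hS h')).trans ?_
      have : (#S : ℝ) ≤ k := by exact_mod_cast Finset.card_le_card hS
      gcongr
  rw [h2] at h1
  have h4 : (2 : ℝ) ^ k * (#{u : ZMod p | ∀ b ∈ B, quadraticChar (ZMod p) (u + b) = 1} : ℝ) ≤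
      p + 2 ^ k * (41 * k * √p) := by
    calc (2 : ℝ) ^ k * (#{u : ZMod p | ∀ b ∈ B, quadraticChar (ZMod p) (u + b) = 1} : ℝ)
        ≤ ∑ S ∈ B.powerset,
            ((∑ u : ZMod p, ∏ b ∈ S, quadraticChar (ZMod p) (u + b) : ℤ) : ℝ) := by
          exact_mod_cast h1
      _ ≤ ∑ S ∈ B.powerset, ((if S = ∅ then (p : ℝ) else 0) + 41 * k * √p) :=
          Finset.sum_le_sum h3
      _ = p + 2 ^ k * (41 * k * √p) := by
          rw [Finset.sum_add_distrib, Finset.sum_ite_eq' , if_pos (Finset.empty_mem_powerset _),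
            Finset.sum_const, Finset.card_powerset, nsmul_eq_mul]
          push_cast
          rfl
  have hpos : (0 : ℝ) < 2 ^ k := by positivity
  rw [← sub_nonneg] at h4 ⊢
  have h5 : (p : ℝ) / 2 ^ k + 41 * k * √p -
      (#{u : ZMod p | ∀ b ∈ B, quadraticChar (ZMod p) (u + b) = 1} : ℝ) =
      (p + 2 ^ k * (41 * k * √p) - 2 ^ k *
      (#{u : ZMod p | ∀ b ∈ B, quadraticChar (ZMod p) (u + b) = 1} : ℝ)) / 2 ^ k := by
    field_simp
  rw [h5]
  positivity

/-- Few `u` have the shifts `u + 1, …, u + k` all of the same quadratic character. -/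
theorem card_le_of_shifts_same_char (hp2 : p ≠ 2) {k : ℕ} (hk : k < p) {U : Finset (ZMod p)}
    (hU : ∀ u ∈ U, ∃ c : ZMod p, c ≠ 0 ∧ ∀ b : ℕ, 1 ≤ b → b ≤ k →
      quadraticChar (ZMod p) (u + b) = quadraticChar (ZMod p) c) :
    (#U : ℝ) ≤ 2 * (p / 2 ^ k + 41 * k * √p) := by
  classical
  have hchar : ringChar (ZMod p) ≠ 2 := by rwa [ZMod.ringChar_zmod_n]
  set B : Finset (ZMod p) := (Finset.Icc 1 k).image fun b : ℕ => (b : ZMod p) with hB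
  have hinj : Set.InjOn (fun b : ℕ => (b : ZMod p)) (Finset.Icc 1 k : Finset ℕ) := by
    intro a ha b hb h
    rw [Finset.coe_Icc, Set.mem_Icc] at ha hb
    exact CharP.natCast_injOn_Iio (ZMod p) p (by simp; omega) (by simp; omega) h
  have hBcard : #B = k := by rw [hB, Finset.card_image_of_injOn hinj]; simp
  have hB0 : (0 : ZMod p) ∉ B := by
    rw [hB, Finset.mem_image]
    rintro ⟨b, hb, h⟩
    rw [Finset.mem_Icc] at hb
    rw [ZMod.natCast_eq_zero_iff] at h
    have := Nat.le_of_dvd (by omega) h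
    omega
  obtain ⟨e, he⟩ := quadraticChar_exists_neg_one hchar
  have he0 : e ≠ 0 := by rintro rfl; simp at he
  set B' := B.image fun b => e * b with hB'
  have hB'card : #B' = k := by
    rw [hB', Finset.card_image_of_injective _ (mul_right_injective₀ he0), hBcard]
  have hB'0 : (0 : ZMod p) ∉ B' := by
    rw [hB', Finset.mem_image]
    rintro ⟨b, hb, h⟩
    rcases mul_eq_zero.mp h with h | h
    · exact he0 h
    · exact hB0 (h ▸ hb)
  have h1 := card_forall_quadraticChar_eq_one_le hp2 hB0
  have h2 := card_forall_quadraticChar_eq_one_le hp2 hB'0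
  rw [hBcard] at h1
  rw [hB'card] at h2
  have hsub : U ⊆ ({u : ZMod p | ∀ b ∈ B, quadraticChar (ZMod p) (u + b) = 1} : Finset (ZMod p)) ∪
      ({u : ZMod p | ∀ b ∈ B', quadraticChar (ZMod p) (u + b) = 1} : Finset (ZMod p)).image
        (fun u => e⁻¹ * u) := by
    intro u hu
    obtain ⟨c, hc0, hc⟩ := hU u hu
    rw [Finset.mem_union]
    rcases quadraticChar_dichotomy hc0 with h | h
    · left
      rw [Finset.mem_filter]
      refine ⟨Finset.mem_univ _, fun b hb => ?_⟩
      obtain ⟨i, hi, rfl⟩ := Finset.mem_image.mp hb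
      rw [Finset.mem_Icc] at hi
      rw [hc i hi.1 hi.2, h]
    · right
      rw [Finset.mem_image]
      refine ⟨e * u, ?_, by field_simp⟩
      rw [Finset.mem_filter]
      refine ⟨Finset.mem_univ _, fun b hb => ?_⟩
      obtain ⟨b', hb', rfl⟩ := Finset.mem_image.mp hb
      obtain ⟨i, hi, rfl⟩ := Finset.mem_image.mp hb'
      rw [Finset.mem_Icc] at hi
      rw [← mul_add, map_mul, he, hc i hi.1 hi.2, h]
      norm_num
  have h3 := (Finset.card_le_card hsub).trans (Finset.card_union_le _ _)
  have h4 : (#U : ℝ) ≤ #{u : ZMod p | ∀ b ∈ B, quadraticChar (ZMod p) (u + b) = 1} +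
      #{u : ZMod p | ∀ b ∈ B', quadraticChar (ZMod p) (u + b) = 1} := by
    exact_mod_cast h3.trans (Nat.add_le_add_left Finset.card_image_le _)
  linarith

end CharacterSums

section BoxBound

variable {r p : ℕ} [Fact p.Prime]

/-- The shifts of a ratio of points of a box of residues share the same quadratic character. -/
lemma exists_shifts_same_char_of_mem_ratioSet {N : Fin r → ℕ} {d : Fin r → ZMod p} {x₀ : ZMod p}
    {k : ℕ} (hr : 0 < r) (hk : 0 < k) (hN : ∀ j, 0 < N j)
    (hproper : ∀ x : Fin r → ℤ, (∀ j, |x j| < N j) → linForm d x = 0 → x = 0)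
    (hG : ∀ i : Fin r → ℤ, (∀ j, 0 ≤ i j ∧ i j < N j) →
      quadraticChar (ZMod p) (x₀ + linForm d i) = 1)
    {u : ZMod p} (hu : u ∈ ratioSet d x₀ N (4 * k * r)) :
    ∃ c : ZMod p, c ≠ 0 ∧ ∀ b : ℕ, 1 ≤ b → b ≤ k →
      quadraticChar (ZMod p) (u + b) = quadraticChar (ZMod p) c := by
  rw [ratioSet, Finset.mem_image] at hu
  obtain ⟨z, hz, rfl⟩ := hu
  rw [Finset.mem_product] at hz
  have hkr : 0 < k * r := Nat.mul_pos hk hr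
  have hc := linForm_ne_zero_of_mem_cornerBox hN (by rw [mul_assoc]; omega) hproper hz.2
  refine ⟨_, hc, fun b _ hb => ?_⟩
  have h1 : quadraticChar (ZMod p) (x₀ + linForm d (z.1 + (b : ℤ) • z.2)) = 1 := by
    refine hG _ fun j => ?_
    obtain ⟨h1, h2⟩ := mem_cornerBox.mp hz.1 j
    obtain ⟨h3, h4⟩ := mem_cornerBox.mp (Finset.mem_of_mem_erase hz.2) j
    set M : ℕ := N j / (4 * k * r) with hM
    have h5 : 4 * k * r * M ≤ N j := Nat.mul_div_le _ _
    have h6 : 4 * (k * M) ≤ N j := by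
      refine le_trans ?_ h5
      calc 4 * (k * M) = 4 * k * 1 * M := by ring
        _ ≤ 4 * k * r * M := by gcongr; omega
    have h7 : M ≤ k * M := Nat.le_mul_of_pos_left _ hk
    have h8 : (b : ℤ) * z.2 j ≤ (k * M : ℕ) := by
      push_cast
      gcongr
    have h9 : 0 ≤ (b : ℤ) * z.2 j := by positivity
    have := hN j
    simp only [Pi.add_apply, Pi.smul_apply, smul_eq_mul]
    omega
  have h2 : ((x₀ + linForm d z.1) / linForm d z.2 + b) * linForm d z.2 =
      x₀ + linForm d (z.1 + (b : ℤ) • z.2) := by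
    rw [map_add, map_smul, zsmul_eq_mul]
    push_cast
    field_simp
    ring
  rw [← h2, map_mul] at h1
  rcases quadraticChar_dichotomy hc with h | h
  · rw [h] at h1 ⊢
    linarith
  · rw [h] at h1 ⊢
    linarith

/-- The volume of a proper box of quadratic residues, in terms of the number `k` of shifts. -/
lemma sq_prod_le_of_residue_box {N : Fin r → ℕ} {d : Fin r → ZMod p} {x₀ : ZMod p}
    {k τ : ℕ} (hp2 : p ≠ 2) (hr : 0 < r) (hk : 0 < k) (hkp : k < p) (hN : ∀ j, 0 < N j)
    (hproper : ∀ x : Fin r → ℤ, (∀ j, |x j| < N j) → linForm d x = 0 → x = 0)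
    (hG : ∀ i : Fin r → ℤ, (∀ j, 0 ≤ i j ∧ i j < N j) →
      quadraticChar (ZMod p) (x₀ + linForm d i) = 1)
    (hp : (∏ j, N j) ^ 2 ≤ p) (hbig : (4 * k * r) ^ r < ∏ j, N j) (hτ : ratioThreshold r ≤ τ)
    (hτ' : 4 * ratioConst r * (4 * k * r) ^ (2 * r) * (1 + Real.log p) ≤ τ) :
    ((∏ j, N j : ℕ) : ℝ) ^ 2 ≤
      (4 * k * r) ^ (2 * r) * (4 * τ * (2 * (p / 2 ^ k + 41 * k * √p))) := by
  refine (sq_prod_le_card_ratioSet (x₀ := x₀) hr hk hN hproper hp (fun i hi h => ?_)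
    hbig hτ hτ').trans ?_
  · have hkr : 0 < k * r := Nat.mul_pos hk hr
    have := hG i fun j => by
      obtain ⟨h1, h2⟩ := mem_cornerBox.mp hi j
      have h3 : N j / (4 * k * r) ≤ N j / 2 :=
        Nat.div_le_div_left (by rw [mul_assoc]; omega) (by norm_num)
      have := hN j
      omega
    rw [h] at this
    simp at this
  · have := card_le_of_shifts_same_char hp2 hkp fun u hu =>
      exists_shifts_same_char_of_mem_ratioSet (x₀ := x₀) hr hk hN hproper hG hu
    gcongr

lemma pow_mul_pow_le_pow {L a b : ℝ} {r i j n : ℕ} (hL : 1 ≤ L) (ha0 : 0 ≤ a)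
    (ha : a ≤ L ^ (i * r)) (hb : b ≤ L ^ (j * r)) (h : i + j ≤ n) : a * b ≤ L ^ (n * r) := by
  calc a * b ≤ L ^ (i * r) * L ^ (j * r) :=
        mul_le_mul_of_nonneg ha hb ha0 (by positivity)
    _ = L ^ ((i + j) * r) := by rw [← pow_add, add_mul]
    _ ≤ L ^ (n * r) := pow_le_pow_right₀ hL (Nat.mul_le_mul_right _ h)

lemma pow_mul_le_pow {L a : ℝ} {i : ℕ} (ha0 : 0 ≤ a) (ha : a ≤ L ^ i) (j r : ℕ) :
    a ^ (j * r) ≤ L ^ (i * j * r) := by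
  rw [mul_assoc, pow_mul L i]
  gcongr

lemma const_le_pow {L a : ℝ} (hL : 1 ≤ L) (ha : a ≤ L) (hr : 0 < r) : a ≤ L ^ (1 * r) := by
  rw [one_mul]
  exact ha.trans (le_self_pow₀ hL hr.ne')

variable {L : ℝ}

lemma pointLoss_le (hL : 1000 ≤ L) (hr : 0 < r) (hrL : r ≤ L) : pointLoss r ≤ L ^ (2 * r) := by
  have hr1 : (1 : ℝ) ≤ r := by exact_mod_cast hr
  have := pow_mul_le_pow (L := L) (a := 2 * ((r : ℝ) + 1)) (i := 2) (by positivity)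
    (by nlinarith) 1 r
  simpa [pointLoss] using this

lemma momentLoss_le (hL : 1000 ≤ L) (hr : 0 < r) (hrL : r ≤ L) : momentLoss r ≤ L ^ (11 * r) := by
  have hr1 : (1 : ℝ) ≤ r := by exact_mod_cast hr
  have hL1 : 1 ≤ L := by linarith
  have h1 : (2 : ℝ) ≤ L ^ (1 * r) := const_le_pow hL1 (by linarith) hr
  have h2 : (72 : ℝ) ^ (2 * r) ≤ L ^ (2 * r) := by gcongr; linarith
  have h3 : pointLoss r ^ 2 ≤ L ^ (4 * r) := by
    have := one_le_pointLoss r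
    calc pointLoss r ^ 2 ≤ (L ^ (2 * r)) ^ 2 := by gcongr; exact pointLoss_le hL hr hrL
      _ = _ := by rw [← pow_mul]; congr 1; ring
  have h4 : pointLoss (2 * r) ≤ L ^ (4 * r) := by
    have := pow_mul_le_pow (L := L) (a := 2 * (2 * (r : ℝ) + 1)) (i := 2) (by positivity)
      (by nlinarith) 2 r
    simpa [pointLoss] using this
  rw [momentLoss]
  exact pow_mul_pow_le_pow hL1 (by positivity)
    (pow_mul_pow_le_pow (n := 7) hL1 (by positivity)
      (pow_mul_pow_le_pow (n := 3) hL1 (by positivity) h1 h2 le_rfl) h3 le_rfl) h4 le_rfl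

lemma ratioThreshold_le (hL : 1000 ≤ L) (hr : 0 < r) (hrL : r ≤ L) :
    ratioThreshold r ≤ L ^ (16 * r) := by
  have hL1 : 1 ≤ L := by linarith
  have h1 : (36 : ℝ) ^ r ≤ L ^ (1 * r) := by rw [one_mul]; gcongr; linarith
  have h3 : pointLoss r ^ 2 ≤ L ^ (4 * r) := by
    have := one_le_pointLoss r
    calc pointLoss r ^ 2 ≤ (L ^ (2 * r)) ^ 2 := by gcongr; exact pointLoss_le hL hr hrL
      _ = _ := by rw [← pow_mul]; congr 1; ring
  have := two_le_momentLoss r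
  rw [ratioThreshold]
  exact pow_mul_pow_le_pow hL1 (by positivity)
    (pow_mul_pow_le_pow (n := 12) hL1 (by positivity) h1 (momentLoss_le hL hr hrL) le_rfl)
    h3 le_rfl

lemma ratioConst_le (hL : 1000 ≤ L) (hr : 0 < r) (hrL : r ≤ L) :
    ratioConst r ≤ L ^ (34 * r) := by
  have hr1 : (1 : ℝ) ≤ r := by exact_mod_cast hr
  have hL1 : 1 ≤ L := by linarith
  have h1 : (2 : ℝ) ≤ L ^ (1 * r) := const_le_pow hL1 (by linarith) hr
  have h2 : (2 * (r : ℝ) + 3) ^ r ≤ L ^ (2 * r) := by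
    rw [pow_mul]
    gcongr
    nlinarith
  have h3 : momentLoss r ^ 2 ≤ L ^ (22 * r) := by
    have := two_le_momentLoss r
    calc momentLoss r ^ 2 ≤ (L ^ (11 * r)) ^ 2 := by gcongr; exact momentLoss_le hL hr hrL
      _ = _ := by rw [← pow_mul]; congr 1; ring
  have h4 : pointLoss r ^ 4 ≤ L ^ (8 * r) := by
    have := one_le_pointLoss r
    calc pointLoss r ^ 4 ≤ (L ^ (2 * r)) ^ 4 := by gcongr; exact pointLoss_le hL hr hrL
      _ = _ := by rw [← pow_mul]; congr 1; ring
  have h5 : (324 : ℝ) ^ r ≤ L ^ (1 * r) := by rw [one_mul]; gcongr; linarith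
  have := two_le_momentLoss r
  have := one_le_pointLoss r
  rw [ratioConst]
  exact pow_mul_pow_le_pow hL1 (by positivity)
    (pow_mul_pow_le_pow (n := 33) hL1 (by positivity)
      (pow_mul_pow_le_pow (n := 25) hL1 (by positivity)
        (pow_mul_pow_le_pow (n := 3) hL1 (by positivity) h1 h2 le_rfl) h3 le_rfl) h4 le_rfl)
    h5 le_rfl

/-- The volume of a proper box of quadratic residues of rank `r` is at most
`(log p)^(O(r)) p^(1/4)`. -/
theorem sq_prod_le_logb_pow_mul_sqrt {N : Fin r → ℕ} {d : Fin r → ZMod p} {x₀ : ZMod p}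
    (hr : 0 < r) (hN : ∀ j, 0 < N j)
    (hproper : ∀ x : Fin r → ℤ, (∀ j, |x j| < N j) → linForm d x = 0 → x = 0)
    (hG : ∀ i : Fin r → ℤ, (∀ j, 0 ≤ i j ∧ i j < N j) →
      quadraticChar (ZMod p) (x₀ + linForm d i) = 1)
    (hp : (∏ j, N j) ^ 2 ≤ p) (hL : 1000 ≤ Real.logb 2 p) (hrL : r ≤ Real.logb 2 p)
    (hbig : Real.logb 2 p ^ (3 * r) < (∏ j, N j : ℕ)) :
    ((∏ j, N j : ℕ) : ℝ) ^ 2 ≤ Real.logb 2 p ^ (52 * r) * √p := by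
  set L := Real.logb 2 p with hLdef
  set k := ⌈L / 2⌉₊ with hk
  have hL1 : 1 ≤ L := by linarith
  have hr1 : (1 : ℝ) ≤ r := by exact_mod_cast hr
  have hp0 : (0 : ℝ) < p := by exact_mod_cast (Fact.out : p.Prime).pos
  have hpL : (2 : ℝ) ^ L = p := Real.rpow_logb (by norm_num) (by norm_num) hp0
  have hk1 : L / 2 ≤ k := Nat.le_ceil _
  have hk2 : (k : ℝ) < L / 2 + 1 := Nat.ceil_lt_add_one (by linarith)
  have hk0 : 0 < k := by
    have : (0 : ℝ) < k := by linarith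
    exact_mod_cast this
  have hkL : (k : ℝ) ≤ L := by linarith
  have hLp : L < p := by
    rw [hLdef, Real.logb_lt_iff_lt_rpow (by norm_num) hp0, Real.rpow_natCast]
    exact_mod_cast Nat.lt_two_pow_self
  have hsqrt : √(p : ℝ) ≤ 2 ^ k := by
    rw [Real.sqrt_eq_rpow, ← hpL, ← Real.rpow_mul (by norm_num), ← Real.rpow_natCast]
    exact Real.rpow_le_rpow_of_exponent_le (by norm_num) (by linarith)
  have hsq : √(p : ℝ) * √(p : ℝ) = p := Real.mul_self_sqrt hp0.le
  have hs0 : 0 < √(p : ℝ) := Real.sqrt_pos.mpr hp0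
  have hdiv : (p : ℝ) / 2 ^ k ≤ √p := by
    rw [div_le_iff₀ (by positivity)]
    nlinarith
  have hlog : Real.log p ≤ L := by
    rw [hLdef, Real.logb, le_div_iff₀ (Real.log_pos (by norm_num))]
    have h1 : Real.log 2 ≤ 1 := by
      have := Real.log_two_lt_d9
      linarith
    exact mul_le_of_le_one_right (Real.log_nonneg (by
      exact_mod_cast (Fact.out : p.Prime).one_lt.le)) h1
  have hq : (4 * k * r : ℝ) ≤ L ^ 3 := by
    calc (4 * k * r : ℝ) ≤ L * L * L := by gcongr; linarith
      _ = L ^ 3 := by ring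
  have hq2 : (4 * k * r : ℝ) ^ (2 * r) ≤ L ^ (6 * r) := pow_mul_le_pow (by positivity) hq 2 r
  have hC := ratioConst_le hL hr hrL
  have hC0 : 0 ≤ ratioConst r := by
    have := two_le_momentLoss r
    have := one_le_pointLoss r
    unfold ratioConst
    positivity
  have hlog0 : 0 ≤ Real.log p :=
    Real.log_nonneg (by exact_mod_cast (Fact.out : p.Prime).one_lt.le)
  have hfour : (4 : ℝ) ≤ L ^ (1 * r) := const_le_pow hL1 (by linarith) hr
  have hlogL : 1 + Real.log p ≤ L ^ (2 * r) := by
    calc 1 + Real.log p ≤ L ^ 2 := by nlinarith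
      _ ≤ L ^ (2 * r) := pow_le_pow_right₀ hL1 (by omega)
  have hτ' : 4 * ratioConst r * (4 * k * r) ^ (2 * r) * (1 + Real.log p) ≤ L ^ (43 * r) :=
    pow_mul_pow_le_pow hL1 (by positivity)
      (pow_mul_pow_le_pow (n := 41) hL1 (by positivity)
        (pow_mul_pow_le_pow (n := 35) hL1 (by positivity) hfour hC le_rfl) hq2 le_rfl)
      hlogL le_rfl
  set τ := ⌈L ^ (43 * r)⌉₊ with hτdef
  have hτ1 : L ^ (43 * r) ≤ τ := Nat.le_ceil _
  have hτ2 : (τ : ℝ) ≤ L ^ (44 * r) := by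
    have h1 : (τ : ℝ) < L ^ (43 * r) + 1 := Nat.ceil_lt_add_one (by positivity)
    have h2 : 1 ≤ L ^ (43 * r) := one_le_pow₀ hL1
    have h3 := pow_mul_pow_le_pow (n := 44) (i := 1) (j := 43) (r := r) (a := 2) hL1 (by norm_num)
      (const_le_pow hL1 (by linarith) hr) (le_refl (L ^ (43 * r))) le_rfl
    linarith
  have hmain := sq_prod_le_of_residue_box (k := k) (τ := τ) (x₀ := x₀) (d := d) (N := N)
    (by
      rintro rfl
      norm_num at hLdef
      linarith) hr hk0 (by exact_mod_cast hkL.trans_lt hLp) hN hproper hG hp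
    (by
      have h1 : (4 * k * r : ℝ) ^ r ≤ L ^ (3 * r) := by
        rw [pow_mul]
        gcongr
      exact_mod_cast h1.trans_lt hbig)
    (((ratioThreshold_le hL hr hrL).trans (pow_le_pow_right₀ hL1 (by omega))).trans hτ1)
    (hτ'.trans hτ1)
  refine hmain.trans ?_
  have hfin : 2 * ((p : ℝ) / 2 ^ k + 41 * k * √p) ≤ 84 * L * √p := by
    have h1 : 41 * (k : ℝ) * √p ≤ 41 * L * √p := by gcongr
    have h2 : √(p : ℝ) ≤ L * √p := le_mul_of_one_le_left hs0.le hL1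
    linarith
  have h336 : 336 * L ≤ L ^ (2 * r) := by
    calc 336 * L ≤ L ^ 2 := by nlinarith
      _ ≤ L ^ (2 * r) := pow_le_pow_right₀ hL1 (by omega)
  calc (4 * k * r : ℝ) ^ (2 * r) * (4 * τ * (2 * (p / 2 ^ k + 41 * k * √p)))
      ≤ L ^ (6 * r) * (4 * τ * (84 * L * √p)) := by gcongr
    _ = L ^ (6 * r) * τ * (336 * L) * √p := by ring
    _ ≤ L ^ (52 * r) * √p := by
        gcongr
        exact pow_mul_pow_le_pow hL1 (by positivity)
          (pow_mul_pow_le_pow (n := 50) hL1 (by positivity) le_rfl hτ2 le_rfl) h336 le_rfl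

end BoxBound

section Progressions

variable {r p : ℕ} [Fact p.Prime]

lemma IsAP.exists_eq_image_range_card {H : Finset (ZMod p)} (hH : IsAP p H) (hne : H.Nonempty) :
    ∃ a d : ZMod p, H = (Finset.range #H).image fun i : ℕ => a + (i : ZMod p) * d := by
  obtain ⟨a, d, k, hk⟩ := hH
  have hk0 : 0 < k := by
    obtain ⟨x, hx⟩ := hne
    rw [hk, Finset.mem_image] at hx
    obtain ⟨i, hi, -⟩ := hx
    rw [Finset.mem_range] at hi
    omega
  have hinj : d ≠ 0 → ∀ n ≤ p, #((Finset.range n).image fun i : ℕ => a + (i : ZMod p) * d) = n := by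
    intro hd n hn
    rw [Finset.card_image_of_injOn, Finset.card_range]
    intro i hi j hj hij
    rw [Finset.coe_range, Set.mem_Iio] at hi hj
    have h1 : (i : ZMod p) = j := mul_right_cancel₀ hd (add_left_cancel hij)
    exact CharP.natCast_injOn_Iio (ZMod p) p (Set.mem_Iio.mpr (by omega))
      (Set.mem_Iio.mpr (by omega)) h1
  by_cases hd : d = 0
  · refine ⟨a, 0, ?_⟩
    have h1 : H = {a} := by
      rw [hk, hd]
      ext x
      simp only [mul_zero, add_zero, Finset.mem_image, Finset.mem_range, Finset.mem_singleton]
      exact ⟨fun ⟨_, _, h⟩ => h.symm, fun h => ⟨0, hk0, h.symm⟩⟩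
    rw [h1]
    simp
  · refine ⟨a, d, ?_⟩
    by_cases hkp : k ≤ p
    · have : #H = k := by rw [hk, hinj hd k hkp]
      rw [this]
      exact hk
    · push Not at hkp
      have h1 : ((Finset.range p).image fun i : ℕ => a + (i : ZMod p) * d) = Finset.univ := by
        rw [← Finset.card_eq_iff_eq_univ, hinj hd p le_rfl, ZMod.card]
      have h2 : H = Finset.univ := by
        rw [hk, Finset.eq_univ_iff_forall]
        intro x
        have hx : x ∈ ((Finset.range p).image fun i : ℕ => a + (i : ZMod p) * d) := by
          rw [h1]; exact Finset.mem_univ x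
        exact Finset.image_subset_image (Finset.range_mono hkp.le) hx
      rw [h2, Finset.card_univ, ZMod.card, h1]

/-- A nonempty proper progression is parametrised injectively by a box. -/
lemma IsProperGAP.exists_box {G : Finset (ZMod p)} (hG : IsProperGAP p r G) (hne : G.Nonempty) :
    ∃ (N : Fin r → ℕ) (d : Fin r → ZMod p) (x₀ : ZMod p), (∀ j, 0 < N j) ∧ #G = ∏ j, N j ∧
      (∀ x : Fin r → ℤ, (∀ j, |x j| < N j) → linForm d x = 0 → x = 0) ∧
      ∀ i : Fin r → ℤ, (∀ j, 0 ≤ i j ∧ i j < N j) → x₀ + linForm d i ∈ G := by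
  obtain ⟨P, hAP, hsum, hcard⟩ := hG
  have himg : G = (Fintype.piFinset P).image fun g => ∑ j, g j := by
    ext x
    rw [hsum, ← Finset.mem_coe, Finset.coe_sum, Set.mem_fintype_sum, Finset.mem_image]
    constructor
    · rintro ⟨g, hg, rfl⟩
      exact ⟨g, Fintype.mem_piFinset.mpr hg, rfl⟩
    · rintro ⟨g, hg, rfl⟩
      exact ⟨g, Fintype.mem_piFinset.mp hg, rfl⟩
  have hinj : Set.InjOn (fun g : Fin r → ZMod p => ∑ j, g j) (Fintype.piFinset P) := by
    rw [← Finset.card_image_iff, ← himg, hcard, Fintype.card_piFinset]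
  have hpos : ∀ j, 0 < #(P j) := by
    have h1 : ∏ j, #(P j) ≠ 0 := by rw [← hcard]; exact (Finset.card_pos.mpr hne).ne'
    exact fun j => Nat.pos_of_ne_zero (Finset.prod_ne_zero_iff.mp h1 j (Finset.mem_univ j))
  choose a d had using fun j => (hAP j).exists_eq_image_range_card (Finset.card_pos.mp (hpos j))
  have hmem : ∀ i : Fin r → ℤ, (∀ j, 0 ≤ i j ∧ i j < #(P j)) →
      (fun j => a j + (i j : ZMod p) * d j) ∈ Fintype.piFinset P := by
    intro i hi
    rw [Fintype.mem_piFinset]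
    intro j
    rw [had j, Finset.mem_image]
    obtain ⟨h1, h2⟩ := hi j
    refine ⟨(i j).toNat, Finset.mem_range.mpr (by omega), ?_⟩
    rw [← Int.cast_natCast, Int.toNat_of_nonneg h1]
  have hval : ∀ i : Fin r → ℤ,
      ∑ j, (a j + (i j : ZMod p) * d j) = ∑ j, a j + linForm d i := fun i => by
    rw [Finset.sum_add_distrib, linForm_apply]
  refine ⟨fun j => #(P j), d, ∑ j, a j, hpos, hcard, ?_, ?_⟩
  · intro x hx h0
    set y : Fin r → ℤ := fun j => max (x j) 0 with hy
    set z : Fin r → ℤ := fun j => max (-x j) 0 with hz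
    have hyz : x = y - z := by
      ext j
      simp only [hy, hz, Pi.sub_apply]
      omega
    have hybd : ∀ j, 0 ≤ y j ∧ y j < #(P j) := fun j => by
      have h1 : -(#(P j) : ℤ) < x j ∧ x j < #(P j) := abs_lt.mp (hx j)
      have := hpos j
      simp only [hy]
      omega
    have hzbd : ∀ j, 0 ≤ z j ∧ z j < #(P j) := fun j => by
      have h1 : -(#(P j) : ℤ) < x j ∧ x j < #(P j) := abs_lt.mp (hx j)
      have := hpos j
      simp only [hz]
      omega
    have h1 : linForm d y = linForm d z := by
      rw [hyz, map_sub, sub_eq_zero] at h0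
      exact h0
    have h2 := hinj (hmem y hybd) (hmem z hzbd) (by
      simp only [hval, h1])
    rw [hyz, sub_eq_zero]
    ext j
    have h3 := congrFun h2 j
    have hinj' : Set.InjOn (fun i : ℕ => a j + (i : ZMod p) * d j) (Finset.range #(P j)) := by
      rw [← Finset.card_image_iff, ← had j, Finset.card_range]
    obtain ⟨hy1, hy2⟩ := hybd j
    obtain ⟨hz1, hz2⟩ := hzbd j
    have h4 : (y j).toNat = (z j).toNat := by
      refine hinj' (Finset.mem_coe.mpr (Finset.mem_range.mpr (by omega)))
        (Finset.mem_coe.mpr (Finset.mem_range.mpr (by omega))) ?_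
      simp only
      rw [← Int.cast_natCast, Int.toNat_of_nonneg hy1, ← Int.cast_natCast,
        Int.toNat_of_nonneg hz1]
      exact h3
    omega
  · intro i hi
    rw [himg, Finset.mem_image]
    exact ⟨_, hmem i hi, hval i⟩

/-- The sides of a box can be shrunk so that its volume is within a factor two of a target. -/
lemma exists_shrink {Q : ℝ} (hQ : 1 ≤ Q) (N : Fin r → ℕ) (hN : ∀ j, 0 < N j)
    (hle : Q ≤ (∏ j, N j : ℕ)) :
    ∃ N' : Fin r → ℕ, (∀ j, 0 < N' j) ∧ (∀ j, N' j ≤ N j) ∧ Q ≤ (∏ j, N' j : ℕ) ∧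
      ((∏ j, N' j : ℕ) : ℝ) ≤ 2 * Q := by
  induction hs : ∑ j, N j using Nat.strong_induction_on generalizing N with
  | _ s ih =>
    by_cases h2 : ((∏ j, N j : ℕ) : ℝ) ≤ 2 * Q
    · exact ⟨N, hN, fun _ => le_rfl, hle, h2⟩
    push Not at h2
    obtain ⟨j, hj⟩ : ∃ j, 2 ≤ N j := by
      by_contra! hcon
      have h3 : ∏ j, N j = 1 := Finset.prod_eq_one fun j _ => by
        have := hN j
        have := hcon j
        omega
      rw [h3] at h2
      norm_num at h2
      linarith
    set M := Function.update N j (N j - 1) with hM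
    have hMN : ∀ i, M i ≤ N i := fun i => by
      rw [hM, Function.update_apply]
      split_ifs with h
      · subst h; omega
      · exact le_rfl
    have hM0 : ∀ i, 0 < M i := fun i => by
      rw [hM, Function.update_apply]
      split_ifs with h
      · omega
      · exact hN i
    have hlt : ∑ i, M i < s := by
      rw [← hs]
      refine Finset.sum_lt_sum (fun i _ => hMN i) ⟨j, Finset.mem_univ j, ?_⟩
      rw [hM, Function.update_self]
      omega
    have hprod : ∏ i, N i ≤ 2 * ∏ i, M i := by
      rw [hM, Finset.prod_update_of_mem (Finset.mem_univ j),
        ← Finset.mul_prod_erase _ N (Finset.mem_univ j), ← mul_assoc, Finset.sdiff_singleton_eq_erase]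
      exact Nat.mul_le_mul_right _ (by omega)
    have hQM : Q ≤ (∏ i, M i : ℕ) := by
      have : ((∏ i, N i : ℕ) : ℝ) ≤ 2 * (∏ i, M i : ℕ) := by exact_mod_cast hprod
      linarith
    obtain ⟨N', h3, h4, h5, h6⟩ := ih _ hlt M hM0 hQM rfl
    exact ⟨N', h3, fun i => (h4 i).trans (hMN i), h5, h6⟩

end Progressions

theorem stmt9 :
    ∃ c₁ c₂ : ℝ, 0 < c₁ ∧ 0 < c₂ ∧
      ∀ (p : ℕ) [Fact p.Prime],
        0 < Real.logb 2 (Real.logb 2 p) →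
        ∀ ε : ℝ, 0 < ε → ε < 1 / 2 →
        ∀ (r : ℕ) (G : Finset (ZMod p)),
          IsProperGAP p r G →
          G ⊆ quadRes p →
          (r : ℝ) ≤ c₁ * ε ^ 3 * Real.logb 2 p / Real.logb 2 (Real.logb 2 p) →
          (G.card : ℝ) ≤ c₂ * (p : ℝ) ^ ((1 : ℝ) / 4 + ε) := by
  refine ⟨1 / 100, (2 : ℝ) ^ (1000 : ℝ), by norm_num, by positivity, ?_⟩
  intro p _ hLL ε hε hε2 r G hGAP hres hrank
  set L := Real.logb 2 p with hL
  set LL := Real.logb 2 L with hLLdef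
  have hp1 : (1 : ℝ) ≤ p := by exact_mod_cast (Fact.out : p.Prime).one_lt.le
  have hp0 : (0 : ℝ) < p := by linarith
  have hpL : (2 : ℝ) ^ L = p := Real.rpow_logb (by norm_num) (by norm_num) hp0
  have hone : 1 ≤ (p : ℝ) ^ ((1 : ℝ) / 4 + ε) := Real.one_le_rpow hp1 (by linarith)
  have htwo : (1 : ℝ) ≤ 2 ^ (1000 : ℝ) := Real.one_le_rpow (by norm_num) (by norm_num)
  by_cases hsmall : L < 1000
  · have h1 : (#G : ℝ) ≤ p := by
      have := Finset.card_le_univ G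
      rw [ZMod.card] at this
      exact_mod_cast this
    have h2 : (p : ℝ) ≤ 2 ^ (1000 : ℝ) := by
      rw [← hpL]
      exact Real.rpow_le_rpow_of_exponent_le (by norm_num) hsmall.le
    calc (#G : ℝ) ≤ 2 ^ (1000 : ℝ) * 1 := by linarith
      _ ≤ _ := by gcongr
  push Not at hsmall
  rcases Nat.eq_zero_or_pos r with hr0 | hr
  · subst hr0
    obtain ⟨P, -, -, hc⟩ := hGAP
    rw [hc]
    simp only [Finset.univ_eq_empty, Finset.prod_empty, Nat.cast_one]
    exact one_le_mul_of_one_le_of_one_le htwo hone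
  by_contra! hcon
  have hL0 : 0 < L := by linarith
  have hL1 : 1 ≤ L := by linarith
  have hLL1 : 1 ≤ LL := by
    rw [hLLdef, Real.le_logb_iff_rpow_le (by norm_num) hL0, Real.rpow_one]
    linarith
  have hrLL : r * LL ≤ 1 / 100 * ε ^ 3 * L := (le_div_iff₀ hLL).mp hrank
  have hε3 : ε ^ 3 ≤ ε / 4 := by
    have : ε ^ 2 ≤ 1 / 4 := by nlinarith
    nlinarith
  have hr1 : (1 : ℝ) ≤ r := by exact_mod_cast hr
  have hrL : (r : ℝ) ≤ L := by nlinarith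
  set δ := min ε (1 / 10) with hδ
  have hδ0 : 0 < δ := lt_min hε (by norm_num)
  have hδ2 : δ ≤ ε := min_le_left _ _
  have hδ1 : δ ≤ 1 / 10 := min_le_right _ _
  have hδε : 52 / 100 * ε ^ 3 < 2 * δ := by
    rcases min_choice ε (1 / 10) with h | h <;> rw [hδ, h] <;> nlinarith
  set Q := (p : ℝ) ^ ((1 : ℝ) / 4 + δ) with hQ
  have hQ1 : 1 ≤ Q := Real.one_le_rpow hp1 (by linarith)
  have hQ2 : Q ^ 2 = p ^ (2 * δ) * √p := by
    rw [Real.sqrt_eq_rpow, ← Real.rpow_add hp0, hQ, ← Real.rpow_natCast, ← Real.rpow_mul hp0.le]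
    congr 1
    push_cast
    ring
  have hQG : Q ≤ #G := by
    refine le_trans ?_ hcon.le
    calc Q ≤ (p : ℝ) ^ ((1 : ℝ) / 4 + ε) :=
          Real.rpow_le_rpow_of_exponent_le hp1 (by linarith)
      _ ≤ _ := le_mul_of_one_le_left (by linarith) htwo
  have hne : G.Nonempty := by
    rw [← Finset.card_pos]
    have : (0 : ℝ) < #G := (zero_lt_one.trans_le hQ1).trans_le hQG
    exact_mod_cast this
  obtain ⟨N₀, d, x₀, hN₀, hcard, hproper, hmem⟩ := hGAP.exists_box hne
  rw [hcard] at hQG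
  obtain ⟨N, hN, hNN, hlow, hup⟩ := exists_shrink hQ1 N₀ hN₀ hQG
  have hLpow : L ^ (52 * r) < (p : ℝ) ^ (2 * δ) := by
    have h1 : (2 : ℝ) ^ LL = L := Real.rpow_logb (by norm_num) (by norm_num) hL0
    rw [← Real.rpow_natCast]
    nth_rewrite 1 [← h1]
    rw [← hpL, ← Real.rpow_mul (by norm_num), ← Real.rpow_mul (by norm_num)]
    refine Real.rpow_lt_rpow_of_exponent_lt (by norm_num) ?_
    push_cast
    nlinarith
  have hsq : (∏ j, N j) ^ 2 ≤ p := by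
    have h1 : ((∏ j, N j : ℕ) : ℝ) ^ 2 ≤ (2 * Q) ^ 2 := by gcongr
    have h2 : (2 * Q) ^ 2 ≤ p := by
      have e1 : (4 : ℝ) ≤ (p : ℝ) ^ ((3 : ℝ) / 10) := by
        rw [← hpL, ← Real.rpow_mul (by norm_num)]
        calc (4 : ℝ) = 2 ^ (2 : ℝ) := by norm_num
          _ ≤ _ := Real.rpow_le_rpow_of_exponent_le (by norm_num) (by linarith)
      have e2 : Q ^ 2 ≤ (p : ℝ) ^ ((7 : ℝ) / 10) := by
        rw [hQ, ← Real.rpow_natCast, ← Real.rpow_mul hp0.le]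
        exact Real.rpow_le_rpow_of_exponent_le hp1 (by push_cast; linarith)
      calc (2 * Q) ^ 2 = 4 * Q ^ 2 := by ring
        _ ≤ (p : ℝ) ^ ((3 : ℝ) / 10) * (p : ℝ) ^ ((7 : ℝ) / 10) := by gcongr
        _ = p := by rw [← Real.rpow_add hp0]; norm_num
    exact_mod_cast h1.trans h2
  have hbig : L ^ (3 * r) < (∏ j, N j : ℕ) := by
    calc L ^ (3 * r) ≤ L ^ (52 * r) := pow_le_pow_right₀ hL1 (by omega)
      _ < (p : ℝ) ^ (2 * δ) := hLpow
      _ ≤ Q := Real.rpow_le_rpow_of_exponent_le hp1 (by linarith)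
      _ ≤ _ := hlow
  have hmain := sq_prod_le_logb_pow_mul_sqrt (x₀ := x₀) hr hN
    (fun x hx => hproper x fun j => (hx j).trans_le (by exact_mod_cast hNN j))
    (fun i hi => by
      have h1 := hres (hmem i fun j =>
        ⟨(hi j).1, (hi j).2.trans_le (by exact_mod_cast hNN j)⟩)
      rw [quadRes, Finset.mem_filter] at h1
      obtain ⟨-, y, hy, hy2⟩ := h1
      rw [← hy2]
      exact quadraticChar_sq_one' hy) hsq hsmall hrL hbig
  have hlt : L ^ (52 * r) * √p < Q ^ 2 := by
    rw [hQ2]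
    exact mul_lt_mul_of_pos_right hLpow (Real.sqrt_pos.mpr hp0)
  have hge : Q ^ 2 ≤ ((∏ j, N j : ℕ) : ℝ) ^ 2 := by gcongr
  linarith
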